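/- (Harnack inequality.) Let Ω ⊂ ℝⁿ be a bounded domain, Q = Ω × (0,T) a bounded cylinder, and L a nondivergence parabolic operator on Q with ellipticity constant ν. Let u be a nonnegative solution of Lu = 0 in Q, and let δ > 0 and λ < ∞ be constants such that Ω^δ is connected, diam(Ω) ≤ λδ, and T ≤ λδ². Then there exists N = N(n, ν, λ) such that for all X = (x,t) and Y = (y,s) in Q^δ = Ω^δ × (δ², T) with t − s ≥ δ², one has u(Y) ≤ N · u(X). -/

import Mathlib

open MeasureTheory Set Metric Filter

noncomputable section

/-- Euclidean space `ℝⁿ`. -/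
abbrev E (n : ℕ) : Type := EuclideanSpace ℝ (Fin n)

/-- Second spatial partial derivative `D_i D_j u` at a space-time point `X`. -/
def D2 {n : ℕ} (u : E n × ℝ → ℝ) (X : E n × ℝ) (i j : Fin n) : ℝ :=
  fderiv ℝ (fun x => fderiv ℝ (fun x' => u (x', X.2)) x (EuclideanSpace.single j 1))
    X.1 (EuclideanSpace.single i 1)

/-- Time derivative `D_t u` at a space-time point `X`. -/
def Dt {n : ℕ} (u : E n × ℝ → ℝ) (X : E n × ℝ) : ℝ :=
  deriv (fun t => u (X.1, t)) X.2

/-- The value `Lu(X)` of the nondivergence parabolic operator with coefficients `a`. -/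
def LVal {n : ℕ} (a : E n × ℝ → Fin n → Fin n → ℝ) (u : E n × ℝ → ℝ) (X : E n × ℝ) : ℝ :=
  (∑ i, ∑ j, a X i j * D2 u X i j) - Dt u X

/-- `u` is C² in `x` and C¹ in `t` at every point of `V`. -/
def ParabolicSmoothOn {n : ℕ} (u : E n × ℝ → ℝ) (V : Set (E n × ℝ)) : Prop :=
  ∀ X ∈ V, ContDiffAt ℝ 2 (fun x => u (x, X.2)) X.1 ∧
    DifferentiableAt ℝ (fun t => u (X.1, t)) X.2

/-- `u` solves `Lu = 0` pointwise in `V` (being C² in `x`, C¹ in `t` there). -/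
def SolvesL {n : ℕ} (a : E n × ℝ → Fin n → Fin n → ℝ) (u : E n × ℝ → ℝ)
    (V : Set (E n × ℝ)) : Prop :=
  ParabolicSmoothOn u V ∧ ∀ X ∈ V, LVal a u X = 0

/-- `a` is a smooth coefficient matrix on `S`, uniformly elliptic with constant `ν`
and with entries bounded by `ν⁻¹`. -/
def IsParabolicCoeff {n : ℕ} (ν : ℝ) (a : E n × ℝ → Fin n → Fin n → ℝ)
    (S : Set (E n × ℝ)) : Prop :=
  (∀ i j, ContDiffOn ℝ (⊤ : ℕ∞) (fun X => a X i j) S) ∧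
  ∀ X ∈ S, (∀ ξ : Fin n → ℝ, ν * ∑ i, ξ i ^ 2 ≤ ∑ i, ∑ j, a X i j * ξ i * ξ j) ∧
    ∀ i j, |a X i j| ≤ ν⁻¹

/-- The cylinder `Ω × (t₀, ∞)`. -/
def CylFrom {n : ℕ} (Ω : Set (E n)) (t₀ : ℝ) : Set (E n × ℝ) := Ω ×ˢ Ioi t₀

/-- The cylinder `Q = Ω × (0, ∞)`. -/
def Cyl {n : ℕ} (Ω : Set (E n)) : Set (E n × ℝ) := CylFrom Ω 0

/-- Parabolic boundary of the cylinder `Ω × (t₀, ∞)`: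
`(∂Ω × (t₀,∞)) ∪ (cl(Ω) × {t₀})`. -/
def pBFrom {n : ℕ} (Ω : Set (E n)) (t₀ : ℝ) : Set (E n × ℝ) :=
  (frontier Ω ×ˢ Ioi t₀) ∪ (closure Ω ×ˢ {t₀})

/-- Parabolic boundary of `Ω × (0, ∞)`. -/
def pB {n : ℕ} (Ω : Set (E n)) : Set (E n × ℝ) := pBFrom Ω 0

/-- The cylinder `C_{R,r}(Y) = B_R(y) × (s - r², s + r²)`. -/
def CRr {n : ℕ} (Y : E n × ℝ) (R r : ℝ) : Set (E n × ℝ) :=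
  ball Y.1 R ×ˢ Ioo (Y.2 - r ^ 2) (Y.2 + r ^ 2)

/-- The standard cylinder `C_r(Y) = B_r(y) × (s - r², s + r²)`. -/
def Cr {n : ℕ} (Y : E n × ℝ) (r : ℝ) : Set (E n × ℝ) := CRr Y r r

/-- `ω` is the `L`-caloric measure family for the cylinder `Ω × (t₀, ∞)`:
each `ω X` is a Borel probability measure on the parabolic boundary, and for every
bounded continuous `φ`, `X ↦ ∫ φ dω^X` is a (bounded) solution of `Lu = 0` in the
cylinder extending continuously to `φ` at each point of the parabolic boundary. -/
def IsCaloricMeasureFrom {n : ℕ} (a : E n × ℝ → Fin n → Fin n → ℝ) (Ω : Set (E n))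
    (t₀ : ℝ) (ω : E n × ℝ → Measure (E n × ℝ)) : Prop :=
  (∀ X ∈ CylFrom Ω t₀, IsProbabilityMeasure (ω X) ∧ ω X (pBFrom Ω t₀)ᶜ = 0) ∧
  ∀ φ : E n × ℝ → ℝ, Continuous φ → (∃ M, ∀ z, |φ z| ≤ M) →
    SolvesL a (fun X => ∫ z, φ z ∂ω X) (CylFrom Ω t₀) ∧
    ∀ Z ∈ pBFrom Ω t₀, Tendsto (fun X => ∫ z, φ z ∂ω X)
      (nhdsWithin Z (CylFrom Ω t₀)) (nhds (φ Z))

/-- `ω` is the `L`-caloric measure family for `Q = Ω × (0, ∞)`. -/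
def IsCaloricMeasure {n : ℕ} (a : E n × ℝ → Fin n → Fin n → ℝ) (Ω : Set (E n))
    (ω : E n × ℝ → Measure (E n × ℝ)) : Prop :=
  IsCaloricMeasureFrom a Ω 0 ω

/-- `Ω` is a Lipschitz domain with constants `m, r₀ > 0`: it is a nonempty open
connected set and near each boundary point, in a suitable orthonormal coordinate
system centered at that point, it coincides with the region above the graph of a
function with `‖∇φ‖_{L^∞} ≤ m` (equivalently, `m`-Lipschitz). -/
def IsLipschitzDomain {n : ℕ} (hn : 0 < n) (Ω : Set (E n)) (m r₀ : ℝ) : Prop :=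
  IsOpen Ω ∧ Ω.Nonempty ∧ IsConnected Ω ∧ 0 < m ∧ 0 < r₀ ∧
  ∀ y ∈ frontier Ω, ∃ (T : E n ≃ₗᵢ[ℝ] E n) (φ : E (n - 1) → ℝ),
    LipschitzWith m.toNNReal φ ∧
    ∀ x : E n, x ∈ Ω ∩ ball y r₀ ↔
      ‖x - y‖ < r₀ ∧
        φ ((EuclideanSpace.equiv (Fin (n - 1)) ℝ).symm
            (fun i => T (x - y) (Fin.castLE (Nat.sub_le n 1) i))) <
          T (x - y) ⟨n - 1, Nat.sub_lt hn Nat.one_pos⟩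

/-- The set `Ω^δ = {x ∈ Ω : dist(x, ∂Ω) > δ}`. -/
def innerSet {n : ℕ} (Ω : Set (E n)) (δ : ℝ) : Set (E n) :=
  {x ∈ Ω | δ < infDist x (frontier Ω)}

/-- The corkscrew property (2.3) with constant `μ`. -/
def Corkscrew {n : ℕ} (Ω : Set (E n)) (r₀ μ : ℝ) : Prop :=
  ∀ y ∈ frontier Ω, ∀ r : ℝ, 0 < r → r < r₀ →
    (∃ y₁ : E n, ball y₁ (2 * μ * r) ⊆ ball y r ∩ Ω) ∧
    (∃ y₂ : E n, ball y₂ (2 * μ * r) ⊆ ball y r \ Ω)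

/-- A constant matrix that is elliptic with constant `ν`. -/
def Ell {n : ℕ} (ν : ℝ) (a : Fin n → Fin n → ℝ) : Prop :=
  (∀ ξ : Fin n → ℝ, ν * ∑ i, ξ i ^ 2 ≤ ∑ i, ∑ j, a i j * ξ i * ξ j) ∧
    ∀ i j, |a i j| ≤ ν⁻¹

/-- Second partial derivatives of a function on `E n`. -/
def hs {n : ℕ} (f : E n → ℝ) (x : E n) (i j : Fin n) : ℝ :=
  fderiv ℝ (fun y => fderiv ℝ f y (EuclideanSpace.single j 1)) x (EuclideanSpace.single i 1)

/-- `∑ a_ij D_ij f`. -/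
def Lx {n : ℕ} (a : Fin n → Fin n → ℝ) (f : E n → ℝ) (x : E n) : ℝ :=
  ∑ i, ∑ j, a i j * hs f x i j

/-- Hessian as a bilinear form. -/
def hess {n : ℕ} (f : E n → ℝ) (x : E n) : E n →L[ℝ] E n →L[ℝ] ℝ := fderiv ℝ (fderiv ℝ f) x

theorem E_sum {n : ℕ} (v : E n) : v = ∑ i, v i • (EuclideanSpace.single i (1:ℝ) : E n) := by
  ext j
  simp [Finset.sum_apply, Pi.single_apply]

theorem cd_fderiv {n : ℕ} {f : E n → ℝ} {x : E n} (h : ContDiffAt ℝ 2 f x) :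
    ContDiffAt ℝ 1 (fderiv ℝ f) x := by
  exact h.fderiv_right (m := 1) (by norm_num)

theorem cd_diff {n : ℕ} {f : E n → ℝ} {x : E n} (h : ContDiffAt ℝ 2 f x) :
    DifferentiableAt ℝ (fderiv ℝ f) x := (cd_fderiv h).differentiableAt (by norm_num)

theorem cd_ev {n : ℕ} {f : E n → ℝ} {x : E n} (h : ContDiffAt ℝ 2 f x) :
    ∀ᶠ y in nhds x, ContDiffAt ℝ 2 f y := h.eventually (by norm_num)

theorem cd_d {n : ℕ} {f : E n → ℝ} {x : E n} (h : ContDiffAt ℝ 2 f x) :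
    DifferentiableAt ℝ f x := h.differentiableAt (by norm_num)

theorem hs_eq {n : ℕ} {f : E n → ℝ} {x : E n} (h : ContDiffAt ℝ 2 f x) (i j : Fin n) :
    hs f x i j = hess f x (EuclideanSpace.single i 1) (EuclideanSpace.single j 1) := by
  unfold hs hess
  have := ((cd_diff h).hasFDerivAt.clm_apply (hasFDerivAt_const (EuclideanSpace.single j (1:ℝ) : E n) x)).fderiv
  rw [this]; simp

theorem hess_symm {n : ℕ} {f : E n → ℝ} {x : E n} (h : ContDiffAt ℝ 2 f x) (v w : E n) :
    hess f x v w = hess f x w v := by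
  have := h.isSymmSndFDerivAt (by simp)
  exact this v w

theorem hs_symm {n : ℕ} {f : E n → ℝ} {x : E n} (h : ContDiffAt ℝ 2 f x) (i j : Fin n) :
    hs f x i j = hs f x j i := by
  rw [hs_eq h, hs_eq h, hess_symm h]

theorem hess_add {n : ℕ} {f g : E n → ℝ} {x : E n} (h : ContDiffAt ℝ 2 f x)
    (h' : ContDiffAt ℝ 2 g x) : hess (fun y => f y + g y) x = hess f x + hess g x := by
  unfold hess
  have : fderiv ℝ (fun y => f y + g y) =ᶠ[nhds x] fun y => fderiv ℝ f y + fderiv ℝ g y := by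
    filter_upwards [cd_ev h, cd_ev h'] with y hy hy'
    exact fderiv_fun_add (cd_d hy) (cd_d hy')
  rw [this.fderiv_eq, fderiv_fun_add (cd_diff h) (cd_diff h')]

theorem hess_smul {n : ℕ} {f : E n → ℝ} {x : E n} (c : ℝ) (h : ContDiffAt ℝ 2 f x) :
    hess (fun y => c * f y) x = c • hess f x := by
  unfold hess
  have : fderiv ℝ (fun y => c * f y) =ᶠ[nhds x] fun y => c • fderiv ℝ f y := by
    filter_upwards [cd_ev h] with y hy
    exact fderiv_const_mul (cd_d hy) c
  rw [this.fderiv_eq, fderiv_fun_const_smul (cd_diff h)]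

theorem hess_congr {n : ℕ} {f g : E n → ℝ} {x : E n} (h : f =ᶠ[nhds x] g) :
    hess f x = hess g x := by
  unfold hess
  exact (h.fderiv (𝕜 := ℝ)).fderiv_eq

theorem hs_congr {n : ℕ} {f g : E n → ℝ} {x : E n} (h : f =ᶠ[nhds x] g) (i j : Fin n) :
    hs f x i j = hs g x i j := by
  unfold hs
  have : (fun y => fderiv ℝ f y (EuclideanSpace.single j 1)) =ᶠ[nhds x]
    (fun y => fderiv ℝ g y (EuclideanSpace.single j 1)) := by
    filter_upwards [h.fderiv (𝕜 := ℝ)] with y hy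
    rw [hy]
  rw [this.fderiv_eq]

theorem hs_add {n : ℕ} {f g : E n → ℝ} {x : E n} (h : ContDiffAt ℝ 2 f x)
    (h' : ContDiffAt ℝ 2 g x) (i j : Fin n) :
    hs (fun y => f y + g y) x i j = hs f x i j + hs g x i j := by
  rw [hs_eq h, hs_eq h', hs_eq (h.add h'), hess_add h h']; simp

theorem hs_smul {n : ℕ} {f : E n → ℝ} {x : E n} (c : ℝ) (h : ContDiffAt ℝ 2 f x) (i j : Fin n) :
    hs (fun y => c * f y) x i j = c * hs f x i j := by
  rw [hs_eq h, hs_eq (contDiffAt_const.mul h), hess_smul c h]; simp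

theorem Lx_add {n : ℕ} (a : Fin n → Fin n → ℝ) {f g : E n → ℝ} {x : E n} (h : ContDiffAt ℝ 2 f x)
    (h' : ContDiffAt ℝ 2 g x) :
    Lx a (fun y => f y + g y) x = Lx a f x + Lx a g x := by
  unfold Lx
  simp_rw [hs_add h h', mul_add, Finset.sum_add_distrib]

theorem Lx_smul {n : ℕ} (a : Fin n → Fin n → ℝ) {f : E n → ℝ} {x : E n} (c : ℝ)
    (h : ContDiffAt ℝ 2 f x) :
    Lx a (fun y => c * f y) x = c * Lx a f x := by
  unfold Lx
  simp_rw [hs_smul c h, Finset.mul_sum]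
  congr 1; ext i; congr 1; ext j; ring

theorem Lx_congr {n : ℕ} (a : Fin n → Fin n → ℝ) {f g : E n → ℝ} {x : E n}
    (h : f =ᶠ[nhds x] g) : Lx a f x = Lx a g x := by
  unfold Lx
  simp_rw [hs_congr h]

theorem Lx_sub {n : ℕ} (a : Fin n → Fin n → ℝ) {f g : E n → ℝ} {x : E n} (h : ContDiffAt ℝ 2 f x)
    (h' : ContDiffAt ℝ 2 g x) :
    Lx a (fun y => f y - g y) x = Lx a f x - Lx a g x := by
  have e : (fun y => f y - g y) = fun y => f y + (-1) * g y := by ext y; ring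
  rw [e, Lx_add a h (contDiffAt_const.mul h'), Lx_smul a _ h']; ring

theorem hess_expand {n : ℕ} {f : E n → ℝ} {x : E n} (h : ContDiffAt ℝ 2 f x) (v : E n) :
    hess f x v v = ∑ i, ∑ j, hs f x i j * v i * v j := by
  conv_lhs => rw [E_sum v]
  simp only [map_sum, map_smul, _root_.sum_apply, _root_.smul_apply, smul_eq_mul, Finset.mul_sum]
  rw [Finset.sum_comm]
  refine Finset.sum_congr rfl fun i _ => Finset.sum_congr rfl fun j _ => ?_
  rw [hs_eq h]; ring

/-- Hessian at a local minimum is nonnegative. -/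
theorem hess_nonneg_of_min {n : ℕ} {f : E n → ℝ} {x : E n} (h : ContDiffAt ℝ 2 f x)
    (hm : IsLocalMin f x) (v : E n) : 0 ≤ hess f x v v := by
  set L : ℝ → E n := fun s => x + s • v with hL
  have hL0 : L 0 = x := by simp [hL]
  have hLd : ∀ s, HasDerivAt L v s := by
    intro s
    have := ((hasDerivAt_id s).smul_const v).const_add x
    simpa [hL] using this
  have hLc : Continuous L := by fun_prop
  have hLt : Tendsto L (nhds 0) (nhds x) := by
    have := hLc.tendsto 0; rwa [hL0] at this
  set g : ℝ → ℝ := fun s => f (L s) with hg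
  have hd1 : ∀ᶠ s in nhds (0:ℝ), deriv g s = fderiv ℝ f (L s) v := by
    filter_upwards [hLt.eventually (cd_ev h)] with s hs
    exact ((cd_d hs).hasFDerivAt.comp_hasDerivAt s (hLd s)).deriv
  have hd2 : deriv (deriv g) 0 = hess f x v v := by
    rw [Filter.EventuallyEq.deriv_eq (f := fun s => fderiv ℝ f (L s) v) hd1]
    have h1 : HasFDerivAt (fderiv ℝ f) (hess f x) (L 0) := by
      rw [hL0]; exact (cd_diff h).hasFDerivAt
    have h2 := h1.comp_hasDerivAt 0 (hLd 0)
    have h3 := h2.clm_apply (hasDerivAt_const (0:ℝ) v)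
    simpa using h3.deriv
  have hmin : IsLocalMin g 0 := by
    have : ∀ᶠ y in nhds x, f x ≤ f y := hm
    have := hLt.eventually this
    unfold IsLocalMin IsMinFilter
    simpa [hg, hL0] using this
  by_contra hneg
  push Not at hneg
  rw [← hd2] at hneg
  have hgd : deriv g 0 = 0 := hmin.deriv_eq_zero
  have hgc : ContinuousAt g 0 := by
    refine ContinuousAt.comp (f := L) (g := f) ?_ hLc.continuousAt
    rw [hL0]; exact h.continuousAt
  have hmax := isLocalMax_of_deriv_deriv_neg hneg hgd hgc
  have hconst : g =ᶠ[nhds 0] fun _ => g 0 := by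
    have h1 : ∀ᶠ y in nhds (0:ℝ), g 0 ≤ g y := hmin
    have h2 : ∀ᶠ y in nhds (0:ℝ), g y ≤ g 0 := hmax
    filter_upwards [h1, h2] with y a b
    exact le_antisymm b a
  have : deriv (deriv g) 0 = 0 := by
    rw [hconst.deriv.deriv_eq]; simp
  linarith

theorem fderiv_zero_of_min {n : ℕ} {f : E n → ℝ} {x : E n} 
    (hm : IsLocalMin f x) : fderiv ℝ f x = 0 := hm.fderiv_eq_zero

/-- quadratic forms: trace of a product of nonnegative forms. -/
theorem trace_mul_nonneg {n : ℕ} {a B : Fin n → Fin n → ℝ}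
    (ha : ∀ ξ : Fin n → ℝ, 0 ≤ ∑ i, ∑ j, a i j * ξ i * ξ j)
    (hB : ∀ ξ : Fin n → ℝ, 0 ≤ ∑ i, ∑ j, B i j * ξ i * ξ j)
    (hs : ∀ i j, B i j = B j i) : 0 ≤ ∑ i, ∑ j, a i j * B i j := by
  have hP : (Matrix.of B).PosSemidef := by
    refine Matrix.PosSemidef.of_dotProduct_mulVec_nonneg ?_ ?_
    · ext i j; simp [hs i j]
    · intro ξ
      have := hB ξ
      simp only [dotProduct, Matrix.mulVec, Matrix.of_apply, Finset.mul_sum, star_trivial]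
      refine this.trans (le_of_eq (Finset.sum_congr rfl fun i _ => Finset.sum_congr rfl fun j _ => ?_))
      ring
  obtain ⟨m, v, hv⟩ := Matrix.posSemidef_iff_eq_sum_vecMulVec.1 hP
  have : ∀ i j, B i j = ∑ k, v k i * v k j := by
    intro i j
    have := congrFun (congrFun hv i) j
    simpa [Matrix.sum_apply, Matrix.vecMulVec_apply] using this
  simp_rw [this, Finset.mul_sum]
  have e : ∑ i, ∑ j, ∑ k, a i j * (v k i * v k j) = ∑ k, ∑ i, ∑ j, a i j * v k i * v k j := by
    have : ∀ i, ∑ j, ∑ k, a i j * (v k i * v k j) = ∑ k, ∑ j, a i j * v k i * v k j := by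
      intro i; rw [Finset.sum_comm]; simp_rw [mul_assoc]
    simp_rw [this]; rw [Finset.sum_comm]
  rw [e]
  exact Finset.sum_nonneg fun k _ => ha (v k)

theorem Ell.psd {n : ℕ} {ν : ℝ} {a : Fin n → Fin n → ℝ} (h : Ell ν a) (hν : 0 < ν)
    (ξ : Fin n → ℝ) : 0 ≤ ∑ i, ∑ j, a i j * ξ i * ξ j :=
  le_trans (mul_nonneg hν.le (Finset.sum_nonneg fun i _ => sq_nonneg _)) (h.1 ξ)

theorem Ell.trace_le {n : ℕ} {ν : ℝ} {a : Fin n → Fin n → ℝ} (h : Ell ν a) :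
    ∑ i, a i i ≤ n * ν⁻¹ := by
  calc ∑ i, a i i ≤ ∑ i : Fin n, ν⁻¹ := Finset.sum_le_sum fun i _ => (le_abs_self _).trans (h.2 i i)
    _ = _ := by simp

theorem Ell.trace_ge {n : ℕ} {ν : ℝ} {a : Fin n → Fin n → ℝ} (h : Ell ν a) (hν : 0 < ν) :
    0 ≤ ∑ i, a i i := by
  refine Finset.sum_nonneg fun i _ => ?_
  have := h.psd hν (fun j => if j = i then 1 else 0)
  simpa using this

theorem Ell.trace_mul {n : ℕ} {ν : ℝ} {a B : Fin n → Fin n → ℝ} (h : Ell ν a)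
    (hB : ∀ ξ : Fin n → ℝ, 0 ≤ ∑ i, ∑ j, B i j * ξ i * ξ j)
    (hs : ∀ i j, B i j = B j i) : ν * ∑ i, B i i ≤ ∑ i, ∑ j, a i j * B i j := by
  have := trace_mul_nonneg (a := fun i j => a i j - if i = j then ν else 0) (B := B) ?_ hB hs
  · simp only [sub_mul, Finset.sum_sub_distrib, ite_mul, zero_mul, Finset.sum_ite_eq,
      Finset.mem_univ, if_true] at this
    rw [Finset.mul_sum]; linarith
  · intro ξ
    have := h.1 ξ
    simp only [sub_mul, Finset.sum_sub_distrib, ite_mul, zero_mul, Finset.sum_ite_eq,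
      Finset.mem_univ, if_true]
    rw [Finset.mul_sum] at this
    have e : ∑ i, ν * ξ i ^ 2 = ∑ i, ν * ξ i * ξ i := by congr 1; ext i; ring
    linarith

/-- Elliptic operator at a local min. -/
theorem Lx_nonneg_of_min {n : ℕ} {ν : ℝ} {a : Fin n → Fin n → ℝ} (ha : Ell ν a) (hν : 0 < ν)
    {f : E n → ℝ} {x : E n} (h : ContDiffAt ℝ 2 f x) (hm : IsLocalMin f x) : 0 ≤ Lx a f x := by
  unfold Lx
  refine trace_mul_nonneg (ha.psd hν) (fun ξ => ?_) (hs_symm h)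
  have := hess_nonneg_of_min h hm (WithLp.toLp 2 ξ)
  rw [hess_expand h] at this
  simpa using this

/-- Pointwise solutions of some elliptic-parabolic equation at each point of `V`. -/
def PS {n : ℕ} (ν : ℝ) (u : E n × ℝ → ℝ) (V : Set (E n × ℝ)) : Prop :=
  ∀ X ∈ V, ContDiffAt ℝ 2 (fun x => u (x, X.2)) X.1 ∧ DifferentiableAt ℝ (fun t => u (X.1, t)) X.2 ∧
    ∃ a : Fin n → Fin n → ℝ, Ell ν a ∧ Lx a (fun x => u (x, X.2)) X.1 = Dt u X

/-- One sided regularity in time, locally uniformly in space. -/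
def RR {n : ℕ} (u : E n × ℝ → ℝ) (V : Set (E n × ℝ)) : Prop :=
  ∀ (x0 : E n) (r τ β : ℝ), 0 < r → τ ≤ β → closedBall x0 r ×ˢ Icc τ β ⊆ V →
    ∃ K : ℝ, ∀ x ∈ closedBall x0 r, ∀ t ∈ Icc τ β, u (x, τ) - K * (t - τ) ≤ u (x, t)

/-- Both of the above. -/
def Sup {n : ℕ} (ν : ℝ) (u : E n × ℝ → ℝ) (V : Set (E n × ℝ)) : Prop := PS ν u V ∧ RR u V

theorem PS.mono {n : ℕ} {ν : ℝ} {u : E n × ℝ → ℝ} {V W : Set (E n × ℝ)} (h : PS ν u V)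
    (hW : W ⊆ V) : PS ν u W := fun X hX => h X (hW hX)

theorem RR.mono {n : ℕ} {u : E n × ℝ → ℝ} {V W : Set (E n × ℝ)} (h : RR u V)
    (hW : W ⊆ V) : RR u W := fun x0 r τ β hr ht hs => h x0 r τ β hr ht (hs.trans hW)

theorem Sup.mono {n : ℕ} {ν : ℝ} {u : E n × ℝ → ℝ} {V W : Set (E n × ℝ)} (h : Sup ν u V)
    (hW : W ⊆ V) : Sup ν u W := ⟨h.1.mono hW, h.2.mono hW⟩

theorem hess_comp_affine {n : ℕ} (f : E n → ℝ) (x0 x : E n) (r : ℝ)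
    (h : ContDiffAt ℝ 2 f (x0 + r • x)) :
    hess (fun y => f (x0 + r • y)) x = r ^ 2 • hess f (x0 + r • x) := by
  unfold hess
  have h1 : ∀ {F : Type} [NormedAddCommGroup F] [NormedSpace ℝ F] (g : E n → F) (y : E n),
      fderiv ℝ (fun y => g (x0 + r • y)) y = r • fderiv ℝ g (x0 + r • y) := by
    intro F _ _ g y
    have := fderiv_comp_smul (𝕜 := ℝ) (f := fun z => g (x0 + z)) (x := y) r
    rw [this, fderiv_comp_add_left]
  have : fderiv ℝ (fun y => f (x0 + r • y)) = fun y => r • fderiv ℝ f (x0 + r • y) := by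
    ext1 y; exact h1 f y
  rw [this]
  have h2 : (fun y => r • fderiv ℝ f (x0 + r • y)) = fun y => (fun z => r • fderiv ℝ f z) (x0 + r • y) := rfl
  rw [h2, h1 (fun z => r • fderiv ℝ f z) x]
  rw [fderiv_fun_const_smul (cd_diff h), smul_smul, pow_two]

/-- affine rescaling -/
def scl {n : ℕ} (u : E n × ℝ → ℝ) (x0 : E n) (t0 r c d : ℝ) : E n × ℝ → ℝ :=
  fun X => c * u (x0 + r • X.1, t0 + r ^ 2 * X.2) + d

theorem cd_affine {n : ℕ} {f : E n → ℝ} {x0 x : E n} {r : ℝ} (h : ContDiffAt ℝ 2 f (x0 + r • x)) :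
    ContDiffAt ℝ 2 (fun y => f (x0 + r • y)) x := by
  have h2 : ContDiffAt ℝ 2 (fun y : E n => x0 + r • y) x := by fun_prop
  exact ContDiffAt.comp x h h2

theorem PS.scl {n : ℕ} {ν : ℝ} {u : E n × ℝ → ℝ} {V : Set (E n × ℝ)} (h : PS ν u V)
    (x0 : E n) (t0 r c d : ℝ) :
    PS ν (scl u x0 t0 r c d) {X | (x0 + r • X.1, t0 + r ^ 2 * X.2) ∈ V} := by
  intro X hX
  obtain ⟨h1, h2, a, ha, h3⟩ := h _ hX
  have h1' := cd_affine (f := fun x => u (x, t0 + r ^ 2 * X.2)) h1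
  have h4 : HasDerivAt (fun t => u (x0 + r • X.1, t0 + r ^ 2 * t))
      (Dt u (x0 + r • X.1, t0 + r ^ 2 * X.2) * r ^ 2) X.2 := by
    have e1 : HasDerivAt (fun t : ℝ => t0 + r ^ 2 * t) (r ^ 2) X.2 := by
      simpa using ((hasDerivAt_id X.2).const_mul (r ^ 2)).const_add t0
    exact HasDerivAt.comp X.2 (h₂ := fun t => u (x0 + r • X.1, t)) h2.hasDerivAt e1
  have h5 : HasDerivAt (fun t => _root_.scl u x0 t0 r c d (X.1, t))
      (c * (Dt u (x0 + r • X.1, t0 + r ^ 2 * X.2) * r ^ 2)) X.2 := (h4.const_mul c).add_const d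
  refine ⟨(contDiffAt_const.mul h1').add contDiffAt_const, h5.differentiableAt, a, ha, ?_⟩
  have e : Dt (_root_.scl u x0 t0 r c d) X = c * (Dt u (x0 + r • X.1, t0 + r ^ 2 * X.2) * r ^ 2) := h5.deriv
  rw [e, ← h3]
  unfold _root_.scl
  rw [Lx_add a (contDiffAt_const.mul h1') contDiffAt_const, Lx_smul a c h1']
  have z : Lx a (fun _ : E n => d) X.1 = 0 := by
    unfold Lx hs; simp
  rw [z, add_zero]
  congr 1
  unfold Lx
  rw [Finset.sum_mul]
  refine Finset.sum_congr rfl fun i _ => ?_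
  rw [Finset.sum_mul]
  refine Finset.sum_congr rfl fun j _ => ?_
  rw [hs_eq h1', hs_eq h1, hess_comp_affine (fun x => u (x, t0 + r ^ 2 * X.2)) _ _ _ h1]
  simp; ring

theorem RR.scl {n : ℕ} {u : E n × ℝ → ℝ} {V : Set (E n × ℝ)} (h : RR u V)
    (x0 : E n) (t0 : ℝ) {r c : ℝ} (d : ℝ) (hr : 0 < r) (hc : 0 ≤ c) :
    RR (scl u x0 t0 r c d) {X | (x0 + r • X.1, t0 + r ^ 2 * X.2) ∈ V} := by
  intro x1 ρ τ β hρ hτ hV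
  have hr2 : 0 < r ^ 2 := by positivity
  obtain ⟨K, hK⟩ := h (x0 + r • x1) (r * ρ) (t0 + r ^ 2 * τ) (t0 + r ^ 2 * β) (by positivity)
    (by gcongr) (by
      rintro ⟨x, t⟩ ⟨hx, ht⟩
      have hm : (r⁻¹ • (x - x0), (r ^ 2)⁻¹ * (t - t0)) ∈ closedBall x1 ρ ×ˢ Icc τ β := by
        refine ⟨?_, ?_, ?_⟩
        · simp only [mem_closedBall, dist_eq_norm] at hx ⊢
          have : r⁻¹ • (x - x0) - x1 = r⁻¹ • (x - (x0 + r • x1)) := by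
            simp only [smul_sub, smul_add, smul_smul, inv_mul_cancel₀ hr.ne', one_smul]; abel
          rw [this, norm_smul, norm_inv, Real.norm_of_nonneg hr.le, inv_mul_le_iff₀ hr]
          exact hx
        · simp only [mem_Icc] at ht
          show τ ≤ (r ^ 2)⁻¹ * (t - t0)
          rw [le_inv_mul_iff₀ hr2]; linarith [ht.1]
        · simp only [mem_Icc] at ht
          show (r ^ 2)⁻¹ * (t - t0) ≤ β
          rw [inv_mul_le_iff₀ hr2]; linarith [ht.2]
      have := hV hm
      simp only [mem_ofPred_eq, smul_smul, mul_inv_cancel₀ hr.ne', one_smul,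
        mul_inv_cancel_left₀ hr2.ne'] at this
      simpa using this)
  refine ⟨c * (K * r ^ 2), fun x hx t ht => ?_⟩
  have := hK (x0 + r • x) (by
      simp only [mem_closedBall, dist_eq_norm] at hx ⊢
      rw [add_sub_add_left_eq_sub, ← smul_sub, norm_smul, Real.norm_of_nonneg hr.le]
      gcongr) (t0 + r ^ 2 * t) ⟨by gcongr; exact ht.1, by gcongr; exact ht.2⟩
  unfold _root_.scl
  simp only
  nlinarith [mul_le_mul_of_nonneg_left this hc]

theorem Sup.scl {n : ℕ} {ν : ℝ} {u : E n × ℝ → ℝ} {V : Set (E n × ℝ)} (h : Sup ν u V)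
    (x0 : E n) (t0 : ℝ) {r c : ℝ} (d : ℝ) (hr : 0 < r) (hc : 0 ≤ c) :
    Sup ν (scl u x0 t0 r c d) {X | (x0 + r • X.1, t0 + r ^ 2 * X.2) ∈ V} :=
  ⟨h.1.scl x0 t0 r c d, h.2.scl x0 t0 d hr hc⟩

theorem PS.neg {n : ℕ} {ν : ℝ} {u : E n × ℝ → ℝ} {V : Set (E n × ℝ)} (h : PS ν u V) :
    PS ν (fun X => - u X) V := by
  have := h.scl 0 0 1 (-1) 0
  have e : _root_.scl u 0 0 1 (-1) 0 = fun X => - u X := by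
    ext X; simp [_root_.scl]
  rw [e] at this
  simpa using this

theorem mem_scl_box {n : ℕ} {V : Set (E n × ℝ)} {x0 : E n} {t0 r R τ β : ℝ} (hr : 0 < r)
    (h : closedBall x0 (r * R) ×ˢ Icc (t0 + r ^ 2 * τ) (t0 + r ^ 2 * β) ⊆ V) :
    closedBall 0 R ×ˢ Icc τ β ⊆ {X : E n × ℝ | (x0 + r • X.1, t0 + r ^ 2 * X.2) ∈ V} := by
  rintro ⟨x, t⟩ ⟨hx, ht⟩
  have hr2 : 0 < r ^ 2 := by positivity
  refine h ⟨?_, ?_, ?_⟩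
  · simp only [mem_closedBall, dist_eq_norm, sub_zero, add_sub_cancel_left] at hx ⊢
    rw [norm_smul, Real.norm_of_nonneg hr.le]; gcongr
  · have := mul_le_mul_of_nonneg_left ht.1 hr2.le
    simpa using this
  · have := mul_le_mul_of_nonneg_left ht.2 hr2.le
    simpa using this

/-! explicit Hessians -/

theorem fderiv_normsq {n : ℕ} (y v : E n) : fderiv ℝ (fun x : E n => ‖x‖ ^ 2) y v = 2 * inner ℝ y v := by
  rw [fderiv_norm_sq_apply]; simp

theorem hs_normsq {n : ℕ} (c x : E n) (i j : Fin n) :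
    hs (fun x : E n => ‖x - c‖ ^ 2) x i j = if i = j then 2 else 0 := by
  unfold hs
  have e1 : (fun y => fderiv ℝ (fun x : E n => ‖x - c‖ ^ 2) y (EuclideanSpace.single j 1)) =
      fun y => 2 * (y j - c j) := by
    ext y
    have : fderiv ℝ (fun x : E n => ‖x - c‖ ^ 2) y = fderiv ℝ (fun x : E n => ‖x‖ ^ 2) (y - c) :=
      fderiv_comp_sub (f := fun x : E n => ‖x‖ ^ 2) c
    rw [this, fderiv_normsq]
    simp [EuclideanSpace.inner_single_right]
  rw [e1]
  have e2 : HasFDerivAt (fun y : E n => 2 * (y j - c j)) ((2:ℝ) • (EuclideanSpace.proj j : E n →L[ℝ] ℝ)) x := by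
    exact (((EuclideanSpace.proj j : E n →L[ℝ] ℝ).hasFDerivAt (x := x)).sub_const (c j)).const_mul 2
  rw [e2.fderiv]
  simp [Pi.single_apply, eq_comm]

theorem hs_bump {n : ℕ} (ρ : ℝ) (x : E n) (i j : Fin n) :
    hs (fun x : E n => (ρ - ‖x‖ ^ 2) ^ 2) x i j = 8 * (x i * x j) - (if i = j then 4 * (ρ - ‖x‖ ^ 2) else 0) := by
  unfold hs
  have hN : ∀ y : E n, HasFDerivAt (fun x : E n => ‖x‖ ^ 2) (fderiv ℝ (fun x : E n => ‖x‖ ^ 2) y) y := by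
    intro y
    exact ((contDiff_norm_sq ℝ (n := 1)).differentiable (by norm_num) y).hasFDerivAt
  have e1 : (fun y => fderiv ℝ (fun x : E n => (ρ - ‖x‖ ^ 2) ^ 2) y (EuclideanSpace.single j 1)) =
      fun y => (-4 * (ρ - ‖y‖ ^ 2)) * y j := by
    ext y
    have := (((hN y).const_sub ρ).pow 2).fderiv
    rw [this]
    simp only [_root_.smul_apply, _root_.neg_apply, fderiv_normsq]
    simp [EuclideanSpace.inner_single_right]
    ring
  rw [e1]
  have e2 : HasFDerivAt (fun y : E n => y j) (EuclideanSpace.proj j : E n →L[ℝ] ℝ) x :=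
    (EuclideanSpace.proj j : E n →L[ℝ] ℝ).hasFDerivAt
  have e3 := (((hN x).const_sub ρ).const_mul (-4)).fun_mul e2
  rw [e3.fderiv]
  simp only [_root_.add_apply, _root_.smul_apply, _root_.neg_apply, fderiv_normsq]
  simp [EuclideanSpace.inner_single_right, Pi.single_apply, eq_comm]
  split_ifs <;> ring

theorem Lx_normsq {n : ℕ} (a : Fin n → Fin n → ℝ) (c x : E n) :
    Lx a (fun x : E n => ‖x - c‖ ^ 2) x = 2 * ∑ i, a i i := by
  unfold Lx
  simp_rw [hs_normsq, mul_ite, mul_zero, Finset.sum_ite_eq, Finset.mem_univ, if_true, Finset.mul_sum,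
    mul_comm]

theorem Lx_bump {n : ℕ} (a : Fin n → Fin n → ℝ) (ρ : ℝ) (x : E n) :
    Lx a (fun x : E n => (ρ - ‖x‖ ^ 2) ^ 2) x =
      8 * (∑ i, ∑ j, a i j * x i * x j) - 4 * (ρ - ‖x‖ ^ 2) * ∑ i, a i i := by
  unfold Lx
  simp_rw [hs_bump, mul_sub, mul_ite, mul_zero, Finset.sum_sub_distrib, Finset.sum_ite_eq,
    Finset.mem_univ, if_true, Finset.mul_sum]
  congr 1
  · refine Finset.sum_congr rfl fun i _ => Finset.sum_congr rfl fun j _ => by ring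
  · refine Finset.sum_congr rfl fun i _ => by ring

theorem Lx_lin {n : ℕ} (a : Fin n → Fin n → ℝ) (l : E n →L[ℝ] ℝ) (x : E n) :
    Lx a (fun y => l y) x = 0 := by
  unfold Lx hs; simp [ContinuousLinearMap.fderiv]

theorem Lx_const {n : ℕ} (a : Fin n → Fin n → ℝ) (c : ℝ) (x : E n) :
    Lx a (fun _ => c) x = 0 := by
  unfold Lx hs; simp

theorem PS.contx {n : ℕ} {ν : ℝ} {u : E n × ℝ → ℝ} {V : Set (E n × ℝ)} (h : PS ν u V)
    {x : E n} {t : ℝ} (hX : (x, t) ∈ V) : ContinuousAt (fun x => u (x, t)) x :=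
  (h _ hX).1.continuousAt

theorem PS.contt {n : ℕ} {ν : ℝ} {u : E n × ℝ → ℝ} {V : Set (E n × ℝ)} (h : PS ν u V)
    {x : E n} {t : ℝ} (hX : (x, t) ∈ V) : ContinuousAt (fun t => u (x, t)) t :=
  (h _ hX).2.1.continuousAt

/-- right lower uniform semicontinuity in time -/
def RLU {n : ℕ} (v : E n × ℝ → ℝ) (B : Set (E n)) (a b : ℝ) : Prop :=
  ∀ τ ∈ Icc a b, ∀ ε > 0, ∃ η > 0, ∀ x ∈ B, ∀ t ∈ Icc a b, τ ≤ t → t < τ + η →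
    v (x, τ) - ε ≤ v (x, t)

theorem RLU.add_cont {n : ℕ} {u g : E n × ℝ → ℝ} {x0 : E n} {R a b : ℝ} (hR : 0 < R)
    (hu : RR u (closedBall x0 R ×ˢ Icc a b)) (hg : Continuous g) :
    RLU (fun X => u X + g X) (closedBall x0 R) a b := by
  intro τ hτ ε hε
  obtain ⟨K, hK⟩ := hu x0 R τ b hR hτ.2 (prod_mono le_rfl (Icc_subset_Icc_left hτ.1))
  have hc : IsCompact (closedBall x0 R ×ˢ Icc a b) := (isCompact_closedBall x0 R).prod isCompact_Icc
  have huc := hc.uniformContinuousOn_of_continuous hg.continuousOn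
  rw [Metric.uniformContinuousOn_iff] at huc
  obtain ⟨η, hη, h2⟩ := huc (ε / 2) (by positivity)
  refine ⟨min η (ε / 2 / (|K| + 1)), by positivity, fun x hx t ht h1 h3 => ?_⟩
  have h4 := hK x hx t ⟨h1, ht.2⟩
  have h5 := h2 (x, τ) ⟨hx, hτ⟩ (x, t) ⟨hx, ht⟩ (by
    rw [Prod.dist_eq]; simp only [dist_self]
    rw [max_eq_right dist_nonneg, Real.dist_eq, abs_sub_comm, abs_of_nonneg (by linarith)]
    have := min_le_left η (ε / 2 / (|K| + 1)); linarith)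
  rw [Real.dist_eq, abs_lt] at h5
  have h6 : K * (t - τ) ≤ ε / 2 := by
    have h7 : t - τ ≤ ε / 2 / (|K| + 1) := by
      have := min_le_right η (ε / 2 / (|K| + 1)); linarith
    calc K * (t - τ) ≤ (|K| + 1) * (t - τ) := by
          apply mul_le_mul_of_nonneg_right _ (by linarith); linarith [le_abs_self K]
      _ ≤ (|K| + 1) * (ε / 2 / (|K| + 1)) := by gcongr
      _ = ε / 2 := by field_simp
  simp only
  linarith

theorem RLU.exists_min {n : ℕ} {v : E n × ℝ → ℝ} {B : Set (E n)} {a b : ℝ} (hB : IsCompact B)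
    (hv : RLU v B a b) (hc : ∀ t ∈ Icc a b, ContinuousOn (fun x => v (x, t)) B) {c : ℝ}
    {t1 : ℝ} (ht1 : t1 ∈ Icc a b) {x1 : E n} (hx1 : x1 ∈ B) (h1 : v (x1, t1) ≤ c) :
    ∃ τ ∈ Icc a t1, (∃ x ∈ B, v (x, τ) ≤ c) ∧ ∀ s ∈ Icc a b, s < τ → ∀ x ∈ B, c < v (x, s) := by
  set S : Set ℝ := {t | t ∈ Icc a b ∧ ∃ x ∈ B, v (x, t) ≤ c} with hS
  have hne : S.Nonempty := ⟨t1, ht1, x1, hx1, h1⟩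
  have hbd : BddBelow S := ⟨a, fun t ht => ht.1.1⟩
  set τ := sInf S with hτ
  have hτ1 : τ ≤ t1 := csInf_le hbd ⟨ht1, x1, hx1, h1⟩
  have hτa : a ≤ τ := le_csInf hne fun t ht => ht.1.1
  have hτm : τ ∈ Icc a b := ⟨hτa, hτ1.trans ht1.2⟩
  refine ⟨τ, ⟨hτa, hτ1⟩, ?_, ?_⟩
  · obtain ⟨x, hx, hmin⟩ := hB.exists_isMinOn ⟨x1, hx1⟩ (hc τ hτm)
    refine ⟨x, hx, ?_⟩
    by_contra hlt
    push Not at hlt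
    obtain ⟨η, hη, h2⟩ := hv τ hτm ((v (x, τ) - c) / 2) (by linarith)
    obtain ⟨t, ht, htη⟩ := exists_lt_of_csInf_lt hne (show sInf S < τ + η by linarith)
    obtain ⟨y, hy, hyc⟩ := ht.2
    have h3 := h2 y hy t ht.1 (csInf_le hbd ht) htη
    have h4 : v (x, τ) ≤ v (y, τ) := hmin hy
    linarith
  · intro s hs hsτ x hx
    by_contra hle
    push Not at hle
    exact absurd (csInf_le hbd (show s ∈ S from ⟨hs, x, hx, hle⟩)) (not_le.2 hsτ)

/-- derivative sign from a record in time. -/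
theorem deriv_nonpos_of_left {g : ℝ → ℝ} {t g' a : ℝ} (ha : a < t) (hg : HasDerivAt g g' t)
    (h : ∀ s, a ≤ s → s < t → g t ≤ g s) : g' ≤ 0 := by
  have h1 : Tendsto (slope g t) (nhdsWithin t (Iio t)) (nhds g') :=
    (hasDerivAt_iff_tendsto_slope.1 hg).mono_left (nhdsWithin_mono t fun s hs => ne_of_lt hs)
  refine le_of_tendsto h1 ?_
  have : Ico a t ∈ nhdsWithin t (Iio t) := Ico_mem_nhdsLT ha
  filter_upwards [this] with s hs
  have := h s hs.1 hs.2
  rw [slope_def_field]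
  exact div_nonpos_of_nonneg_of_nonpos (by linarith) (by linarith [hs.2])

theorem CP {n : ℕ} {ν : ℝ} (hν : 0 < ν) {u : E n × ℝ → ℝ} {R T : ℝ} (hR : 0 < R)
    (hS : Sup ν u (closedBall 0 R ×ˢ Icc 0 T)) (hu : ∀ X ∈ closedBall 0 R ×ˢ Icc 0 T, 0 ≤ u X)
    {φ : E n × ℝ → ℝ} (hφ : Continuous φ)
    (hlat : ∀ x t, ‖x‖ = R → t ∈ Icc 0 T → φ (x, t) ≤ 0)
    (hini : ∀ x ∈ closedBall (0 : E n) R, φ (x, 0) ≤ u (x, 0))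
    (hsub : ∀ x t, ‖x‖ < R → t ∈ Ioc 0 T → 0 < φ (x, t) →
      ContDiffAt ℝ 2 (fun y => φ (y, t)) x ∧ DifferentiableAt ℝ (fun s => φ (x, s)) t ∧
        ∀ a, Ell ν a → Dt φ (x, t) ≤ Lx a (fun y => φ (y, t)) x) :
    ∀ X ∈ closedBall 0 R ×ˢ Icc 0 T, φ X ≤ u X := by
  rintro ⟨x1, t1⟩ ⟨hx1, ht1⟩
  by_contra hlt
  push Not at hlt
  simp only at hx1 ht1
  have hT : 0 ≤ T := ht1.1.trans ht1.2
  set ε := (φ (x1, t1) - u (x1, t1)) / (2 * (T + 1)) with hε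
  have hε0 : 0 < ε := by apply div_pos <;> linarith
  set v : E n × ℝ → ℝ := fun X => u X + (- φ X + ε * X.2) with hv
  set c := v (x1, t1) with hcdef
  have hc0 : c < 0 := by
    have h1 : ε * t1 ≤ ε * (T + 1) := by gcongr; linarith [ht1.2]
    have h2 : ε * (T + 1) = (φ (x1, t1) - u (x1, t1)) / 2 := by rw [hε]; field_simp
    simp only [hcdef, hv]; linarith
  have hRLU : RLU v (closedBall 0 R) 0 T := RLU.add_cont hR hS.2 (by fun_prop)
  have hcont : ∀ t ∈ Icc 0 T, ContinuousOn (fun x => v (x, t)) (closedBall 0 R) := by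
    intro t ht x hx
    have h1 : ContinuousAt (fun x => u (x, t)) x := hS.1.contx ⟨hx, ht⟩
    have h2 : ContinuousAt (fun x => - φ (x, t) + ε * t) x := by fun_prop
    exact (h1.add h2).continuousWithinAt
  obtain ⟨τ, hτ, ⟨x2, hx2, hx2c⟩, hbefore⟩ :=
    hRLU.exists_min (isCompact_closedBall 0 R) hcont ht1 hx1 (le_refl c)
  have hτT : τ ∈ Icc 0 T := ⟨hτ.1, hτ.2.trans ht1.2⟩
  obtain ⟨x, hx, hmin⟩ := (isCompact_closedBall (0 : E n) R).exists_isMinOn ⟨x2, hx2⟩ (hcont τ hτT)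
  have hxc : v (x, τ) ≤ c := le_trans (hmin hx2) hx2c
  have hxv : v (x, τ) = u (x, τ) + (- φ (x, τ) + ε * τ) := rfl
  have hu0 := hu (x, τ) ⟨hx, hτT⟩
  have hετ : 0 ≤ ε * τ := mul_nonneg hε0.le hτ.1
  have hφpos : 0 < φ (x, τ) := by linarith
  have hτ0 : 0 < τ := by
    rcases hτ.1.eq_or_lt with h | h
    · exfalso
      have := hini x hx
      rw [← h] at hxv hxc
      linarith
    · exact h
  have hxR : ‖x‖ < R := by
    rcases (mem_closedBall_zero_iff.1 hx).eq_or_lt with h | h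
    · linarith [hlat x τ h hτT]
    · exact h
  obtain ⟨hφ1, hφ2, hφ3⟩ := hsub x τ hxR ⟨hτ0, hτT.2⟩ hφpos
  obtain ⟨hu1, hu2, a, ha, hu3⟩ := hS.1 (x, τ) ⟨hx, hτT⟩
  have hloc : IsLocalMin (fun y => u (y, τ) - φ (y, τ)) x := by
    have : ball (0 : E n) R ∈ nhds x := isOpen_ball.mem_nhds (mem_ball_zero_iff.2 hxR)
    filter_upwards [this] with y hy
    have : v (x, τ) ≤ v (y, τ) := hmin (ball_subset_closedBall hy)
    simp only [hv] at this
    linarith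
  have hL := Lx_nonneg_of_min ha hν (hu1.sub hφ1) hloc
  have hL' := Lx_sub a hu1 hφ1
  have h3 := hφ3 a ha
  have hder : HasDerivAt (fun t => v (x, t)) (Dt u (x, τ) + (- Dt φ (x, τ) + ε)) τ := by
    have e1 : HasDerivAt (fun t => u (x, t)) (Dt u (x, τ)) τ := hu2.hasDerivAt
    have e2 : HasDerivAt (fun t => φ (x, t)) (Dt φ (x, τ)) τ := hφ2.hasDerivAt
    have e3 : HasDerivAt (fun t : ℝ => ε * t) ε τ := by
      simpa using (hasDerivAt_id τ).const_mul ε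
    exact e1.add (e2.neg.add e3)
  have := deriv_nonpos_of_left hτ0 hder (fun s hs hsτ =>
    hxc.trans (hbefore s ⟨hs, (hsτ.le).trans hτT.2⟩ hsτ x hx).le)
  simp only at hu3 hL hL' h3
  rw [hu3] at hL'
  change 0 ≤ Lx a (fun y => u (y, τ) - φ (y, τ)) x at hL
  linarith

theorem bar_alg {ν ε q A : ℝ} (hq : 0 < q) (hqA : A ^ 2 = q * (32 * ν * ε ^ 2)) (z : ℝ) :
    0 ≤ 8 * ν * ε ^ 2 - A * z + q * z ^ 2 := by
  have h : 0 ≤ q * (8 * ν * ε ^ 2 - A * z + q * z ^ 2) := by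
    have : q * (8 * ν * ε ^ 2 - A * z + q * z ^ 2) = (2 * q * z - A) ^ 2 / 4 := by
      have : q * (8 * ν * ε ^ 2) = A ^ 2 / 4 := by rw [hqA]; ring
      linear_combination this
    rw [this]; positivity
  exact nonneg_of_mul_nonneg_right h hq

set_option maxHeartbeats 1000000 in
theorem BAR {n : ℕ} {ν : ℝ} (hν : 0 < ν) {ε tmin T : ℝ} (hε : 0 < ε) (hε1 : ε ≤ 1) (htm : 0 < tmin) :
    ∃ κ : ℝ, 0 < κ ∧ κ ≤ 1 ∧ ∀ u : E n × ℝ → ℝ, Sup ν u (closedBall 0 3 ×ˢ Icc 0 T) →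
      (∀ X ∈ closedBall 0 3 ×ˢ Icc 0 T, 0 ≤ u X) → (∀ x ∈ ball (0 : E n) ε, 1 ≤ u (x, 0)) →
      ∀ x ∈ closedBall (0 : E n) 2, ∀ t ∈ Icc tmin T, κ ≤ u (x, t) := by
  set A : ℝ := 8 * ν + 4 * (n * ν⁻¹) + 18 / tmin with hA
  set q : ℝ := A ^ 2 / (32 * ν * ε ^ 2) with hq
  have hA0 : 0 < A := by positivity
  have hq0 : 0 < q := by positivity
  have hqA : A ^ 2 = q * (32 * ν * ε ^ 2) := by rw [hq]; field_simp
  refine ⟨min 1 (25 * Real.exp (- q * T)), by positivity, min_le_left _ _, fun u hS hu hini x hx t ht => ?_⟩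
  have ht0 : 0 < t := htm.trans_le ht.1
  set k : ℝ := (9 - ε ^ 2) / t with hk
  have hε2 : ε ^ 2 ≤ 1 := by nlinarith
  have hk0 : 0 < k := by apply div_pos <;> linarith
  have hk9 : 2 * k ≤ 18 / tmin := by
    have : k ≤ 9 / tmin := by
      rw [hk]; apply div_le_div₀ <;> nlinarith [ht.1]
    calc 2 * k ≤ 2 * (9 / tmin) := by gcongr
      _ = _ := by ring
  have hkt : k * t = 9 - ε ^ 2 := by rw [hk]; field_simp
  set φ : E n × ℝ → ℝ := fun X => Real.exp (- q * X.2) * (max (ε ^ 2 + k * X.2 - ‖X.1‖ ^ 2) 0) ^ 2 with hφ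
  have hsub' : closedBall (0 : E n) 3 ×ˢ Icc 0 t ⊆ closedBall 0 3 ×ˢ Icc 0 T :=
    prod_mono le_rfl (Icc_subset_Icc_right ht.2)
  have hmain := CP (R := 3) (T := t) hν (by norm_num) (hS.mono hsub') (fun X hX => hu X (hsub' hX)) (φ := φ)
    (by fun_prop) ?_ ?_ ?_
  · have h1 := hmain (x, t) ⟨closedBall_subset_closedBall (by norm_num) hx, ⟨ht0.le, le_refl t⟩⟩
    refine le_trans (min_le_right _ _) (le_trans ?_ h1)
    simp only [hφ]
    rw [show ε ^ 2 + k * t - ‖x‖ ^ 2 = 9 - ‖x‖ ^ 2 by rw [hkt]; ring]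
    have hx2 : ‖x‖ ≤ 2 := mem_closedBall_zero_iff.1 hx
    have h5 : 5 ≤ max (9 - ‖x‖ ^ 2) 0 := le_max_of_le_left (by nlinarith [norm_nonneg x])
    have h6 : (25:ℝ) ≤ (max (9 - ‖x‖ ^ 2) 0) ^ 2 := by nlinarith
    have h7 : Real.exp (-q * T) ≤ Real.exp (-q * t) := by
      apply Real.exp_le_exp.2; nlinarith [ht.2]
    calc 25 * Real.exp (-q * T) ≤ 25 * Real.exp (-q * t) := by gcongr
      _ ≤ Real.exp (-q * t) * (max (9 - ‖x‖ ^ 2) 0) ^ 2 := by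
        rw [mul_comm]; gcongr
  · intro y s hy hs
    simp only [hφ]
    have : ε ^ 2 + k * s - ‖y‖ ^ 2 ≤ 0 := by
      rw [hy]
      have : k * s ≤ k * t := by gcongr; exact hs.2
      linarith
    rw [max_eq_right this]; simp
  · intro y hy
    simp only [hφ]
    by_cases hyε : ‖y‖ < ε
    · have h1 := hini y (mem_ball_zero_iff.2 hyε)
      have h2 : max (ε ^ 2 + k * 0 - ‖y‖ ^ 2) 0 ≤ 1 := by
        apply max_le _ (by norm_num); nlinarith [norm_nonneg y]
      have h3 : 0 ≤ max (ε ^ 2 + k * 0 - ‖y‖ ^ 2) 0 := le_max_right _ _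
      simp only [mul_zero, Real.exp_zero, one_mul]
      simp only [mul_zero] at h2 h3
      nlinarith
    · push Not at hyε
      have : ε ^ 2 + k * 0 - ‖y‖ ^ 2 ≤ 0 := by nlinarith
      rw [max_eq_right this]
      simpa using hu (y, 0) ⟨hy, ⟨le_refl 0, ht0.le.trans ht.2⟩⟩
  · intro y s hy hs hpos
    have hρ : 0 < ε ^ 2 + k * s - ‖y‖ ^ 2 := by
      by_contra hcon
      push Not at hcon
      simp only [hφ] at hpos
      rw [max_eq_right hcon] at hpos; simp at hpos
    set z := ε ^ 2 + k * s - ‖y‖ ^ 2 with hz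
    have hx1 : (fun w => φ (w, s)) =ᶠ[nhds y] fun w => Real.exp (-q * s) * ((ε ^ 2 + k * s) - ‖w‖ ^ 2) ^ 2 := by
      have hcont : ContinuousAt (fun w : E n => (ε ^ 2 + k * s) - ‖w‖ ^ 2) y := by fun_prop
      have : ∀ᶠ w in nhds y, 0 < (ε ^ 2 + k * s) - ‖w‖ ^ 2 := hcont.eventually (lt_mem_nhds hρ)
      filter_upwards [this] with w hw
      simp only [hφ]
      rw [max_eq_left hw.le]
    have ht1 : (fun w => φ (y, w)) =ᶠ[nhds s] fun w => Real.exp (-q * w) * (ε ^ 2 + k * w - ‖y‖ ^ 2) ^ 2 := by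
      have hcont : ContinuousAt (fun w : ℝ => ε ^ 2 + k * w - ‖y‖ ^ 2) s := by fun_prop
      have : ∀ᶠ w in nhds s, 0 < ε ^ 2 + k * w - ‖y‖ ^ 2 := hcont.eventually (lt_mem_nhds hρ)
      filter_upwards [this] with w hw
      simp only [hφ]
      rw [max_eq_left hw.le]
    have hcd : ContDiffAt ℝ 2 (fun w : E n => ((ε ^ 2 + k * s) - ‖w‖ ^ 2) ^ 2) y := by
      have := (contDiff_norm_sq ℝ (n := 2) (E := E n)).contDiffAt (x := y)
      exact (contDiffAt_const.sub this).pow 2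
    have hder : HasDerivAt (fun w => Real.exp (-q * w) * (ε ^ 2 + k * w - ‖y‖ ^ 2) ^ 2)
        (Real.exp (-q * s) * (- q * z ^ 2 + 2 * k * z)) s := by
      have e1 : HasDerivAt (fun w => Real.exp (-q * w)) (Real.exp (-q * s) * (-q)) s := by
        simpa using ((hasDerivAt_id s).const_mul (-q)).exp
      have e2 : HasDerivAt (fun w => ε ^ 2 + k * w - ‖y‖ ^ 2) k s := by
        simpa using (((hasDerivAt_id s).const_mul k).const_add (ε ^ 2)).sub_const (‖y‖ ^ 2)
      have e4 : Real.exp (-q * s) * (- q * z ^ 2 + 2 * k * z) = Real.exp (-q * s) * -q * (ε ^ 2 + k * s - ‖y‖ ^ 2) ^ 2 + Real.exp (-q * s) * (((2:ℕ):ℝ) * (ε ^ 2 + k * s - ‖y‖ ^ 2) ^ (2 - 1) * k) := by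
        rw [hz]; push_cast; ring
      rw [e4]
      exact e1.fun_mul (e2.fun_pow 2)
    refine ⟨(contDiffAt_const.mul hcd).congr_of_eventuallyEq hx1,
      (hder.congr_of_eventuallyEq ht1).differentiableAt, fun a ha => ?_⟩
    have hD : Dt φ (y, s) = Real.exp (-q * s) * (- q * z ^ 2 + 2 * k * z) :=
      (hder.congr_of_eventuallyEq ht1).deriv
    rw [hD, Lx_congr a hx1, Lx_smul a _ hcd, Lx_bump]
    gcongr
    have h1 := ha.1 y
    have h2 := ha.trace_le
    rw [← EuclideanSpace.real_norm_sq_eq] at h1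
    have h3 : 4 * (ε ^ 2 + k * s - ‖y‖ ^ 2) * ∑ i, a i i ≤ 4 * z * (n * ν⁻¹) := by
      rw [← hz]; gcongr
    have h4 : ε ^ 2 - z ≤ ‖y‖ ^ 2 := by
      have : 0 ≤ k * s := mul_nonneg hk0.le hs.1.le
      rw [hz]; linarith
    have h5 : 8 * ν * (ε ^ 2 - z) ≤ 8 * ν * ‖y‖ ^ 2 := by gcongr
    have h7 := bar_alg hq0 hqA z
    have h8 : 2 * k * z ≤ 18 / tmin * z := by gcongr
    have h9 : A * z = 8 * ν * z + 4 * (n * ν⁻¹) * z + 18 / tmin * z := by rw [hA]; ring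
    linarith

theorem BARs {n : ℕ} {ν : ℝ} (hν : 0 < ν) {ε tmin T : ℝ} (hε : 0 < ε) (hε1 : ε ≤ 1) (htm : 0 < tmin) :
    ∃ κ : ℝ, 0 < κ ∧ κ ≤ 1 ∧ ∀ (u : E n × ℝ → ℝ) (x0 : E n) (t0 r l : ℝ), 0 < r → 0 ≤ l →
      Sup ν u (closedBall x0 (r * 3) ×ˢ Icc t0 (t0 + r ^ 2 * T)) →
      (∀ X ∈ closedBall x0 (r * 3) ×ˢ Icc t0 (t0 + r ^ 2 * T), 0 ≤ u X) →
      (∀ x ∈ ball x0 (r * ε), l ≤ u (x, t0)) →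
      ∀ x ∈ closedBall x0 (r * 2), ∀ t ∈ Icc (t0 + r ^ 2 * tmin) (t0 + r ^ 2 * T), κ * l ≤ u (x, t) := by
  obtain ⟨κ, hκ, hκ1, H⟩ := BAR (n := n) hν (T := T) hε hε1 htm
  refine ⟨κ, hκ, hκ1, fun u x0 t0 r l hr hl hS hu hini x hx t ht => ?_⟩
  have hr2 : 0 < r ^ 2 := by positivity
  rcases hl.eq_or_lt with h0 | hl
  · rw [← h0, mul_zero]
    exact hu (x, t) ⟨closedBall_subset_closedBall (by linarith) hx,
      ⟨by have := mul_pos hr2 htm; linarith [ht.1], ht.2⟩⟩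
  have hsub := mem_scl_box (n := n) (V := closedBall x0 (r * 3) ×ˢ Icc t0 (t0 + r ^ 2 * T)) (x0 := x0)
    (t0 := t0) (R := 3) (τ := 0) (β := T) hr (by simp)
  have h1 := H (scl u x0 t0 r l⁻¹ 0) ((hS.scl x0 t0 0 hr (inv_nonneg.2 hl.le)).mono hsub)
    (fun X hX => by
      have := hu _ (hsub hX)
      simp only [scl, add_zero]; positivity)
    (fun y hy => by
      have := hini (x0 + r • y) (by
        simp only [mem_ball, dist_eq_norm, sub_zero, add_sub_cancel_left] at hy ⊢
        rw [norm_smul, Real.norm_of_nonneg hr.le]; gcongr)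
      simp only [scl, add_zero, mul_zero]
      rwa [le_inv_mul_iff₀ hl, mul_one])
    (r⁻¹ • (x - x0)) (by
      simp only [mem_closedBall, dist_eq_norm, sub_zero] at hx ⊢
      rw [norm_smul, norm_inv, Real.norm_of_nonneg hr.le, inv_mul_le_iff₀ hr]
      exact hx)
    ((r ^ 2)⁻¹ * (t - t0)) ⟨by rw [le_inv_mul_iff₀ hr2]; linarith [ht.1],
      by rw [inv_mul_le_iff₀ hr2]; linarith [ht.2]⟩
  simp only [scl, smul_smul, mul_inv_cancel₀ hr.ne', one_smul, mul_inv_cancel_left₀ hr2.ne',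
    add_sub_cancel, add_zero] at h1
  rw [le_inv_mul_iff₀ hl] at h1
  linarith

/-- record points of `w + |x|² - t - p·x` -/
def Rec {n : ℕ} (w : E n × ℝ → ℝ) (p x : E n) (t : ℝ) : Prop :=
  x ∈ closedBall (0 : E n) 1 ∧ t ∈ Ioc (-1 : ℝ) 0 ∧ w (x, t) + ‖x‖ ^ 2 - t - inner ℝ p x < 7 / 8 ∧
  ∀ y ∈ closedBall (0 : E n) 1, ∀ s ∈ Icc (-1 : ℝ) t,
    w (x, t) + ‖x‖ ^ 2 - t - inner ℝ p x ≤ w (y, s) + ‖y‖ ^ 2 - s - inner ℝ p y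

theorem inner_le_eighth {n : ℕ} {p x : E n} (hp : ‖p‖ ≤ 1 / 8) (hx : ‖x‖ ≤ 1) : inner ℝ p x ≤ 1 / 8 := by
  have := real_inner_le_norm p x
  nlinarith [norm_nonneg p, norm_nonneg x]

theorem Rec.facts {n : ℕ} {ν : ℝ} (hν : 0 < ν) {w : E n × ℝ → ℝ} {p x : E n} {t : ℝ}
    (hS : PS ν w (closedBall 0 1 ×ˢ Icc (-1) 0)) (hw : ∀ X ∈ closedBall 0 1 ×ˢ Icc (-1) 0, 0 ≤ w X)
    (hp : ‖p‖ ≤ 1 / 8) (h : Rec w p x t) :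
    ‖x‖ < 1 ∧ w (x, t) < 1 ∧ fderiv ℝ (fun y => w (y, t) + ‖y‖ ^ 2) x = innerSL ℝ p ∧
    (∀ v, 0 ≤ hess (fun y => w (y, t) + ‖y‖ ^ 2) x v v) ∧
    ν * ∑ i, hs (fun y => w (y, t) + ‖y‖ ^ 2) x i i ≤ 1 + 2 * (n * ν⁻¹) ∧
    -(1 + 2 * (n * ν⁻¹)) ≤ Dt w (x, t) - 1 := by
  obtain ⟨hx, ht, h1, h2⟩ := h
  have htI : t ∈ Icc (-1:ℝ) 0 := ⟨ht.1.le, ht.2⟩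
  have hxn : ‖x‖ ≤ 1 := mem_closedBall_zero_iff.1 hx
  have hip := inner_le_eighth hp hxn
  have hw0 := hw (x, t) ⟨hx, htI⟩
  have hxlt : ‖x‖ < 1 := by
    rcases hxn.eq_or_lt with h | h
    · exfalso; rw [h] at h1; linarith [ht.2]
    · exact h
  obtain ⟨c1, c2, a, ha, c3⟩ := hS (x, t) ⟨hx, htI⟩
  simp only at c1 c2 c3
  have cn : ContDiffAt ℝ 2 (fun y : E n => ‖y‖ ^ 2) x := (contDiff_norm_sq ℝ).contDiffAt
  have cf : ContDiffAt ℝ 2 (fun y => w (y, t) + ‖y‖ ^ 2) x := c1.add cn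
  have cl : ContDiffAt ℝ 2 (fun y : E n => innerSL ℝ p y) x := (innerSL ℝ p).contDiff.contDiffAt
  have hloc : IsLocalMin (fun y => (w (y, t) + ‖y‖ ^ 2) - innerSL ℝ p y) x := by
    have : ball (0 : E n) 1 ∈ nhds x := isOpen_ball.mem_nhds (mem_ball_zero_iff.2 hxlt)
    filter_upwards [this] with y hy
    have := h2 y (ball_subset_closedBall hy) t ⟨ht.1.le, le_refl t⟩
    simp only [innerSL_apply_apply]; linarith
  have hgrad : fderiv ℝ (fun y => w (y, t) + ‖y‖ ^ 2) x = innerSL ℝ p := by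
    have := hloc.fderiv_eq_zero
    rw [fderiv_fun_sub (cd_d cf) (cd_d cl), ContinuousLinearMap.fderiv, sub_eq_zero] at this
    exact this
  have hhess : ∀ v, 0 ≤ hess (fun y => w (y, t) + ‖y‖ ^ 2) x v v := by
    intro v
    have := hess_nonneg_of_min (cf.sub cl) hloc v
    have e : (fun y => (w (y, t) + ‖y‖ ^ 2) - innerSL ℝ p y) =
      fun y => (w (y, t) + ‖y‖ ^ 2) + (-(innerSL ℝ p)) y := by ext y; simp [sub_eq_add_neg]
    rw [e] at this
    change 0 ≤ hess (fun y => (w (y, t) + ‖y‖ ^ 2) + (-(innerSL ℝ p)) y) x v v at this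
    rw [hess_add cf (-(innerSL ℝ p)).contDiff.contDiffAt] at this
    have z : hess (fun y => (-(innerSL ℝ p)) y) x = 0 := by
      unfold hess
      have : fderiv ℝ (fun y => (-(innerSL ℝ p)) y) = fun _ => -(innerSL ℝ p) := by
        ext1 y; exact (-(innerSL ℝ p)).fderiv
      rw [this]; simp
    have e3 : (hess (fun y => w (y, t) + ‖y‖ ^ 2) x + hess (fun y => (-(innerSL ℝ p)) y) x) v v =
        hess (fun y => w (y, t) + ‖y‖ ^ 2) x v v + hess (fun y => (-(innerSL ℝ p)) y) x v v := rfl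
    rw [e3, z] at this
    exact this.trans (le_of_eq (add_zero _))
  have hB : ∀ ξ : Fin n → ℝ, 0 ≤ ∑ i, ∑ j, hs (fun y => w (y, t) + ‖y‖ ^ 2) x i j * ξ i * ξ j := by
    intro ξ
    have := hhess (WithLp.toLp 2 ξ)
    rw [hess_expand cf] at this
    simpa using this
  have htr := ha.trace_mul hB (hs_symm cf)
  have hsum : Lx a (fun y => w (y, t) + ‖y‖ ^ 2) x = Dt w (x, t) + 2 * ∑ i, a i i := by
    rw [Lx_add a c1 cn, c3]
    have := Lx_normsq a 0 x
    simp only [sub_zero] at this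
    rw [this]
  change ν * _ ≤ Lx a (fun y => w (y, t) + ‖y‖ ^ 2) x at htr
  have hder : HasDerivAt (fun s => w (x, s) + ‖x‖ ^ 2 - s - inner ℝ p x) (Dt w (x, t) - 1) t := by
    have e1 : HasDerivAt (fun s => w (x, s)) (Dt w (x, t)) t := c2.hasDerivAt
    exact ((e1.add_const _).sub (hasDerivAt_id t)).sub_const _
  have hle := deriv_nonpos_of_left ht.1 hder (fun s hs hst => h2 x hx s ⟨hs, hst.le⟩)
  have ht2 := ha.trace_le
  have hLx0 : 0 ≤ Lx a (fun y => w (y, t) + ‖y‖ ^ 2) x := 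
    trace_mul_nonneg (ha.psd hν) hB (hs_symm cf)
  refine ⟨hxlt, by nlinarith [ht.2, norm_nonneg x], hgrad, hhess, by linarith, by linarith⟩

/-- lower bound for the measure of the set of record times -/
theorem rec_times {n : ℕ} {ν : ℝ} (hν : 0 < ν) {w : E n × ℝ → ℝ} {p : E n}
    (hS : Sup ν w (closedBall 0 1 ×ˢ Icc (-1) 0)) (hw : ∀ X ∈ closedBall 0 1 ×ˢ Icc (-1) 0, 0 ≤ w X)
    (hw0 : w (0, 0) ≤ 1 / 2) (hp : ‖p‖ ≤ 1 / 8) {C : ℝ} (hC : C = 1 + 2 * (n * ν⁻¹)) :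
    ENNReal.ofReal (3 / 8 / (C + 1)) ≤ volume {t : ℝ | ∃ x, Rec w p x t} := by
  have hC0 : 0 < C := by rw [hC]; positivity
  by_contra hlt
  push Not at hlt
  obtain ⟨U, hAU, hUo, hU⟩ := Set.exists_isOpen_lt_of_lt _ _ hlt
  have hUm : MeasurableSet U := hUo.measurableSet
  have hUreal : (volume U).toReal < 3 / 8 / (C + 1) := by
    rw [← ENNReal.ofReal_toReal (hU.trans ENNReal.ofReal_lt_top).ne] at hU
    exact (ENNReal.ofReal_lt_ofReal_iff (by positivity)).1 hU
  have hIntv : ∀ a b : ℝ, IntervalIntegrable (U.indicator (fun _ => (1:ℝ))) volume a b := by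
    intro a b
    refine ⟨?_, ?_⟩ <;> exact IntegrableOn.indicator (integrableOn_const (by simp)) hUm
  set m : ℝ → ℝ := fun t => ∫ s in (-1:ℝ)..t, U.indicator (fun _ => (1:ℝ)) s with hm
  have hmc : Continuous m := intervalIntegral.continuous_primitive hIntv (-1)
  have hm1 : m (-1) = 0 := by simp [hm]
  have hmono : Monotone m := by
    intro s t hst
    have := intervalIntegral.integral_add_adjacent_intervals (hIntv (-1) s) (hIntv s t)
    have h2 : 0 ≤ ∫ r in s..t, U.indicator (fun _ => (1:ℝ)) r :=
      intervalIntegral.integral_nonneg hst fun r _ => indicator_nonneg (by simp) r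
    simp only [hm]; linarith
  have hm0 : m 0 ≤ (volume U).toReal := by
    simp only [hm]
    rw [intervalIntegral.integral_of_le (by norm_num), integral_indicator hUm]
    simp only [integral_const, smul_eq_mul, mul_one, Measure.real, Measure.restrict_apply MeasurableSet.univ,
      univ_inter, Measure.restrict_apply hUm]
    exact ENNReal.toReal_mono (hU.trans ENNReal.ofReal_lt_top).ne (measure_mono inter_subset_left)
  have hmd : ∀ t ∈ U, HasDerivAt m 1 t := by
    intro t ht
    have hev : U.indicator (fun _ => (1:ℝ)) =ᶠ[nhds t] fun _ => 1 := by
      filter_upwards [hUo.mem_nhds ht] with s hs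
      simp [hs]
    have := intervalIntegral.integral_hasDerivAt_right (hIntv (-1) t)
      (Measurable.stronglyMeasurable (measurable_const.indicator hUm)).stronglyMeasurableAtFilter
      (continuousAt_const.congr hev.symm)
    simpa [ht] using this
  set g : E n × ℝ → ℝ := fun X => ‖X.1‖ ^ 2 - X.2 - inner ℝ p X.1 + (C + 1) * m X.2 with hg
  have hgc : Continuous g := by fun_prop
  set v : E n × ℝ → ℝ := fun X => w X + g X with hv
  have hRLU : RLU v (closedBall 0 1) (-1) 0 := RLU.add_cont (by norm_num) hS.2 hgc
  have hcont : ∀ t ∈ Icc (-1:ℝ) 0, ContinuousOn (fun x => v (x, t)) (closedBall 0 1) := by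
    intro t ht x hx
    have h1 : ContinuousAt (fun x => w (x, t)) x := hS.1.contx ⟨hx, ht⟩
    have h2 : ContinuousAt (fun x => g (x, t)) x := by fun_prop
    exact (h1.add h2).continuousWithinAt
  have h0m : (0:ℝ) ∈ Icc (-1:ℝ) 0 := by constructor <;> norm_num
  have h0b : (0 : E n) ∈ closedBall (0 : E n) 1 := by simp
  obtain ⟨τ, hτ, ⟨x2, hx2, hx2c⟩, hbefore⟩ :=
    hRLU.exists_min (isCompact_closedBall 0 1) hcont h0m h0b (le_refl (v (0, 0)))
  set c := v (0, 0) with hc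
  have hc78 : c < 7 / 8 := by
    have : (C + 1) * m 0 < 3 / 8 := by
      calc (C + 1) * m 0 ≤ (C + 1) * (volume U).toReal := by gcongr
        _ < (C + 1) * (3 / 8 / (C + 1)) := by gcongr
        _ = 3 / 8 := by field_simp
    simp only [hc, hv, hg]; simp; linarith
  obtain ⟨x, hx, hmin⟩ := (isCompact_closedBall (0 : E n) 1).exists_isMinOn ⟨x2, hx2⟩ (hcont τ hτ)
  have hxc : v (x, τ) ≤ c := le_trans (hmin hx2) hx2c
  have hmτ : 0 ≤ m τ := by rw [← hm1]; exact hmono hτ.1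
  have hτ1 : -1 < τ := by
    rcases hτ.1.eq_or_lt with h | h
    · exfalso
      have h3 := hw (x, τ) ⟨hx, hτ⟩
      have h4 := inner_le_eighth hp (mem_closedBall_zero_iff.1 hx)
      simp only [hv, hg] at hxc
      rw [← h] at hxc h3
      rw [hm1] at hxc
      nlinarith [norm_nonneg x]
    · exact h
  have hrec : Rec w p x τ := by
    refine ⟨hx, ⟨hτ1, hτ.2⟩, ?_, ?_⟩
    · have : 0 ≤ (C + 1) * m τ := by positivity
      simp only [hv, hg] at hxc
      linarith
    · intro y hy s hs
      have hms : (C + 1) * m s ≤ (C + 1) * m τ := by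
        have := hmono hs.2
        gcongr
      rcases hs.2.eq_or_lt with h | h
      · have : v (x, τ) ≤ v (y, τ) := hmin hy
        rw [h]
        simp only [hv, hg] at this; linarith
      · have := hbefore s ⟨hs.1, h.le.trans hτ.2⟩ h y hy
        simp only [hv, hg] at this hxc; linarith
  have hfacts := hrec.facts hν hS.1 hw hp
  obtain ⟨c1, c2, a, ha, c3⟩ := hS.1 (x, τ) ⟨hx, hτ⟩
  have hder : HasDerivAt (fun s => v (x, s)) (Dt w (x, τ) + (0 - 1 - 0 + (C + 1) * 1)) τ := by
    have e1 : HasDerivAt (fun s => w (x, s)) (Dt w (x, τ)) τ := c2.hasDerivAt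
    exact e1.add ((((hasDerivAt_const τ (‖x‖ ^ 2)).sub (hasDerivAt_id τ)).sub
      (hasDerivAt_const τ (inner ℝ p x))).add ((hmd τ (hAU ⟨x, hrec⟩)).const_mul (C + 1)))
  have := deriv_nonpos_of_left hτ1 hder (fun s hs hsτ =>
    hxc.trans (hbefore s ⟨hs, (hsτ.le).trans hτ.2⟩ hsτ x hx).le)
  linarith [hfacts.2.2.2.2.2]

theorem det_le_of_psd {n : ℕ} {B : Matrix (Fin n) (Fin n) ℝ} (h : B.PosSemidef) {c : ℝ}
    (hc : ∑ i, B i i ≤ c) : |B.det| ≤ c ^ n := by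
  have h1 := h.1.det_eq_prod_eigenvalues
  have h2 := h.1.trace_eq_sum_eigenvalues
  have h0 : ∀ i, 0 ≤ h.1.eigenvalues i := h.eigenvalues_nonneg
  have h3 : ∀ i, h.1.eigenvalues i ≤ c := by
    intro i
    have : h.1.eigenvalues i ≤ ∑ j, h.1.eigenvalues j :=
      Finset.single_le_sum (fun j _ => h0 j) (Finset.mem_univ i)
    have e : ∑ i, B i i = ∑ j, h.1.eigenvalues j := by
      simpa [Matrix.trace] using h2
    linarith
  rw [h1]
  simp only [RCLike.ofReal_real_eq_id, id]
  rw [abs_of_nonneg (Finset.prod_nonneg fun i _ => h0 i)]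
  calc ∏ i, h.1.eigenvalues i ≤ ∏ _i : Fin n, c := Finset.prod_le_prod (fun i _ => h0 i) fun i _ => h3 i
    _ = c ^ n := by simp

/-- gradient as a map `E n → E n` -/
def grad {n : ℕ} (f : E n → ℝ) (y : E n) : E n :=
  WithLp.toLp 2 fun i => fderiv ℝ f y (EuclideanSpace.single i 1)

theorem grad_hasFDerivAt {n : ℕ} {f : E n → ℝ} {x : E n} (h : ContDiffAt ℝ 2 f x) :
    HasFDerivAt (grad f) (Matrix.toEuclideanCLM (n := Fin n) (𝕜 := ℝ) (Matrix.of (hs f x))) x := by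
  rw [← hasFDerivWithinAt_univ, hasFDerivWithinAt_euclidean]
  intro i
  rw [hasFDerivWithinAt_univ]
  have h1 := (cd_diff h).hasFDerivAt.clm_apply (hasFDerivAt_const (EuclideanSpace.single i (1:ℝ) : E n) x)
  refine h1.congr_fderiv ?_
  ext v
  simp only [ContinuousLinearMap.comp_apply]
  have e : (Matrix.toEuclideanCLM (n := Fin n) (𝕜 := ℝ) (Matrix.of (hs f x)) v) i =
      ∑ j, hs f x i j * v j := by
    rw [Matrix.ofLp_toEuclideanCLM]; simp [Matrix.mulVec, dotProduct]
  have e2 : hess f x v (EuclideanSpace.single i 1) = ∑ j, hs f x i j * v j := by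
    conv_lhs => rw [E_sum v]
    simp only [map_sum, map_smul, _root_.sum_apply, _root_.smul_apply, smul_eq_mul]
    refine Finset.sum_congr rfl fun j _ => ?_
    rw [hs_symm h, hs_eq h]; ring
  calc _ = hess f x v (EuclideanSpace.single i 1) := by simp [hess]
    _ = _ := by rw [e2, ← e]; rfl

theorem det_toCLM {n : ℕ} (B : Matrix (Fin n) (Fin n) ℝ) :
    (Matrix.toEuclideanCLM (n := Fin n) (𝕜 := ℝ) B).det = B.det := by
  unfold ContinuousLinearMap.det
  have : ((Matrix.toEuclideanCLM (n := Fin n) (𝕜 := ℝ) B : E n →L[ℝ] E n) : E n →ₗ[ℝ] E n) =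
      Matrix.toLin (EuclideanSpace.basisFun (Fin n) ℝ).toBasis (EuclideanSpace.basisFun (Fin n) ℝ).toBasis B := by
    rfl
  rw [this, LinearMap.det_toLin]

theorem slice_bound {n : ℕ} {ν : ℝ} (hν : 0 < ν) {w : E n × ℝ → ℝ}
    (hS : PS ν w (closedBall 0 1 ×ˢ Icc (-1) 0)) (hw : ∀ X ∈ closedBall 0 1 ×ˢ Icc (-1) 0, 0 ≤ w X)
    {C : ℝ} (hC : C = 1 + 2 * (n * ν⁻¹)) {t : ℝ} (ht : t ∈ Icc (-1 : ℝ) 0) :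
    volume {p : E n | ‖p‖ ≤ 1 / 8 ∧ ∃ x, Rec w p x t} ≤
      ENNReal.ofReal ((C / ν) ^ n) * volume {x : E n | x ∈ ball (0 : E n) 1 ∧ w (x, t) < 1} := by
  have hC0 : 0 < C := by rw [hC]; positivity
  set f : E n → ℝ := fun y => w (y, t) + ‖y‖ ^ 2 with hf
  have hcd : ∀ x ∈ ball (0 : E n) 1, ContDiffAt ℝ 2 f x := by
    intro x hx
    exact (hS (x, t) ⟨ball_subset_closedBall hx, ht⟩).1.add (contDiff_norm_sq ℝ).contDiffAt
  set s1 : Set (E n) := {x | x ∈ ball (0 : E n) 1 ∧ w (x, t) < 1} with hs1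
  have hs1o : IsOpen s1 := by
    have hc : ContinuousOn (fun x => w (x, t)) (ball (0 : E n) 1) := fun x hx =>
      (hS.contx (x := x) (t := t) ⟨ball_subset_closedBall hx, ht⟩).continuousWithinAt
    exact hc.isOpen_inter_preimage isOpen_ball isOpen_Iio
  set s : Set (E n) := s1 ∩ {x | |(fderiv ℝ (grad f) x).det| ≤ (C / ν) ^ n} with hs'
  have hsm : MeasurableSet s := by
    refine hs1o.measurableSet.inter ?_
    have : Measurable fun x => |(fderiv ℝ (grad f) x).det| :=
      (continuous_abs.measurable.comp ContinuousLinearMap.continuous_det.measurable).comp (measurable_fderiv ℝ (grad f))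
    exact measurableSet_le this measurable_const
  have hsub : {p : E n | ‖p‖ ≤ 1 / 8 ∧ ∃ x, Rec w p x t} ⊆ grad f '' s := by
    rintro p ⟨hp, x, hr⟩
    obtain ⟨h1, h2, h3, h4, h5, -⟩ := hr.facts hν hS hw hp
    have hxb : x ∈ ball (0 : E n) 1 := mem_ball_zero_iff.2 h1
    refine ⟨x, ⟨⟨hxb, h2⟩, ?_⟩, ?_⟩
    · show |(fderiv ℝ (grad f) x).det| ≤ _
      rw [(grad_hasFDerivAt (hcd x hxb)).fderiv, det_toCLM]
      apply det_le_of_psd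
      · refine Matrix.PosSemidef.of_dotProduct_mulVec_nonneg ?_ ?_
        · ext i j; simp [hs_symm (hcd x hxb) i j]
        · intro ξ
          have := h4 (WithLp.toLp 2 ξ)
          rw [hess_expand (hcd x hxb)] at this
          simp only [dotProduct, Matrix.mulVec, Matrix.of_apply, Finset.mul_sum, star_trivial]
          refine this.trans (le_of_eq (Finset.sum_congr rfl fun i _ => Finset.sum_congr rfl fun j _ => ?_))
          simp only [hf]
          ring
      · rw [le_div_iff₀ hν, mul_comm, hC]; exact h5
    · ext i
      have : fderiv ℝ f x (EuclideanSpace.single i 1) = p i := by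
        rw [hf, h3]; simp [EuclideanSpace.inner_single_right]
      simpa [grad] using this
  calc volume {p : E n | ‖p‖ ≤ 1 / 8 ∧ ∃ x, Rec w p x t} ≤ volume (grad f '' s) := measure_mono hsub
    _ ≤ ∫⁻ x in s, ENNReal.ofReal |(fderiv ℝ (grad f) x).det| := by
        refine addHaar_image_le_lintegral_abs_det_fderiv volume hsm fun x hx => ?_
        have := grad_hasFDerivAt (hcd x hx.1.1)
        rw [this.fderiv]
        exact this.hasFDerivWithinAt
    _ ≤ ∫⁻ x in s, ENNReal.ofReal ((C / ν) ^ n) := by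
        refine setLIntegral_mono measurable_const fun x hx => ENNReal.ofReal_le_ofReal hx.2
    _ = ENNReal.ofReal ((C / ν) ^ n) * volume s := by simp
    _ ≤ _ := by gcongr; exact inter_subset_left

theorem dense_lt {n : ℕ} {B D : Set (E n)} (hD : B ⊆ closure D) (hDB : D ⊆ B) {f : E n → ℝ}
    (hf : ContinuousOn f B) {x : E n} (hx : x ∈ B) {c : ℝ} (h : f x < c) : ∃ y ∈ D, f y < c := by
  have h1 : ∀ᶠ y in nhdsWithin x B, f y < c := (hf x hx).eventually (gt_mem_nhds h)
  have h2 : (nhdsWithin x D).NeBot := mem_closure_iff_nhdsWithin_neBot.1 (hD hx)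
  have h3 : ∀ᶠ y in nhdsWithin x D, f y < c := h1.filter_mono (nhdsWithin_mono x hDB)
  obtain ⟨y, hy1, hy2⟩ := (h3.and self_mem_nhdsWithin).exists
  exact ⟨y, hy2, hy1⟩

theorem theta_meas {n : ℕ} {ν : ℝ} {w : E n × ℝ → ℝ}
    (hS : PS ν w (closedBall 0 1 ×ˢ Icc (-1) 0)) (hw : ∀ X ∈ closedBall 0 1 ×ˢ Icc (-1) 0, 0 ≤ w X) :
    MeasurableSet {P : E n × ℝ | ‖P.1‖ ≤ 1 / 8 ∧ ∃ x, Rec w P.1 x P.2} := by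
  set B := closedBall (0 : E n) 1 with hB
  obtain ⟨D, hDB, hDc, hDd⟩ := (TopologicalSpace.IsSeparable.of_separableSpace B).exists_countable_dense_subset
  set F : E n → E n → ℝ → ℝ := fun p x t => w (x, t) + ‖x‖ ^ 2 - t - inner ℝ p x with hF
  set G : E n → E n → ℝ → ℝ := fun p x t => (Icc (-1:ℝ) 0).indicator (fun t => w (x, t)) t + ‖x‖ ^ 2 - t - inner ℝ p x with hG
  have hGF : ∀ p x, ∀ t ∈ Icc (-1:ℝ) 0, G p x t = F p x t := by
    intro p x t ht; simp only [hG, hF, indicator_of_mem ht]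
  have hFx : ∀ p, ∀ t ∈ Icc (-1:ℝ) 0, ContinuousOn (fun x => F p x t) B := by
    intro p t ht x hx
    have h1 : ContinuousAt (fun x => w (x, t)) x := hS.contx ⟨hx, ht⟩
    have h2 : ContinuousAt (fun x : E n => ‖x‖ ^ 2 - t - inner ℝ p x) x := by fun_prop
    have h3 := (h1.add h2).continuousWithinAt (s := B)
    refine h3.congr (fun y _ => ?_) ?_ <;> simp only [hF, Pi.add_apply] <;> ring
  have hFt : ∀ p, ∀ x ∈ B, ∀ t ∈ Icc (-1:ℝ) 0, ContinuousAt (fun t => F p x t) t := by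
    intro p x hx t ht
    have h1 : ContinuousAt (fun t => w (x, t)) t := hS.contt ⟨hx, ht⟩
    exact ((h1.add continuousAt_const).sub continuousAt_id).sub continuousAt_const
  have hGm : ∀ x ∈ B, Measurable fun P : E n × ℝ => G P.1 x P.2 := by
    intro x hx
    have h1 : Measurable ((Icc (-1:ℝ) 0).indicator fun t => w (x, t)) := by
      have hc : ContinuousOn (fun t => w (x, t)) (Icc (-1:ℝ) 0) := fun t ht =>
        (hS.contt (x := x) (t := t) ⟨hx, ht⟩).continuousWithinAt
      classical
      have := hc.measurable_piecewise (continuousOn_const (c := (0:ℝ)) (s := (Icc (-1:ℝ) 0)ᶜ)) measurableSet_Icc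
      rw [← Set.piecewise_eq_indicator]
      exact this
    have h2 : Measurable fun P : E n × ℝ => ‖x‖ ^ 2 - P.2 - inner ℝ P.1 x := by fun_prop
    have h3 : Measurable fun P : E n × ℝ => (Icc (-1:ℝ) 0).indicator (fun t => w (x, t)) P.2 := h1.comp measurable_snd
    have h4 := h3.add h2
    have e : (fun P : E n × ℝ => G P.1 x P.2) = fun P : E n × ℝ => (Icc (-1:ℝ) 0).indicator (fun t => w (x, t)) P.2 + (‖x‖ ^ 2 - P.2 - inner ℝ P.1 x) := by
      ext P; simp only [hG]; ring
    rw [e]; exact h4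
  have key : {P : E n × ℝ | ‖P.1‖ ≤ 1 / 8 ∧ ∃ x, Rec w P.1 x P.2} =
      (({P : E n × ℝ | ‖P.1‖ ≤ 1 / 8} ∩ {P | P.2 ∈ Ioc (-1:ℝ) 0}) ∩ ⋃ x ∈ D, {P | G P.1 x P.2 < 7 / 8}) ∩
      ⋂ q : ℚ, ⋂ y ∈ D, ⋂ k : ℕ, ({P : E n × ℝ | ¬ ((q:ℝ) ∈ Ioo (-1) P.2)} ∪
        ⋃ x ∈ D, {P | G P.1 x P.2 < G P.1 y q + 1 / ((k:ℝ) + 1)}) := by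
    ext ⟨p, t⟩
    simp only [mem_inter_iff, mem_iUnion, mem_iInter, mem_union, exists_prop]
    change (‖p‖ ≤ 1 / 8 ∧ ∃ x, Rec w p x t) ↔ ((‖p‖ ≤ 1 / 8 ∧ t ∈ Ioc (-1:ℝ) 0) ∧ ∃ x ∈ D, G p x t < 7 / 8) ∧
      ∀ q : ℚ, ∀ y ∈ D, ∀ k : ℕ, (¬ ((q:ℝ) ∈ Ioo (-1) t)) ∨ ∃ x ∈ D, G p x t < G p y q + 1 / ((k:ℝ) + 1)
    constructor
    · rintro ⟨hp, x, hx, ht, h1, h2⟩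
      have htI : t ∈ Icc (-1:ℝ) 0 := ⟨ht.1.le, ht.2⟩
      refine ⟨⟨⟨hp, ht⟩, ?_⟩, ?_⟩
      · obtain ⟨y, hy, hy2⟩ := dense_lt hDd hDB (hFx p t htI) hx h1
        exact ⟨y, hy, by rw [hGF _ _ _ htI]; exact hy2⟩
      · intro q y hy k
        by_cases hq : (q:ℝ) ∈ Ioo (-1) t
        · right
          have hqI : (q:ℝ) ∈ Icc (-1:ℝ) 0 := ⟨hq.1.le, hq.2.le.trans ht.2⟩
          have h3 : F p x t ≤ F p y q := h2 y (hDB hy) q ⟨hq.1.le, hq.2.le⟩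
          have h4 : F p x t < F p y q + 1 / ((k:ℝ) + 1) := by
            have : (0:ℝ) < 1 / ((k:ℝ) + 1) := by positivity
            linarith
          obtain ⟨z, hz, hz2⟩ := dense_lt hDd hDB (hFx p t htI) hx h4
          exact ⟨z, hz, by rw [hGF _ _ _ htI, hGF _ _ _ hqI]; exact hz2⟩
        · left; exact hq
    · rintro ⟨⟨⟨hp, ht⟩, ⟨x1, hx1, hx1'⟩⟩, h3⟩
      have htI : t ∈ Icc (-1:ℝ) 0 := ⟨ht.1.le, ht.2⟩
      rw [hGF _ _ _ htI] at hx1'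
      obtain ⟨x, hx, hmin⟩ := (isCompact_closedBall (0 : E n) 1).exists_isMinOn ⟨x1, hDB hx1⟩ (hFx p t htI)
      have hxx : F p x t < 7 / 8 := (hmin (hDB hx1)).trans_lt hx1'
      refine ⟨hp, x, hx, ht, hxx, ?_⟩
      intro y hy s hs
      change F p x t ≤ F p y s
      rcases hs.2.eq_or_lt with h | h
      · rw [h]; exact hmin hy
      rcases hs.1.eq_or_lt with h' | h'
      · have h5 := hw (y, s) ⟨hy, ⟨hs.1, hs.2.trans ht.2⟩⟩
        have h6 := inner_le_eighth hp (mem_closedBall_zero_iff.1 hy)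
        refine hxx.le.trans ?_
        simp only [hF]
        rw [← h'] at h5 ⊢
        nlinarith [norm_nonneg y]
      · by_contra hlt
        push Not at hlt
        have hsI : s ∈ Icc (-1:ℝ) 0 := ⟨hs.1, hs.2.trans ht.2⟩
        obtain ⟨y', hy', hy'2⟩ := dense_lt hDd hDB (hFx p s hsI) hy hlt
        have h7 : ∀ᶠ r in nhds s, F p y' r < F p x t := (hFt p y' (hDB hy') s hsI).eventually (gt_mem_nhds hy'2)
        have h8 : ∀ᶠ r in nhds s, r ∈ Ioo (-1) t := Ioo_mem_nhds h' h
        obtain ⟨q, hq⟩ := (Rat.denseRange_cast (𝕜 := ℝ)).exists_mem_open (isOpen_interior (s := {r | F p y' r < F p x t ∧ r ∈ Ioo (-1) t}))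
          ⟨s, mem_interior_iff_mem_nhds.2 (h7.and h8)⟩
        obtain ⟨hq1, hq2⟩ := interior_subset hq
        have hqI : (q:ℝ) ∈ Icc (-1:ℝ) 0 := ⟨hq2.1.le, hq2.2.le.trans ht.2⟩
        obtain ⟨k, hk⟩ := exists_nat_one_div_lt (sub_pos.2 hq1)
        rcases h3 q y' hy' k with h9 | ⟨z, hz, hz2⟩
        · exact h9 hq2
        · rw [hGF _ _ _ htI, hGF _ _ _ hqI] at hz2
          have : F p x t ≤ F p z t := hmin (hDB hz)
          linarith
  rw [key]
  refine MeasurableSet.inter (MeasurableSet.inter (MeasurableSet.inter ?_ ?_) ?_) ?_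
  · exact measurableSet_le (by fun_prop) measurable_const
  · exact measurable_snd measurableSet_Ioc
  · exact MeasurableSet.biUnion hDc fun x hx => measurableSet_lt (hGm x (hDB hx)) measurable_const
  · refine MeasurableSet.iInter fun q => MeasurableSet.biInter hDc fun y hy => MeasurableSet.iInter fun k => ?_
    refine MeasurableSet.union ?_ (MeasurableSet.biUnion hDc fun x hx => ?_)
    · apply MeasurableSet.compl
      change MeasurableSet {P : E n × ℝ | (-1:ℝ) < q ∧ (q:ℝ) < P.2}
      exact (MeasurableSet.const _).inter (measurableSet_lt measurable_const measurable_snd)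
    · refine measurableSet_lt (hGm x (hDB hx)) ?_
      have : Measurable fun P : E n × ℝ => G P.1 y q := by
        simp only [hG]; fun_prop
      exact this.add measurable_const

theorem ML_unit {n : ℕ} {ν : ℝ} (hν : 0 < ν) :
    ∃ μ : ℝ, 0 < μ ∧ ∀ w : E n × ℝ → ℝ, Sup ν w (closedBall 0 1 ×ˢ Icc (-1) 0) →
      (∀ X ∈ closedBall 0 1 ×ˢ Icc (-1) 0, 0 ≤ w X) → w (0, 0) ≤ 1 / 2 →
      ENNReal.ofReal μ ≤ volume {X : E n × ℝ | X ∈ ball (0 : E n) 1 ×ˢ Ioo (-1 : ℝ) 0 ∧ w X < 1} := by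
  set C : ℝ := 1 + 2 * (n * ν⁻¹) with hC
  have hC0 : 0 < C := by rw [hC]; positivity
  have hCd : 0 < (C / ν) ^ n := by positivity
  set ω := (volume (closedBall (0 : E n) (1 / 8))).toReal with hω
  have hωt : volume (closedBall (0 : E n) (1 / 8)) ≠ ⊤ := measure_closedBall_lt_top.ne
  have hω0 : 0 < ω := ENNReal.toReal_pos (measure_closedBall_pos _ _ (by norm_num)).ne' hωt
  refine ⟨ω * (3 / 8 / (C + 1)) / (C / ν) ^ n, by positivity, fun w hS hw hw0 => ?_⟩
  set Θ : Set (E n × ℝ) := {P : E n × ℝ | ‖P.1‖ ≤ 1 / 8 ∧ ∃ x, Rec w P.1 x P.2} with hΘ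
  have hΘm : MeasurableSet Θ := theta_meas hS.1 hw
  set S : Set (E n × ℝ) := {X : E n × ℝ | X ∈ ball (0 : E n) 1 ×ˢ Ioo (-1 : ℝ) 0 ∧ w X < 1} with hSdef
  have h1 : ENNReal.ofReal (ω * (3 / 8 / (C + 1))) ≤ volume Θ := by
    have : volume Θ = ∫⁻ p, volume (Prod.mk p ⁻¹' Θ) := Measure.prod_apply hΘm
    rw [this]
    calc ENNReal.ofReal (ω * (3 / 8 / (C + 1))) = ENNReal.ofReal (3 / 8 / (C + 1)) * volume (closedBall (0 : E n) (1 / 8)) := by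
          rw [ENNReal.ofReal_mul hω0.le, hω, ENNReal.ofReal_toReal hωt, mul_comm]
      _ = ∫⁻ p in closedBall (0 : E n) (1 / 8), ENNReal.ofReal (3 / 8 / (C + 1)) := by simp
      _ ≤ ∫⁻ p in closedBall (0 : E n) (1 / 8), volume (Prod.mk p ⁻¹' Θ) := by
          refine setLIntegral_mono' measurableSet_closedBall fun p hp => ?_
          have hp' : ‖p‖ ≤ 1 / 8 := mem_closedBall_zero_iff.1 hp
          refine (rec_times hν hS hw hw0 hp' hC).trans (measure_mono ?_)
          intro t ht
          exact ⟨hp', ht⟩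
      _ ≤ _ := setLIntegral_le_lintegral _ _
  have h2 : volume Θ ≤ ENNReal.ofReal ((C / ν) ^ n) * volume S := by
    have : volume Θ = ∫⁻ t, volume ((fun p => (p, t)) ⁻¹' Θ) := Measure.prod_apply_symm hΘm
    rw [this]
    have hS' : ∫⁻ t, volume ((fun p => (p, t)) ⁻¹' S) ≤ volume S := by
      calc ∫⁻ t, volume ((fun p => (p, t)) ⁻¹' S) ≤ ∫⁻ t, volume ((fun p => (p, t)) ⁻¹' (toMeasurable volume S)) := by
            refine lintegral_mono fun t => measure_mono (preimage_mono (subset_toMeasurable _ _))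
        _ = volume (toMeasurable volume S) := (Measure.prod_apply_symm (measurableSet_toMeasurable _ _)).symm
        _ = volume S := measure_toMeasurable S
    refine le_trans ?_ (mul_le_mul_right hS' _)
    rw [← lintegral_const_mul' _ _ ENNReal.ofReal_ne_top]
    have hae : ∀ᵐ t : ℝ, t ≠ 0 := by simp [ae_iff]
    refine lintegral_mono_ae (hae.mono fun t ht0 => ?_)
    by_cases ht : t ∈ Ioo (-1:ℝ) 0
    · refine (slice_bound hν hS.1 hw hC ⟨ht.1.le, ht.2.le⟩).trans ?_
      gcongr
      rintro x ⟨hx, hx2⟩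
      exact ⟨⟨hx, ht⟩, hx2⟩
    · have : ((fun p => (p, t)) ⁻¹' Θ) = ∅ := by
        ext p
        simp only [mem_preimage, mem_empty_iff_false, iff_false]
        rintro ⟨-, x, -, hx, -⟩
        exact ht ⟨hx.1, lt_of_le_of_ne hx.2 ht0⟩
      rw [this]; simp
  rw [ENNReal.ofReal_div_of_pos hCd]
  refine ENNReal.div_le_of_le_mul ?_
  exact (h1.trans h2).trans (le_of_eq (mul_comm _ _))

/-- Standard parabolic cylinder with top center `Y` and radius `r`. -/
def CC {n : ℕ} (Y : E n × ℝ) (r : ℝ) : Set (E n × ℝ) := ball Y.1 r ×ˢ Ioo (Y.2 - r ^ 2) Y.2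

/-- Parabolic rescaling. -/
def aff {n : ℕ} (x0 : E n) (t0 r : ℝ) (X : E n × ℝ) : E n × ℝ := (x0 + r • X.1, t0 + r ^ 2 * X.2)

theorem isOpen_CC {n : ℕ} (Y : E n × ℝ) (r : ℝ) : IsOpen (CC Y r) := isOpen_ball.prod isOpen_Ioo

theorem vol_aff {n : ℕ} (x0 : E n) (t0 : ℝ) {r : ℝ} (hr : 0 < r) (S : Set (E n × ℝ)) :
    volume (aff x0 t0 r '' S) = ENNReal.ofReal (r ^ (n + 2)) * volume S := by
  set f : E n × ℝ →ₗ[ℝ] E n × ℝ := LinearMap.prodMap (r • LinearMap.id) (r ^ 2 • LinearMap.id) with hf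
  have h1 : aff x0 t0 r '' S = (fun X => (x0, t0) + X) '' (f '' S) := by
    rw [image_image]
    rfl
  rw [h1]
  haveI : (volume : Measure (E n × ℝ)).IsAddHaarMeasure :=
    inferInstanceAs (((volume : Measure (E n)).prod (volume : Measure ℝ)).IsAddHaarMeasure)
  have h2 : volume ((fun X : E n × ℝ => (x0, t0) + X) '' (f '' S)) = volume (f '' S) := by
    rw [image_add_left, measure_preimage_add]
  rw [h2]
  have h3 := Measure.addHaar_image_linearMap (volume : Measure (E n × ℝ)) f S
  rw [h3]
  congr 2
  rw [hf, LinearMap.det_prodMap]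
  simp only [LinearMap.det_smul, LinearMap.det_id, finrank_euclideanSpace, Fintype.card_fin, Module.finrank_self]
  rw [abs_of_nonneg (by positivity)]
  ring

theorem CC_eq_aff {n : ℕ} (x0 : E n) (t0 : ℝ) {r : ℝ} (hr : 0 < r) :
    CC (x0, t0) r = aff x0 t0 r '' (ball (0 : E n) 1 ×ˢ Ioo (-1 : ℝ) 0) := by
  ext ⟨x, t⟩
  constructor
  · rintro ⟨h1, h2, h3⟩
    simp only [mem_ball, dist_eq_norm] at h1 h2 h3
    have hr2 : 0 < r ^ 2 := by positivity
    refine ⟨(r⁻¹ • (x - x0), (t - t0) / r ^ 2), ⟨?_, ?_, ?_⟩, ?_⟩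
    · simp only [mem_ball, dist_zero_right, norm_smul, norm_inv, Real.norm_of_nonneg hr.le]
      rw [inv_mul_lt_iff₀ hr]; linarith
    · change -1 < (t - t0) / r ^ 2
      rw [lt_div_iff₀ hr2]; linarith
    · change (t - t0) / r ^ 2 < 0
      exact div_neg_of_neg_of_pos (by linarith) hr2
    · simp only [aff]
      rw [smul_inv_smul₀ hr.ne', mul_div_cancel₀ _ hr2.ne']
      simp
  · rintro ⟨⟨y, s⟩, ⟨h1, h2, h3⟩, h4⟩
    simp only [aff, Prod.mk.injEq] at h4
    obtain ⟨rfl, rfl⟩ := h4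
    simp only [mem_ball, dist_zero_right] at h1 h2 h3
    refine ⟨?_, ?_, ?_⟩
    · simp only [mem_ball, dist_eq_norm, add_sub_cancel_left, norm_smul, Real.norm_of_nonneg hr.le]
      nlinarith
    · change t0 - r ^ 2 < t0 + r ^ 2 * s
      nlinarith [sq_pos_of_pos hr]
    · change t0 + r ^ 2 * s < t0
      nlinarith [sq_pos_of_pos hr]

theorem vol_unit {n : ℕ} : volume (ball (0 : E n) 1 ×ˢ Ioo (-1 : ℝ) 0) = volume (ball (0 : E n) 1) := by
  have : (volume : Measure (E n × ℝ)) = volume.prod volume := rfl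
  rw [this, Measure.prod_prod]
  simp

theorem vol_CC {n : ℕ} (Y : E n × ℝ) {r : ℝ} (hr : 0 < r) :
    volume (CC Y r) = ENNReal.ofReal (r ^ (n + 2)) * volume (ball (0 : E n) 1) := by
  obtain ⟨x0, t0⟩ := Y
  rw [CC_eq_aff x0 t0 hr, vol_aff x0 t0 hr, vol_unit]

theorem vol_CC_lt_top {n : ℕ} (Y : E n × ℝ) {r : ℝ} (hr : 0 < r) : volume (CC Y r) < ⊤ := by
  rw [vol_CC Y hr]
  exact ENNReal.mul_lt_top ENNReal.ofReal_lt_top measure_ball_lt_top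

theorem vol_CC_pos {n : ℕ} (Y : E n × ℝ) {r : ℝ} (hr : 0 < r) : 0 < volume (CC Y r) := by
  rw [vol_CC Y hr]
  exact ENNReal.mul_pos (by simp; positivity) (measure_ball_pos _ _ one_pos).ne'

theorem ML {n : ℕ} {ν : ℝ} (hν : 0 < ν) :
    ∃ μ : ℝ, 0 < μ ∧ μ ≤ 1 ∧ ∀ (w : E n × ℝ → ℝ) (y : E n) (s r k : ℝ), 0 < r → 0 < k →
      Sup ν w (closedBall y r ×ˢ Icc (s - r ^ 2) s) →
      (∀ X ∈ closedBall y r ×ˢ Icc (s - r ^ 2) s, 0 ≤ w X) → w (y, s) ≤ k / 2 →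
      ENNReal.ofReal μ * volume (CC (y, s) r) ≤ volume {X : E n × ℝ | X ∈ CC (y, s) r ∧ w X < k} := by
  obtain ⟨μ, hμ, H⟩ := ML_unit (n := n) hν
  set ω := (volume (ball (0 : E n) 1)).toReal with hω
  have hωt : volume (ball (0 : E n) 1) ≠ ⊤ := measure_ball_lt_top.ne
  have hω0 : 0 < ω := ENNReal.toReal_pos (measure_ball_pos _ _ one_pos).ne' hωt
  refine ⟨min (μ / ω) 1, by positivity, min_le_right _ _, fun w y s r k hr hk hS hw hy => ?_⟩
  have hbox : closedBall y (r * 1) ×ˢ Icc (s + r ^ 2 * (-1)) (s + r ^ 2 * 0) ⊆ closedBall y r ×ˢ Icc (s - r ^ 2) s := by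
    rw [mul_one, mul_zero, add_zero, mul_neg_one, ← sub_eq_add_neg]
  have hsub := mem_scl_box hr hbox
  have h1 := H (scl w y s r k⁻¹ 0) ((hS.scl y s 0 hr (by positivity)).mono hsub) ?_ ?_
  · have h2 : {X : E n × ℝ | X ∈ CC (y, s) r ∧ w X < k} =
        aff y s r '' {X : E n × ℝ | X ∈ ball (0 : E n) 1 ×ˢ Ioo (-1 : ℝ) 0 ∧ scl w y s r k⁻¹ 0 X < 1} := by
      rw [CC_eq_aff y s hr]
      ext X
      constructor
      · rintro ⟨⟨Z, hZ, rfl⟩, h⟩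
        refine ⟨Z, ⟨hZ, ?_⟩, rfl⟩
        simp only [scl, add_zero]
        rw [inv_mul_lt_iff₀ hk, mul_one]; exact h
      · rintro ⟨Z, ⟨hZ, h⟩, rfl⟩
        refine ⟨⟨Z, hZ, rfl⟩, ?_⟩
        simp only [scl, add_zero] at h
        rw [inv_mul_lt_iff₀ hk, mul_one] at h; exact h
    rw [h2, vol_aff y s hr, vol_CC _ hr, mul_left_comm]
    gcongr
    refine le_trans ?_ h1
    calc ENNReal.ofReal (min (μ / ω) 1) * volume (ball (0 : E n) 1)
        ≤ ENNReal.ofReal (μ / ω) * volume (ball (0 : E n) 1) := by gcongr; exact min_le_left _ _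
      _ = ENNReal.ofReal (μ / ω) * ENNReal.ofReal ω := by rw [hω, ENNReal.ofReal_toReal hωt]
      _ = ENNReal.ofReal μ := by
        rw [← ENNReal.ofReal_mul (by positivity), div_mul_cancel₀ _ hω0.ne']
  · intro X hX
    have := hw _ (hsub hX)
    simp only [scl, add_zero]; positivity
  · simp only [scl, add_zero, smul_zero, mul_zero]
    rw [inv_mul_le_iff₀ hk]; linarith

theorem meas_lt {n : ℕ} {ν : ℝ} {u : E n × ℝ → ℝ} {B : Set (E n)} {I : Set ℝ} (hB : MeasurableSet B)
    (hI : MeasurableSet I) (h : PS ν u (B ×ˢ I)) (c : ℝ) :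
    MeasurableSet {X : E n × ℝ | X ∈ B ×ˢ I ∧ u X < c} := by
  have h1 : Measurable (Function.uncurry fun (x : B) (t : I) => u ((x : E n), (t : ℝ))) := by
    refine measurable_uncurry_of_continuous_of_measurable (fun t => ?_) (fun x => ?_)
    · rw [continuous_iff_continuousAt]
      intro x
      exact ContinuousAt.comp (g := fun x => u (x, (t:ℝ))) (h.contx ⟨x.2, t.2⟩) continuous_subtype_val.continuousAt
    · refine Continuous.measurable ?_
      rw [continuous_iff_continuousAt]
      intro t
      exact ContinuousAt.comp (g := fun t => u ((x:E n), t)) (h.contt ⟨x.2, t.2⟩) continuous_subtype_val.continuousAt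
  have h2 := (MeasurableEmbedding.subtype_coe hB).prodMap (MeasurableEmbedding.subtype_coe hI)
  have h3 := h2.measurableSet_image.2 (measurableSet_lt h1 (measurable_const (a := c)))
  convert h3 using 1
  ext ⟨x, t⟩
  constructor
  · rintro ⟨⟨hx, ht⟩, hu⟩
    exact ⟨(⟨x, hx⟩, ⟨t, ht⟩), hu, rfl⟩
  · rintro ⟨⟨⟨x, hx⟩, ⟨t, ht⟩⟩, hu, h⟩
    simp only [Prod.map_apply, Prod.mk.injEq] at h
    obtain ⟨rfl, rfl⟩ := h
    exact ⟨⟨hx, ht⟩, hu⟩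

/-- `Γ` is `η`-dense in the cylinder `CC Y ρ`. -/
def Dn {n : ℕ} (Γ : Set (E n × ℝ)) (η : ℝ) (Y : E n × ℝ) (ρ : ℝ) : Prop :=
  ENNReal.ofReal (1 - η) * volume (CC Y ρ) ≤ volume (Γ ∩ CC Y ρ)

theorem one_dim {ι : Type*} (S : Set ι) (σ L : ι → ℝ) {m : ℝ} (hm : 0 < m) (hL : ∀ i ∈ S, 0 < L i) :
    volume (⋃ i ∈ S, Ioo (σ i - L i) (σ i)) ≤
      ENNReal.ofReal (1 + 1 / m) * volume (⋃ i ∈ S, Ioo (σ i) (σ i + m * L i)) := by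
  set V : Set ℝ := ⋃ i ∈ S, Ioo (σ i) (σ i + m * L i) with hV
  have hVo : IsOpen V := isOpen_biUnion fun i _ => isOpen_Ioo
  by_cases hfin : volume V = ⊤
  · rw [hfin, ENNReal.mul_top]
    · exact le_top
    · simp; positivity
  set T : Set (Set ℝ) := {c | ∃ x ∈ V, c = connectedComponentIn V x} with hT
  have hTo : ∀ c ∈ T, IsOpen c := by rintro c ⟨x, hx, rfl⟩; exact hVo.connectedComponentIn
  have hTn : ∀ c ∈ T, c.Nonempty := by
    rintro c ⟨x, hx, rfl⟩; exact ⟨x, mem_connectedComponentIn hx⟩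
  have hTd : T.PairwiseDisjoint id := by
    rintro c ⟨x, hx, rfl⟩ d ⟨y, hy, rfl⟩ hcd
    rw [Function.onFun, id, id]
    by_contra h
    rw [not_disjoint_iff] at h
    obtain ⟨z, hz1, hz2⟩ := h
    exact hcd ((connectedComponentIn_eq hz1).trans (connectedComponentIn_eq hz2).symm)
  have hTc : T.Countable := hTd.countable_of_isOpen hTo hTn
  have hTV : ∀ c ∈ T, c ⊆ V := by rintro c ⟨x, hx, rfl⟩; exact connectedComponentIn_subset _ _
  have hTp : ∀ c ∈ T, IsPreconnected c := by rintro c ⟨x, hx, rfl⟩; exact isPreconnected_connectedComponentIn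
  have hbd : ∀ c ∈ T, BddBelow c ∧ BddAbove c := by
    intro c hc
    obtain ⟨x, hx⟩ := hTn c hc
    have hoc := (hTp c hc).ordConnected
    have key : ∀ y ∈ c, ∀ z ∈ c, z - y ≤ (volume V).toReal := by
      intro y hy z hz
      have h1 : volume (Icc y z) ≤ volume V := measure_mono ((hoc.out hy hz).trans (hTV c hc))
      rw [Real.volume_Icc] at h1
      exact (ENNReal.ofReal_le_iff_le_toReal hfin).1 h1
    exact ⟨⟨x - (volume V).toReal, fun y hy => by linarith [key y hy x hx]⟩,
      ⟨x + (volume V).toReal, fun y hy => by linarith [key x hx y hy]⟩⟩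
  have hcov : (⋃ i ∈ S, Ioo (σ i - L i) (σ i)) ⊆ ⋃ c ∈ T, Ioo (sInf c - (sSup c - sInf c) / m) (sSup c) := by
    intro t ht
    simp only [mem_iUnion, exists_prop] at ht ⊢
    obtain ⟨i, hi, ht⟩ := ht
    have hLi := hL i hi
    have hmL : 0 < m * L i := mul_pos hm hLi
    set p := σ i + m * L i / 2 with hp
    have hpI : p ∈ Ioo (σ i) (σ i + m * L i) := ⟨by linarith, by linarith⟩
    have hsubV : Ioo (σ i) (σ i + m * L i) ⊆ V := by
      intro z hz; rw [hV]; simp only [mem_iUnion, exists_prop]; exact ⟨i, hi, hz⟩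
    have hc : connectedComponentIn V p ∈ T := ⟨p, hsubV hpI, rfl⟩
    set c := connectedComponentIn V p with hcdef
    have hsub : Ioo (σ i) (σ i + m * L i) ⊆ c := isPreconnected_Ioo.subset_connectedComponentIn hpI hsubV
    have hne : (Ioo (σ i) (σ i + m * L i)).Nonempty := ⟨p, hpI⟩
    have h1 : sInf c ≤ σ i := by
      have := csInf_le_csInf (hbd c hc).1 hne hsub
      rwa [csInf_Ioo (by linarith)] at this
    have h2 : σ i + m * L i ≤ sSup c := by
      have := csSup_le_csSup (hbd c hc).2 hne hsub
      rwa [csSup_Ioo (by linarith)] at this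
    refine ⟨c, hc, ?_, by linarith [ht.2]⟩
    have h3 : m * L i ≤ sSup c - sInf c := by linarith
    have h4 : L i ≤ (sSup c - sInf c) / m := by rw [le_div_iff₀ hm]; linarith
    have h5 : L i ≤ (sSup c - σ i) / m := by rw [le_div_iff₀ hm]; linarith
    have h6 : (sSup c - σ i) / m ≤ (sSup c - sInf c) / m := by gcongr
    linarith [ht.1]
  have hVeq : V = ⋃ c ∈ T, c := by
    ext x
    simp only [mem_iUnion, exists_prop]
    exact ⟨fun hx => ⟨_, ⟨x, hx, rfl⟩, mem_connectedComponentIn hx⟩, fun ⟨c, hc, hx⟩ => hTV c hc hx⟩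
  calc volume (⋃ i ∈ S, Ioo (σ i - L i) (σ i))
      ≤ volume (⋃ c ∈ T, Ioo (sInf c - (sSup c - sInf c) / m) (sSup c)) := measure_mono hcov
    _ ≤ ∑' c : T, volume (Ioo (sInf c.1 - (sSup c.1 - sInf c.1) / m) (sSup c.1)) := measure_biUnion_le _ hTc _
    _ ≤ ∑' c : T, ENNReal.ofReal (1 + 1 / m) * volume c.1 := by
        refine ENNReal.tsum_le_tsum fun c => ?_
        have h1 : Ioo (sInf c.1) (sSup c.1) ⊆ c.1 :=
          IsConnected.Ioo_csInf_csSup_subset ⟨hTn c c.2, hTp c c.2⟩ (hbd c c.2).1 (hbd c c.2).2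
        have h2 := measure_mono (μ := volume) h1
        rw [Real.volume_Ioo] at h2 ⊢
        refine le_trans (le_of_eq ?_) (mul_le_mul_right h2 _)
        rw [← ENNReal.ofReal_mul (by positivity)]
        congr 1; field_simp; ring
    _ = ENNReal.ofReal (1 + 1 / m) * ∑' c : T, volume c.1 := ENNReal.tsum_mul_left
    _ = ENNReal.ofReal (1 + 1 / m) * volume V := by
        congr 1
        have := measure_biUnion (μ := volume) hTc hTd (fun c hc => (hTo c hc).measurableSet)
        rw [hVeq]; exact this.symm

theorem VL {n : ℕ} (Γ : Set (E n × ℝ)) (hΓ : MeasurableSet Γ) (F : Set ((E n × ℝ) × ℝ)) (R : ℝ) {η : ℝ}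
    (hF : ∀ p ∈ F, 0 < p.2 ∧ p.2 ≤ R ∧ ENNReal.ofReal η * volume (CC p.1 p.2) ≤ volume (CC p.1 p.2 \ Γ)) :
    ENNReal.ofReal η * volume (⋃ p ∈ F, CC p.1 p.2) ≤
      ENNReal.ofReal (5 ^ (n + 2)) * volume ((⋃ p ∈ F, CC p.1 p.2) \ Γ) := by
  have hne : ∀ p ∈ F, (CC p.1 p.2).Nonempty := by
    rintro ⟨⟨y, s⟩, ρ⟩ hp
    have := (hF _ hp).1
    refine ⟨(y, s - ρ ^ 2 / 2), mem_ball_self this, ?_, ?_⟩ <;> dsimp only at * <;> nlinarith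
  obtain ⟨G, hGF, hGd, hG⟩ := Vitali.exists_disjoint_subfamily_covering_enlargement
    (fun p : (E n × ℝ) × ℝ => CC p.1 p.2) F (fun p => p.2) 2 (by norm_num) (fun p hp => (hF p hp).1.le) R
    (fun p hp => (hF p hp).2.1) hne
  have hGc : G.Countable := hGd.countable_of_isOpen (fun p _ => isOpen_CC _ _) (fun p hp => hne p (hGF hp))
  have hcov : (⋃ p ∈ F, CC p.1 p.2) ⊆ ⋃ q ∈ G, CC (q.1.1, q.1.2 + 4 * q.2 ^ 2) (5 * q.2) := by
    intro Z hZ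
    simp only [mem_iUnion, exists_prop] at hZ ⊢
    obtain ⟨p, hp, hZ⟩ := hZ
    obtain ⟨q, hq, ⟨W, hW1, hW2⟩, hpq⟩ := hG p hp
    refine ⟨q, hq, ?_⟩
    have hp0 := (hF p hp).1
    have hq0 := (hF q (hGF hq)).1
    obtain ⟨hZ1, hZ2, hZ3⟩ := hZ
    obtain ⟨hW11, hW12, hW13⟩ := hW1
    obtain ⟨hW21, hW22, hW23⟩ := hW2
    rw [mem_ball] at hZ1 hW11 hW21
    have hsq : p.2 ^ 2 ≤ 4 * q.2 ^ 2 := by nlinarith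
    refine ⟨?_, ?_, ?_⟩
    · change dist Z.1 q.1.1 < 5 * q.2
      have h1 := dist_triangle Z.1 p.1.1 q.1.1
      have h2 := dist_triangle p.1.1 W.1 q.1.1
      rw [dist_comm p.1.1 W.1] at h2
      linarith
    · change q.1.2 + 4 * q.2 ^ 2 - (5 * q.2) ^ 2 < Z.2
      nlinarith
    · change Z.2 < q.1.2 + 4 * q.2 ^ 2
      nlinarith
  calc ENNReal.ofReal η * volume (⋃ p ∈ F, CC p.1 p.2)
      ≤ ENNReal.ofReal η * ∑' q : G, volume (CC (q.1.1.1, q.1.1.2 + 4 * q.1.2 ^ 2) (5 * q.1.2)) := by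
        gcongr
        exact (measure_mono hcov).trans (measure_biUnion_le _ hGc _)
    _ = ∑' q : G, ENNReal.ofReal η * volume (CC (q.1.1.1, q.1.1.2 + 4 * q.1.2 ^ 2) (5 * q.1.2)) := ENNReal.tsum_mul_left.symm
    _ ≤ ∑' q : G, ENNReal.ofReal (5 ^ (n + 2)) * volume (CC q.1.1 q.1.2 \ Γ) := by
        refine ENNReal.tsum_le_tsum fun q => ?_
        obtain ⟨h0, -, h1⟩ := hF q.1 (hGF q.2)
        refine le_trans (le_of_eq ?_) (mul_le_mul_right h1 _)
        rw [vol_CC _ (by linarith : 0 < 5 * q.1.2), vol_CC _ h0, mul_pow, ENNReal.ofReal_mul (by positivity)]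
        ring
    _ = ENNReal.ofReal (5 ^ (n + 2)) * ∑' q : G, volume (CC q.1.1 q.1.2 \ Γ) := ENNReal.tsum_mul_left
    _ = ENNReal.ofReal (5 ^ (n + 2)) * volume (⋃ q ∈ G, CC q.1 q.2 \ Γ) := by
        rw [measure_biUnion hGc]
        · intro p hp q hq hpq
          exact (hGd hp hq hpq).mono sdiff_subset sdiff_subset
        · exact fun p _ => (isOpen_CC _ _).measurableSet.diff hΓ
    _ ≤ _ := by
        gcongr
        intro Z hZ
        simp only [mem_iUnion, exists_prop, Set.mem_sdiff] at hZ ⊢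
        obtain ⟨q, hq, h1, h2⟩ := hZ
        exact ⟨⟨q, hGF hq, h1⟩, h2⟩

theorem not_dense {n : ℕ} {Γ : Set (E n × ℝ)} (hΓ : MeasurableSet Γ) {η : ℝ} (hη : 0 ≤ η) {Y : E n × ℝ} {ρ : ℝ}
    (hρ : 0 < ρ) (h : ¬ Dn Γ η Y ρ) : ENNReal.ofReal η * volume (CC Y ρ) ≤ volume (CC Y ρ \ Γ) := by
  unfold Dn at h
  push Not at h
  by_contra h2
  push Not at h2
  have h3 : volume (CC Y ρ) = volume (Γ ∩ CC Y ρ) + volume (CC Y ρ \ Γ) := by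
    rw [inter_comm, measure_inter_add_sdiff _ hΓ]
  have h4 := ENNReal.add_lt_add h h2
  rw [← h3, ← add_mul] at h4
  by_cases hη1 : η ≤ 1
  · rw [← ENNReal.ofReal_add (by linarith) hη] at h4
    simp at h4
  · have : ENNReal.ofReal (1 - η) = 0 := ENNReal.ofReal_eq_zero.2 (by linarith)
    rw [this, zero_mul] at h
    exact not_lt_zero h

theorem CC_mono {n : ℕ} (Y : E n × ℝ) {r s : ℝ} (hr : 0 < r) (h : r ≤ s) : CC Y r ⊆ CC Y s := by
  rintro X ⟨h1, h2, h3⟩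
  exact ⟨ball_subset_ball h h1, by have : r ^ 2 ≤ s ^ 2 := by gcongr
                                   linarith, h3⟩

/-- Dense at small radius implies a dense-to-nondense transition. -/
theorem stop_radius {n : ℕ} {Γ : Set (E n × ℝ)} {η ρ0 : ℝ} (hρ0 : 0 < ρ0)
    (hno : ∀ Y ρ, ρ0 ≤ ρ → ρ < 2 * ρ0 → ¬ Dn Γ η Y ρ) {Y : E n × ℝ} {ρ : ℝ} (hρ : 0 < ρ) (hρ2 : ρ < 2 * ρ0)
    (hd : Dn Γ η Y ρ) : ∃ r, 0 < r ∧ r < ρ0 ∧ ρ ≤ r ∧ Dn Γ η Y r ∧ ¬ Dn Γ η Y (2 * r) := by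
  by_contra hcon
  push Not at hcon
  have key : ∀ k : ℕ, 2 ^ k * ρ < ρ0 ∧ Dn Γ η Y (2 ^ k * ρ) := by
    intro k
    induction k with
    | zero =>
      simp only [pow_zero, one_mul]
      refine ⟨?_, hd⟩
      by_contra h
      exact hno Y ρ (not_lt.1 h) hρ2 hd
    | succ k ih =>
      have h1 := hcon (2 ^ k * ρ) (by positivity) ih.1 (le_mul_of_one_le_left hρ.le (one_le_pow₀ (by norm_num))) ih.2
      have e : 2 * (2 ^ k * ρ) = 2 ^ (k + 1) * ρ := by ring
      rw [e] at h1
      refine ⟨?_, h1⟩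
      by_contra h
      exact hno Y _ (not_lt.1 h) (by rw [← e]; linarith [ih.1]) h1
  obtain ⟨k, hk⟩ := pow_unbounded_of_one_lt (ρ0 / ρ) (by norm_num : (1:ℝ) < 2)
  rw [div_lt_iff₀ hρ] at hk
  exact absurd hk (not_lt.2 (key k).1.le)

theorem COV (n : ℕ) {η : ℝ} (hη : 0 < η) (hη1 : η ≤ 1) : ∃ θ m : ℝ, 0 < θ ∧ 0 < m ∧
    ∀ (Γ : Set (E n × ℝ)), MeasurableSet Γ → volume Γ ≠ ⊤ → ∀ ρ0 : ℝ, 0 < ρ0 →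
      (∀ Y ρ, ρ0 ≤ ρ → ρ < 2 * ρ0 → ¬ Dn Γ η Y ρ) →
      ENNReal.ofReal (1 + θ) * volume Γ ≤
        volume (⋃ p ∈ {p : (E n × ℝ) × ℝ | 0 < p.2 ∧ p.2 < ρ0 ∧ Dn Γ η p.1 p.2},
          ball p.1.1 (2 * p.2) ×ˢ Ioo (p.1.2 + p.2 ^ 2) (p.1.2 + p.2 ^ 2 + m * (5 * p.2 ^ 2))) := by
  set θ1 : ℝ := η / 5 ^ (n + 2) with hθ1
  have h5 : (1:ℝ) ≤ 5 ^ (n + 2) := one_le_pow₀ (by norm_num)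
  have hθ10 : 0 < θ1 := by positivity
  have hθ11 : θ1 ≤ 1 := by rw [hθ1, div_le_one (by positivity)]; linarith
  refine ⟨θ1 / 3, 3 / θ1, by positivity, by positivity, fun Γ hΓ hfin ρ0 hρ0 hno => ?_⟩
  set m := 3 / θ1 with hm
  have hm0 : 0 < m := by positivity
  set A : Set ((E n × ℝ) × ℝ) := {p | 0 < p.2 ∧ p.2 < ρ0 ∧ Dn Γ η p.1 p.2 ∧ ¬ Dn Γ η p.1 (2 * p.2)} with hA
  set U1 : Set (E n × ℝ) := ⋃ p ∈ A, CC p.1 (2 * p.2) with hU1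
  have hU1o : IsOpen U1 := isOpen_biUnion fun p _ => isOpen_CC _ _
  -- step 1 : the part of Γ outside U1 is null
  have hnull : volume (Γ \ U1) = 0 := by
    have hmeas : MeasurableSet (Γ \ U1) := hΓ.diff hU1o.measurableSet
    have hfin' : volume (Γ \ U1) ≠ ⊤ := ne_top_of_le_ne_top hfin (measure_mono sdiff_subset)
    have hle : ∀ ε : ENNReal, ε ≠ 0 → ENNReal.ofReal η * volume (Γ \ U1) ≤ ENNReal.ofReal (5 ^ (n + 2)) * ε := by
      intro ε hε
      obtain ⟨U, hUs, hUo, hUv⟩ := hmeas.exists_isOpen_sdiff_lt hfin' hε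
      set F : Set ((E n × ℝ) × ℝ) := {p | 0 < p.2 ∧ p.2 < 2 * ρ0 ∧ CC p.1 p.2 ⊆ U ∧ ¬ Dn Γ η p.1 p.2} with hF
      have h1 := VL Γ hΓ F (2 * ρ0) (η := η) (fun p hp => ⟨hp.1, hp.2.1.le, not_dense hΓ hη.le hp.1 hp.2.2.2⟩)
      have h2 : Γ \ U1 ⊆ ⋃ p ∈ F, CC p.1 p.2 := by
        rintro ⟨x, t⟩ hX
        simp only [mem_iUnion, exists_prop]
        obtain ⟨e, he, hball⟩ := Metric.isOpen_iff.1 hUo _ (hUs hX)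
        set ρ := min (min ρ0 e) 1 / 2 with hρ
        have hmin : 0 < min (min ρ0 e) 1 := by positivity
        have ha : min (min ρ0 e) 1 ≤ ρ0 := (min_le_left _ _).trans (min_le_left _ _)
        have hb : min (min ρ0 e) 1 ≤ e := (min_le_left _ _).trans (min_le_right _ _)
        have hc : min (min ρ0 e) 1 ≤ 1 := min_le_right _ _
        have hρpos : 0 < ρ := by positivity
        have hXm : (x, t) ∈ CC (x, t + ρ ^ 2 / 2) ρ := by
          refine ⟨mem_ball_self hρpos, ?_, ?_⟩ <;> dsimp only <;> nlinarith
        refine ⟨((x, t + ρ ^ 2 / 2), ρ), ⟨hρpos, by dsimp only; linarith, ?_, ?_⟩, hXm⟩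
        · rintro ⟨y, s⟩ ⟨hy, hs1, hs2⟩
          refine hball ?_
          dsimp only at hs1 hs2 hy
          rw [mem_ball] at hy
          have hρ1 : ρ ^ 2 ≤ ρ := by nlinarith
          rw [mem_ball, Prod.dist_eq, max_lt_iff]
          refine ⟨by dsimp only; linarith, ?_⟩
          rw [Real.dist_eq, abs_lt]
          constructor <;> dsimp only <;> linarith
        · intro hd
          obtain ⟨r, hr1, hr2, hr3, hr4, hr5⟩ := stop_radius hρ0 hno hρpos (by linarith) hd
          refine hX.2 ?_
          rw [hU1]
          simp only [mem_iUnion, exists_prop]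
          exact ⟨(_, r), ⟨hr1, hr2, hr4, hr5⟩, CC_mono _ hρpos (by linarith) hXm⟩
      calc ENNReal.ofReal η * volume (Γ \ U1) ≤ ENNReal.ofReal η * volume (⋃ p ∈ F, CC p.1 p.2) := by gcongr
        _ ≤ _ := h1
        _ ≤ ENNReal.ofReal (5 ^ (n + 2)) * volume (U \ (Γ \ U1)) := by
          refine mul_le_mul_right (measure_mono ?_) _
          rintro X ⟨hX1, hX2⟩
          obtain ⟨p, hp, hX1⟩ := mem_iUnion₂.1 hX1
          exact ⟨hp.2.2.1 hX1, fun h => hX2 h.1⟩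
        _ ≤ _ := by gcongr; exact hUv.2.le
    have hz : ENNReal.ofReal η * volume (Γ \ U1) = 0 := by
      by_contra h0
      have h0' : 0 < ENNReal.ofReal η * volume (Γ \ U1) := pos_iff_ne_zero.2 h0
      have htop : ENNReal.ofReal η * volume (Γ \ U1) ≠ ⊤ := ENNReal.mul_ne_top ENNReal.ofReal_ne_top hfin'
      have h5p : ENNReal.ofReal (5 ^ (n + 2)) ≠ 0 := by simp
      have := hle ((ENNReal.ofReal η * volume (Γ \ U1)) / 2 / ENNReal.ofReal (5 ^ (n + 2))) (by
        refine (ENNReal.div_pos (ENNReal.div_pos h0 (by simp)).ne' ENNReal.ofReal_ne_top).ne')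
      rw [ENNReal.mul_div_cancel h5p ENNReal.ofReal_ne_top] at this
      exact absurd this (not_le.2 (ENNReal.half_lt_self h0 htop))
    rcases mul_eq_zero.1 hz with h | h
    · simp at h; linarith
    · exact h
  -- step 2
  have hstep2 : ENNReal.ofReal (1 + θ1) * volume Γ ≤ volume U1 := by
    have hVL := VL Γ hΓ ((fun p : (E n × ℝ) × ℝ => (p.1, 2 * p.2)) '' A) (2 * ρ0) (η := η) (by
      rintro p ⟨q, hq, rfl⟩
      exact ⟨by dsimp only; linarith [hq.1], by dsimp only; linarith [hq.2.1],
        not_dense hΓ hη.le (by linarith [hq.1]) hq.2.2.2⟩)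
    rw [biUnion_image] at hVL
    change ENNReal.ofReal η * volume U1 ≤ ENNReal.ofReal (5 ^ (n + 2)) * volume (U1 \ Γ) at hVL
    have h1 : volume Γ = volume (Γ ∩ U1) := by
      rw [← measure_inter_add_sdiff Γ hU1o.measurableSet, hnull, add_zero]
    have h2 : volume U1 = volume (Γ ∩ U1) + volume (U1 \ Γ) := by
      rw [inter_comm, measure_inter_add_sdiff _ hΓ]
    have h3 : ENNReal.ofReal θ1 * volume U1 ≤ volume (U1 \ Γ) := by
      rw [hθ1, ENNReal.ofReal_div_of_pos (by positivity), mul_comm, ← mul_div_assoc, mul_comm]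
      exact ENNReal.div_le_of_le_mul (hVL.trans (le_of_eq (mul_comm _ _)))
    rw [ENNReal.ofReal_add zero_le_one hθ10.le, add_mul, ENNReal.ofReal_one, one_mul]
    calc volume Γ + ENNReal.ofReal θ1 * volume Γ ≤ volume (Γ ∩ U1) + ENNReal.ofReal θ1 * volume U1 := by
          rw [h1]; gcongr; exact inter_subset_right
      _ ≤ volume (Γ ∩ U1) + volume (U1 \ Γ) := by gcongr
      _ = _ := h2.symm
  -- step 3
  set S : Set ((E n × ℝ) × ℝ) := {p : (E n × ℝ) × ℝ | 0 < p.2 ∧ p.2 < ρ0 ∧ Dn Γ η p.1 p.2} with hS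
  set Γ2 : Set (E n × ℝ) := ⋃ p ∈ S, ball p.1.1 (2 * p.2) ×ˢ Ioo (p.1.2 + p.2 ^ 2) (p.1.2 + p.2 ^ 2 + m * (5 * p.2 ^ 2)) with hΓ2
  have hΓ2o : IsOpen Γ2 := isOpen_biUnion fun p _ => isOpen_ball.prod isOpen_Ioo
  have hstep3 : volume U1 ≤ ENNReal.ofReal (1 + 1 / m) * volume Γ2 := by
    have e1 : volume U1 = ∫⁻ x, volume (Prod.mk x ⁻¹' U1) := Measure.prod_apply hU1o.measurableSet
    have e2 : volume Γ2 = ∫⁻ x, volume (Prod.mk x ⁻¹' Γ2) := Measure.prod_apply hΓ2o.measurableSet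
    rw [e1, e2, ← lintegral_const_mul' _ _ ENNReal.ofReal_ne_top]
    refine lintegral_mono fun x => ?_
    have h1 := one_dim {p : (E n × ℝ) × ℝ | p ∈ S ∧ x ∈ ball p.1.1 (2 * p.2)} (fun p => p.1.2 + p.2 ^ 2)
      (fun p => 5 * p.2 ^ 2) hm0 (fun p hp => by have := hp.1.1; positivity)
    refine (measure_mono ?_).trans (h1.trans ?_)
    · intro t ht
      simp only [mem_preimage, hU1, mem_iUnion, exists_prop] at ht
      obtain ⟨p, hp, hx, ht1, ht2⟩ := ht
      simp only [mem_iUnion, exists_prop]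
      have := hp.1
      refine ⟨p, ⟨⟨hp.1, hp.2.1, hp.2.2.1⟩, hx⟩, ?_, ?_⟩ <;> dsimp only at * <;> nlinarith
    · gcongr
      intro t ht
      simp only [mem_iUnion, exists_prop] at ht
      obtain ⟨p, ⟨hp, hx⟩, ht⟩ := ht
      simp only [mem_preimage, hΓ2, mem_iUnion, exists_prop]
      exact ⟨p, hp, hx, ht⟩
  have hfinal := hstep2.trans hstep3
  have e : 1 / m = θ1 / 3 := by rw [hm]; field_simp
  rw [e] at hfinal
  have h1 : ENNReal.ofReal (1 + θ1 / 3) * (ENNReal.ofReal (1 + θ1 / 3) * volume Γ) ≤ ENNReal.ofReal (1 + θ1 / 3) * volume Γ2 := by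
    refine le_trans ?_ hfinal
    rw [← mul_assoc, ← ENNReal.ofReal_mul (by positivity)]
    gcongr
    nlinarith
  exact (ENNReal.mul_le_mul_iff_right (by simp; positivity) ENNReal.ofReal_ne_top).1 h1

theorem Dn.hit {n : ℕ} {Γ : Set (E n × ℝ)} {η : ℝ} (hη : η < 1) {Y : E n × ℝ} {ρ : ℝ} (hρ : 0 < ρ)
    (h : Dn Γ η Y ρ) : ∃ Z ∈ Γ, Z ∈ CC Y ρ := by
  by_contra hc
  push Not at hc
  have : Γ ∩ CC Y ρ = ∅ := by
    ext Z; simp only [mem_inter_iff, mem_empty_iff_false, iff_false]; exact fun hZ => hc Z hZ.1 hZ.2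
  unfold Dn at h
  rw [this, measure_empty, nonpos_iff_eq_zero, mul_eq_zero] at h
  rcases h with h | h
  · rw [ENNReal.ofReal_eq_zero] at h; linarith
  · have hne := (vol_CC_pos Y hρ).ne'
    exact hne h

/-- Density of a superlevel set gives a lower bound on the top face. -/
theorem dense_top {n : ℕ} {ν : ℝ} (hν : 0 < ν) : ∃ η : ℝ, 0 < η ∧ η < 1 ∧
    ∀ (u : E n × ℝ → ℝ) (Γ : Set (E n × ℝ)) (y : E n) (s ρ l : ℝ), 0 < ρ → 0 < l → MeasurableSet Γ →
      Sup ν u (closedBall y ρ ×ˢ Icc (s - ρ ^ 2) s) →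
      (∀ X ∈ closedBall y ρ ×ˢ Icc (s - ρ ^ 2) s, 0 ≤ u X) → (∀ X ∈ Γ, l ≤ u X) → Dn Γ η (y, s) ρ →
      ∀ x ∈ closedBall y (ρ / 2), l / 2 ≤ u (x, s) := by
  obtain ⟨μ, hμ, hμ1, H⟩ := ML (n := n) hν
  have h2 : (1:ℝ) ≤ 2 ^ (n + 2) := one_le_pow₀ (by norm_num)
  have hmu : μ / 2 ^ (n + 2) ≤ 1 := by rw [div_le_one (by positivity)]; linarith
  refine ⟨μ / 2 ^ (n + 2) / 2, by positivity, by linarith, ?_⟩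
  set η := μ / 2 ^ (n + 2) / 2 with hη
  have hη0 : 0 < η := by positivity
  intro u Γ y s ρ l hρ hl hΓ hS hu hΓu hd x hx
  by_contra hlt
  push Not at hlt
  rw [mem_closedBall] at hx
  have hsub : closedBall x (ρ / 2) ×ˢ Icc (s - (ρ / 2) ^ 2) s ⊆ closedBall y ρ ×ˢ Icc (s - ρ ^ 2) s := by
    refine prod_mono (closedBall_subset_closedBall' (by linarith)) (Icc_subset_Icc ?_ le_rfl)
    nlinarith
  have h1 := H u x s (ρ / 2) l (by positivity) hl (hS.mono hsub) (fun X hX => hu X (hsub hX)) hlt.le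
  have h3 : volume {X : E n × ℝ | X ∈ CC (x, s) (ρ / 2) ∧ u X < l} ≤ volume (CC (y, s) ρ \ Γ) := by
    refine measure_mono ?_
    rintro X ⟨⟨hX1, hX2, hX3⟩, hX⟩
    refine ⟨⟨?_, ?_, hX3⟩, fun hXΓ => absurd (hΓu X hXΓ) (not_le.2 hX)⟩
    · exact ball_subset_ball' (by dsimp only; linarith) hX1
    · dsimp only at *; nlinarith
  have h4 : ENNReal.ofReal (2 * η) * volume (CC (y, s) ρ) ≤ volume (CC (y, s) ρ \ Γ) := by
    refine le_trans (le_of_eq ?_) (h1.trans h3)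
    rw [vol_CC _ hρ, vol_CC _ (by positivity : 0 < ρ / 2), ← mul_assoc, ← mul_assoc,
      ← ENNReal.ofReal_mul (by positivity), ← ENNReal.ofReal_mul (by positivity)]
    congr 2
    rw [hη, div_pow]; field_simp
  have h5 : volume (CC (y, s) ρ) = volume (Γ ∩ CC (y, s) ρ) + volume (CC (y, s) ρ \ Γ) := by
    rw [inter_comm, measure_inter_add_sdiff _ hΓ]
  have h6 : ENNReal.ofReal (1 + η) * volume (CC (y, s) ρ) ≤ volume (CC (y, s) ρ) := by
    conv_rhs => rw [h5]
    refine le_trans (le_of_eq ?_) (add_le_add hd h4)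
    rw [← add_mul, ← ENNReal.ofReal_add (by linarith) (by linarith)]
    congr 2; ring
  have hfin := (vol_CC_lt_top (y, s) hρ).ne
  have hpos := (vol_CC_pos (y, s) hρ).ne'
  have h7 : ENNReal.ofReal (1 + η) ≤ 1 := by
    by_contra hc
    push Not at hc
    have := ENNReal.mul_lt_mul_left hpos hfin hc
    rw [one_mul] at this
    exact absurd h6 (not_le.2 this)
  rw [ENNReal.ofReal_le_one] at h7
  linarith

set_option maxHeartbeats 1600000 in
theorem EE {n : ℕ} {ν : ℝ} (hν : 0 < ν) {μ1 : ℝ} (hμ1 : 0 < μ1) : ∃ c : ℝ, 0 < c ∧ c ≤ 1 ∧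
    ∀ u : E n × ℝ → ℝ, Sup ν u (closedBall 0 9 ×ˢ Icc (-3) 7) →
      (∀ X ∈ closedBall 0 9 ×ˢ Icc (-3) 7, 0 ≤ u X) →
      ENNReal.ofReal μ1 ≤ volume {X : E n × ℝ | X ∈ CC (0, 0) 1 ∧ 1 ≤ u X} →
      ∀ x ∈ closedBall (0 : E n) 1, c ≤ u (x, 4) := by
  obtain ⟨η, hη0, hη1, HD⟩ := dense_top (n := n) hν
  obtain ⟨θ, m, hθ, hm, HC⟩ := COV n hη0 hη1.le
  obtain ⟨κ, hκ0, hκ1, HB⟩ := BARs (n := n) hν (ε := 1 / 2) (tmin := 1) (T := 1 + 5 * m) (by norm_num) (by norm_num) one_pos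
  set W : ℝ := (volume (ball (0 : E n) 2 ×ˢ Ioo (-1 : ℝ) 1)).toReal with hW
  have hWt : volume (ball (0 : E n) 2 ×ˢ Ioo (-1 : ℝ) 1) ≠ ⊤ :=
    ((isBounded_ball.prod (isBounded_Ioo (a := (-1:ℝ)) (b := 1))).measure_lt_top).ne
  obtain ⟨N, hN⟩ := pow_unbounded_of_one_lt (W / μ1) (by linarith : 1 < 1 + θ)
  rw [div_lt_iff₀ hμ1] at hN
  set ρ0 : ℝ := min (1 / 4) (1 / ((N + 1) * (3 + 5 * m))) with hρ0
  have hden : 0 < ((N:ℝ) + 1) * (3 + 5 * m) := by positivity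
  have hρ0p : 0 < ρ0 := by positivity
  have hρ04 : ρ0 ≤ 1 / 4 := min_le_left _ _
  have hρN : (N + 1) * (3 + 5 * m) * ρ0 ≤ 1 := by
    have : ρ0 ≤ 1 / ((N + 1) * (3 + 5 * m)) := min_le_right _ _
    rw [le_div_iff₀ hden] at this; linarith
  obtain ⟨κ', hκ'0, hκ'1, HB'⟩ := BARs (n := n) hν (ε := ρ0 / 4) (tmin := 1 / 2) (T := 5 / 4) (by positivity) (by linarith) (by norm_num)
  set c1 := κ / 2 with hc1
  have hc10 : 0 < c1 := by positivity
  have hc11 : c1 ≤ 1 := by linarith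
  have hpw : c1 ^ N ≤ 1 := pow_le_one₀ hc10.le hc11
  refine ⟨κ' * (c1 ^ N / 2), by positivity, by nlinarith [pow_pos hc10 N], fun u hS hu hvol x hx => ?_⟩
  by_contra hlt
  push Not at hlt
  rw [mem_closedBall_zero_iff] at hx
  -- general step
  have hN0 : (0:ℝ) ≤ N := N.cast_nonneg
  have key : ∀ j : ℕ, j ≤ N → ∃ Γ : Set (E n × ℝ), MeasurableSet Γ ∧
      Γ ⊆ ball 0 (1 + 3 * j * ρ0) ×ˢ Ioo (-1) (j * (2 + 5 * m) * ρ0) ∧ (∀ X ∈ Γ, c1 ^ j ≤ u X) ∧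
      ENNReal.ofReal ((1 + θ) ^ j * μ1) ≤ volume Γ := by
    intro j
    induction j with
    | zero =>
      intro _
      refine ⟨{X : E n × ℝ | X ∈ CC (0, 0) 1 ∧ 1 ≤ u X}, ?_, ?_, ?_, ?_⟩
      · have h1 := meas_lt (B := ball (0 : E n) 1) (I := Ioo ((0:ℝ) - 1 ^ 2) 0) (u := u) (ν := ν) measurableSet_ball measurableSet_Ioo
          (hS.1.mono (prod_mono (ball_subset_closedBall.trans (closedBall_subset_closedBall (by norm_num)))
            (Ioo_subset_Icc_self.trans (Icc_subset_Icc (by norm_num) (by norm_num))))) 1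
        have h2 := (isOpen_CC ((0 : E n), (0:ℝ)) 1).measurableSet.diff h1
        convert h2 using 1
        ext X
        constructor
        · rintro ⟨h3, h4⟩
          exact ⟨h3, fun h5 => absurd h4 (not_le.2 h5.2)⟩
        · rintro ⟨h3, h4⟩
          exact ⟨h3, not_lt.1 fun h5 => h4 ⟨h3, h5⟩⟩
      · rintro X ⟨⟨h1, h2, h3⟩, -⟩
        simp only [Nat.cast_zero, mul_zero, zero_mul, add_zero]
        exact ⟨h1, by dsimp only at h2; linarith, h3⟩
      · rintro X ⟨-, h⟩; simpa using h
      · simpa using hvol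
    | succ j ih =>
      intro hj
      obtain ⟨Γ, hΓm, hΓs, hΓu, hΓv⟩ := ih (by omega)
      have hjN : (j:ℝ) + 1 ≤ N := by exact_mod_cast hj
      have hj0 : (0:ℝ) ≤ j := j.cast_nonneg
      have hb1 : 3 * j * ρ0 ≤ 1 := by
        have h3j : 3 * (j:ℝ) ≤ (N + 1) * (3 + 5 * m) := by
          have : 0 ≤ ((N:ℝ) + 1) * m := by positivity
          linarith
        have : (3 * j) * ρ0 ≤ (N + 1) * (3 + 5 * m) * ρ0 := mul_le_mul_of_nonneg_right h3j hρ0p.le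
        linarith
      have hb2 : ((j:ℝ) + 1) * (2 + 5 * m) * ρ0 ≤ 1 := by
        have : ((j:ℝ) + 1) * (2 + 5 * m) * ρ0 ≤ (N + 1) * (3 + 5 * m) * ρ0 := by gcongr <;> linarith
        linarith
      have hb3 : j * (2 + 5 * m) * ρ0 + (2 + 5 * m) * ρ0 ≤ 1 := by linarith
      have hmr : 0 < (2 + 5 * m) * ρ0 := by positivity
      have hl : 0 < c1 ^ j := by positivity
      have hpwj : c1 ^ N ≤ c1 ^ j := pow_le_pow_of_le_one hc10.le hc11 (by omega)
      -- location of dense cylinders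
      have hloc : ∀ (y : E n) (s ρ : ℝ), 0 < ρ → ρ < 2 * ρ0 → Dn Γ η (y, s) ρ →
          ∃ z : E n, ∃ τ : ℝ, ‖z‖ < 1 + 3 * j * ρ0 ∧ -1 < τ ∧ τ < j * (2 + 5 * m) * ρ0 ∧ dist z y < ρ ∧ τ < s ∧ s < τ + ρ ^ 2 := by
        intro y s ρ hρ hρ2 hd
        obtain ⟨⟨z, τ⟩, hZ, hZ1, hZ2, hZ3⟩ := hd.hit hη1 hρ
        obtain ⟨h1, h2, h3⟩ := hΓs hZ
        rw [mem_ball_zero_iff] at h1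
        exact ⟨z, τ, h1, h2, h3, hZ1, hZ3, by dsimp only at hZ2; linarith⟩
      have hno : ∀ Y ρ, ρ0 ≤ ρ → ρ < 2 * ρ0 → ¬ Dn Γ η Y ρ := by
        rintro ⟨y, s⟩ ρ h1 h2 hd
        have hρ : 0 < ρ := by linarith
        obtain ⟨z, τ, hz, hτ1, hτ2, hzy, hs1, hs2⟩ := hloc y s ρ hρ h2 hd
        have hy : ‖y‖ < 5 / 2 := by
          have : ‖y‖ ≤ ‖z‖ + dist z y := by
            rw [dist_comm, dist_eq_norm]; have := norm_add_le z (y - z); simpa using this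
          linarith
        have hρsq : ρ ^ 2 ≤ 1 / 4 := by nlinarith
        have hs3 : s < 5 / 4 := by linarith
        have hs4 : -1 < s := by linarith
        have hbox : closedBall y ρ ×ˢ Icc (s - ρ ^ 2) s ⊆ closedBall (0 : E n) 9 ×ˢ Icc (-3 : ℝ) 7 := by
          refine prod_mono (closedBall_subset_closedBall' ?_) (Icc_subset_Icc ?_ ?_)
          · rw [dist_zero_right]; linarith
          · linarith
          · linarith
        have h3 := HD u Γ y s ρ (c1 ^ j) hρ hl hΓm (hS.mono hbox) (fun X hX => hu X (hbox hX)) hΓu hd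
        have hbox2 : closedBall y (2 * 3) ×ˢ Icc s (s + 2 ^ 2 * (5 / 4)) ⊆ closedBall (0 : E n) 9 ×ˢ Icc (-3 : ℝ) 7 := by
          refine prod_mono (closedBall_subset_closedBall' ?_) (Icc_subset_Icc ?_ ?_)
          · rw [dist_zero_right]; linarith
          · linarith
          · linarith
        have h4 := HB' u y s 2 (c1 ^ j / 2) (by norm_num) (by positivity) (hS.mono hbox2) (fun X hX => hu X (hbox2 hX))
          (fun x' hx' => h3 x' (by
            rw [mem_ball] at hx'; rw [mem_closedBall]; linarith)) x (by
            rw [mem_closedBall, dist_eq_norm]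
            have := norm_sub_le x y
            linarith) 4 ⟨by linarith, by linarith⟩
        have : κ' * (c1 ^ N / 2) ≤ κ' * (c1 ^ j / 2) := by gcongr
        linarith
      have hcov := HC Γ hΓm ?_ ρ0 hρ0p hno
      · refine ⟨_, ?_, ?_, ?_, le_trans ?_ hcov⟩
        · exact (isOpen_biUnion fun p _ => isOpen_ball.prod isOpen_Ioo).measurableSet
        · rintro ⟨x', t'⟩ hX
          obtain ⟨⟨⟨y, s⟩, ρ⟩, ⟨hρ, hρ2, hd⟩, hx', ht1, ht2⟩ := mem_iUnion₂.1 hX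
          dsimp only at hρ hρ2 hd hx' ht1 ht2
          obtain ⟨z, τ, hz, hτ1, hτ2, hzy, hs1, hs2⟩ := hloc y s ρ hρ (by linarith) hd
          have hρsq : ρ ^ 2 ≤ ρ0 := by nlinarith
          rw [mem_ball] at hx'
          push_cast
          refine ⟨?_, ?_, ?_⟩
          · rw [mem_ball_zero_iff]
            have h1 : ‖x'‖ ≤ ‖z‖ + dist x' z := by
              rw [dist_eq_norm]; have := norm_add_le z (x' - z); simpa using this
            have h2 := dist_triangle x' y z
            rw [dist_comm y z] at h2
            dsimp only
            linarith
          · dsimp only; linarith [sq_nonneg ρ]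
          · dsimp only
            have : m * (5 * ρ ^ 2) ≤ m * (5 * ρ0) := by gcongr
            linarith
        · rintro ⟨x', t'⟩ hX
          obtain ⟨⟨⟨y, s⟩, ρ⟩, ⟨hρ, hρ2, hd⟩, hx', ht1, ht2⟩ := mem_iUnion₂.1 hX
          dsimp only at hρ hρ2 hd hx' ht1 ht2
          obtain ⟨z, τ, hz, hτ1, hτ2, hzy, hs1, hs2⟩ := hloc y s ρ hρ (by linarith) hd
          have hρsq : ρ ^ 2 ≤ ρ0 := by nlinarith
          have hmr2 : m * (5 * ρ ^ 2) ≤ m * (5 * ρ0) := by gcongr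
          have hy : ‖y‖ < 5 / 2 := by
            have : ‖y‖ ≤ ‖z‖ + dist z y := by
              rw [dist_comm, dist_eq_norm]; have := norm_add_le z (y - z); simpa using this
            linarith
          have hbox : closedBall y ρ ×ˢ Icc (s - ρ ^ 2) s ⊆ closedBall (0 : E n) 9 ×ˢ Icc (-3 : ℝ) 7 := by
            refine prod_mono (closedBall_subset_closedBall' ?_) (Icc_subset_Icc ?_ ?_)
            · rw [dist_zero_right]; linarith
            · linarith
            · linarith
          have h3 := HD u Γ y s ρ (c1 ^ j) hρ hl hΓm (hS.mono hbox) (fun X hX => hu X (hbox hX)) hΓu hd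
          have hbox2 : closedBall y (ρ * 3) ×ˢ Icc s (s + ρ ^ 2 * (1 + 5 * m)) ⊆ closedBall (0 : E n) 9 ×ˢ Icc (-3 : ℝ) 7 := by
            refine prod_mono (closedBall_subset_closedBall' ?_) (Icc_subset_Icc ?_ ?_)
            · rw [dist_zero_right]; linarith
            · linarith
            · linarith
          have h4 := HB u y s ρ (c1 ^ j / 2) hρ (by positivity) (hS.mono hbox2) (fun X hX => hu X (hbox2 hX))
            (fun x' hx' => h3 x' (by
              rw [mem_ball] at hx'; rw [mem_closedBall]; linarith)) x' (by
              rw [mem_ball] at hx'; rw [mem_closedBall]; linarith) t' ⟨by linarith, by linarith⟩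
          refine le_trans (le_of_eq ?_) h4
          rw [pow_succ, hc1]; ring
        · rw [pow_succ', mul_assoc, ENNReal.ofReal_mul (by positivity)]
          gcongr
      · refine ne_top_of_le_ne_top hWt (measure_mono (hΓs.trans (prod_mono (ball_subset_ball (by linarith)) (Ioo_subset_Ioo le_rfl (by linarith)))))
  obtain ⟨Γ, -, hΓs, -, hΓv⟩ := key N le_rfl
  have hb1 : 3 * N * ρ0 ≤ 1 := by
    have h3j : 3 * (N:ℝ) ≤ (N + 1) * (3 + 5 * m) := by
      have : 0 ≤ ((N:ℝ) + 1) * m := by positivity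
      linarith
    have : (3 * N) * ρ0 ≤ (N + 1) * (3 + 5 * m) * ρ0 := mul_le_mul_of_nonneg_right h3j hρ0p.le
    linarith
  have hb2 : N * (2 + 5 * m) * ρ0 ≤ 1 := by
    have : N * (2 + 5 * m) * ρ0 ≤ (N + 1) * (3 + 5 * m) * ρ0 := by gcongr <;> linarith
    linarith
  have h1 : volume Γ ≤ ENNReal.ofReal W := by
    rw [hW, ENNReal.ofReal_toReal hWt]
    exact measure_mono (hΓs.trans (prod_mono (ball_subset_ball (by linarith)) (Ioo_subset_Ioo le_rfl (by linarith))))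
  have h2 := hΓv.trans h1
  rw [ENNReal.ofReal_le_ofReal_iff ENNReal.toReal_nonneg] at h2
  linarith

theorem Sup.const_sub {n : ℕ} {ν : ℝ} {u : E n × ℝ → ℝ} {V : Set (E n × ℝ)}
    (h : Sup ν (fun X => - u X) V) (d : ℝ) : Sup ν (fun X => d - u X) V := by
  have h1 := h.scl 0 0 (r := 1) (c := 1) d one_pos zero_le_one
  have e : _root_.scl (fun X => - u X) 0 0 1 1 d = fun X => d - u X := by
    funext X
    simp only [_root_.scl, zero_add, one_smul, one_pow, one_mul]
    ring
  rw [e] at h1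
  refine h1.mono fun X hX => ?_
  change ((0 : E n) + (1:ℝ) • X.1, (0:ℝ) + 1 ^ 2 * X.2) ∈ V
  simpa using hX

theorem EEs {n : ℕ} {ν : ℝ} (hν : 0 < ν) {μ : ℝ} (hμ : 0 < μ) : ∃ c : ℝ, 0 < c ∧
    ∀ (u : E n × ℝ → ℝ) (y : E n) (s r l : ℝ), 0 < r → 0 < l →
      Sup ν u (closedBall y (r * 9) ×ˢ Icc (s + r ^ 2 * (-3)) (s + r ^ 2 * 7)) →
      (∀ X ∈ closedBall y (r * 9) ×ˢ Icc (s + r ^ 2 * (-3)) (s + r ^ 2 * 7), 0 ≤ u X) →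
      ENNReal.ofReal μ * volume (CC (y, s) r) ≤ volume {X : E n × ℝ | X ∈ CC (y, s) r ∧ l ≤ u X} →
      ∀ x ∈ closedBall y r, c * l ≤ u (x, s + 4 * r ^ 2) := by
  set ω := (volume (ball (0 : E n) 1)).toReal with hω
  have hωt : volume (ball (0 : E n) 1) ≠ ⊤ := measure_ball_lt_top.ne
  have hω0 : 0 < ω := ENNReal.toReal_pos (measure_ball_pos _ _ one_pos).ne' hωt
  obtain ⟨c, hc0, hc1, H⟩ := EE (n := n) hν (mul_pos hμ hω0)
  refine ⟨c, hc0, fun u y s r l hr hl hS hu hv x hx => ?_⟩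
  have hsub := mem_scl_box hr (Subset.refl (closedBall y (r * 9) ×ˢ Icc (s + r ^ 2 * (-3)) (s + r ^ 2 * 7)))
  have h1 := H (scl u y s r l⁻¹ 0) ((hS.scl y s 0 hr (by positivity)).mono hsub) ?_ ?_ (r⁻¹ • (x - y)) ?_
  · simp only [scl, add_zero] at h1
    rw [smul_inv_smul₀ hr.ne', add_sub_cancel, le_inv_mul_iff₀ hl, mul_comm (r ^ 2)] at h1
    linarith
  · intro X hX
    have := hu _ (hsub hX)
    simp only [scl, add_zero]; positivity
  · have h2 : {X : E n × ℝ | X ∈ CC (y, s) r ∧ l ≤ u X} =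
        aff y s r '' {X : E n × ℝ | X ∈ CC (0, 0) 1 ∧ 1 ≤ scl u y s r l⁻¹ 0 X} := by
      have e0 : (CC (0, 0) 1 : Set (E n × ℝ)) = ball (0 : E n) 1 ×ˢ Ioo (-1 : ℝ) 0 := by
        simp [CC]
      rw [CC_eq_aff y s hr, e0]
      ext X
      constructor
      · rintro ⟨⟨Z, hZ, rfl⟩, h⟩
        refine ⟨Z, ⟨hZ, ?_⟩, rfl⟩
        simp only [scl, add_zero]
        rw [le_inv_mul_iff₀ hl, mul_one]; exact h
      · rintro ⟨Z, ⟨hZ, h⟩, rfl⟩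
        refine ⟨⟨Z, hZ, rfl⟩, ?_⟩
        simp only [scl, add_zero] at h
        rw [le_inv_mul_iff₀ hl, mul_one] at h; exact h
    rw [h2, vol_aff y s hr, vol_CC _ hr, mul_left_comm] at hv
    rw [ENNReal.mul_le_mul_iff_right (by simp; positivity) ENNReal.ofReal_ne_top] at hv
    refine le_trans (le_of_eq ?_) hv
    rw [ENNReal.ofReal_mul hμ.le, hω, ENNReal.ofReal_toReal hωt]
  · rw [mem_closedBall, dist_eq_norm] at hx
    rw [mem_closedBall_zero_iff, norm_smul, norm_inv, Real.norm_of_nonneg hr.le, inv_mul_le_iff₀ hr]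
    linarith

theorem FStep {n : ℕ} {ν : ℝ} (hν : 0 < ν) : ∃ C κ : ℝ, 0 < C ∧ 0 < κ ∧ κ ≤ 1 ∧
    ∀ (u : E n × ℝ → ℝ), Sup ν u (closedBall 0 10 ×ˢ Icc (-4) 9) →
      Sup ν (fun X => - u X) (closedBall 0 10 ×ˢ Icc (-4) 9) →
      (∀ X ∈ closedBall 0 10 ×ˢ Icc (-4) 9, 0 ≤ u X) →
      ∀ (y : E n) (s M : ℝ) (k : ℕ), ‖y‖ ≤ 1 → -1 ≤ s → s ≤ 0 → 0 < M → M ≤ u (y, s) →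
      (∀ X ∈ closedBall y ((1 / 2) ^ k) ×ˢ Icc (s - ((1 / 2) ^ k) ^ 2) s, u X ≤ 3 / 2 * M) →
      ∀ x ∈ closedBall (0 : E n) 1, C * κ ^ k * M ≤ u (x, 9) := by
  obtain ⟨μ, hμ, hμ1, HM⟩ := ML (n := n) hν
  obtain ⟨c, hc0, HE⟩ := EEs (n := n) hν hμ
  obtain ⟨κ, hκ0, hκ1, HB⟩ := BARs (n := n) hν (ε := 1) (tmin := 1) (T := 1) (by norm_num) (by norm_num) one_pos
  obtain ⟨κ', hκ'0, hκ'1, HB'⟩ := BARs (n := n) hν (ε := 1 / 3) (tmin := 5 / 4) (T := 5 / 4) (by norm_num) (by norm_num) (by norm_num)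
  refine ⟨κ' * c / 2, κ, by positivity, hκ0, hκ1, fun u hS hS' hu y s M k hy hs1 hs2 hM hMu hle x hx => ?_⟩
  set r : ℝ := (1 / 2) ^ k with hr
  have hr0 : 0 < r := by positivity
  have hr1 : r ≤ 1 := pow_le_one₀ (by norm_num) (by norm_num)
  have hr2 : r ^ 2 ≤ 1 := by nlinarith
  have hr20 : 0 < r ^ 2 := by positivity
  have hbox : ∀ (R a b : ℝ), R ≤ 9 → -4 ≤ a → b ≤ 9 → closedBall y R ×ˢ Icc a b ⊆ closedBall (0 : E n) 10 ×ˢ Icc (-4 : ℝ) 9 := by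
    intro R a b h1 h2 h3
    refine prod_mono (closedBall_subset_closedBall' ?_) (Icc_subset_Icc h2 h3)
    rw [dist_zero_right]; linarith
  have hb1 := hbox r (s - r ^ 2) s (by linarith) (by linarith) (by linarith)
  have h1 := HM (fun X => 3 / 2 * M - u X) y s r M hr0 hM ((hS'.const_sub _).mono hb1) (fun X hX => by
    have := hle X hX; linarith) (by linarith)
  have hb2 := hbox (r * 9) (s + r ^ 2 * (-3)) (s + r ^ 2 * 7) (by linarith) (by linarith) (by linarith)
  have h2 := HE u y s r (M / 2) hr0 (by positivity) (hS.mono hb2) (fun X hX => hu X (hb2 hX)) (by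
    refine h1.trans (measure_mono ?_)
    rintro X ⟨hX1, hX2⟩
    exact ⟨hX1, by linarith⟩)
  have h3 : ∀ i : ℕ, i ≤ k → ∀ x ∈ closedBall y (2 ^ i * r), κ ^ i * (c * (M / 2)) ≤ u (x, s + 4 * r ^ 2 + ((2 ^ i * r) ^ 2 - r ^ 2) / 3) := by
    intro i
    induction i with
    | zero => intro _; simpa using h2
    | succ i ih =>
      intro hi x hx
      set ρ := 2 ^ i * r with hρ
      have hρ0 : 0 < ρ := by positivity
      have hρr : r ≤ ρ := le_mul_of_one_le_left hr0.le (one_le_pow₀ (by norm_num))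
      have hρ1 : 2 * ρ ≤ 1 := by
        have : 2 * ρ = 2 ^ (i + 1) * (1 / 2) ^ k := by rw [hρ, hr]; ring
        rw [this]
        calc (2:ℝ) ^ (i + 1) * (1 / 2) ^ k ≤ 2 ^ k * (1 / 2) ^ k := by
              gcongr; norm_num
          _ = 1 := by rw [← mul_pow]; norm_num
      have hρ2 : ρ ^ 2 ≤ 1 := by nlinarith
      have hρ3 : r ^ 2 ≤ ρ ^ 2 := by gcongr
      set t0 := s + 4 * r ^ 2 + (ρ ^ 2 - r ^ 2) / 3 with ht0
      have hb3 := hbox (ρ * 3) t0 (t0 + ρ ^ 2 * 1) (by linarith) (by linarith) (by linarith)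
      have e1 : 2 ^ (i + 1) * r = ρ * 2 := by rw [hρ]; ring
      have e2 : s + 4 * r ^ 2 + ((2 ^ (i + 1) * r) ^ 2 - r ^ 2) / 3 = t0 + ρ ^ 2 := by
        rw [e1, ht0]; ring
      have h4 := HB u y t0 ρ (κ ^ i * (c * (M / 2))) hρ0 (by positivity) (hS.mono hb3) (fun X hX => hu X (hb3 hX))
        (fun x hx => ih (by omega) x (by rw [mul_one] at hx; exact ball_subset_closedBall hx)) x (by rw [← e1]; exact hx)
        (t0 + ρ ^ 2) ⟨by linarith, by linarith⟩
      rw [e2, pow_succ']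
      linarith
  have h4 := h3 k le_rfl
  have e3 : 2 ^ k * r = 1 := by rw [hr, ← mul_pow]; norm_num
  rw [e3] at h4
  set t1 := s + 4 * r ^ 2 + (1 ^ 2 - r ^ 2) / 3 with ht1
  have ht1a : -1 ≤ t1 := by linarith
  have ht1b : t1 ≤ 4 := by linarith
  set q := Real.sqrt ((9 - t1) * (4 / 5)) with hq
  have hq2 : q ^ 2 = (9 - t1) * (4 / 5) := Real.sq_sqrt (by linarith)
  have hq0 : 0 ≤ q := Real.sqrt_nonneg _
  have hqa : 2 ≤ q := by nlinarith
  have hqb : q < 3 := by nlinarith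
  have hT : t1 + q ^ 2 * (5 / 4) = 9 := by rw [hq2]; ring
  have hb4 := hbox (q * 3) t1 (t1 + q ^ 2 * (5 / 4)) (by linarith) (by linarith) (by linarith)
  rw [mem_closedBall_zero_iff] at hx
  have h5 := HB' u y t1 q (κ ^ k * (c * (M / 2))) (by linarith) (by positivity) (hS.mono hb4) (fun X hX => hu X (hb4 hX))
    (fun x hx => h4 x (by rw [mem_ball] at hx; rw [mem_closedBall]; linarith)) x (by
      rw [mem_closedBall, dist_eq_norm]
      have := norm_sub_le x y
      linarith) 9 ⟨by linarith, by linarith⟩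
  linarith

theorem FF {n : ℕ} {ν : ℝ} (hν : 0 < ν) : ∃ N : ℝ, 0 < N ∧
    ∀ (u : E n × ℝ → ℝ), Sup ν u (closedBall 0 10 ×ˢ Icc (-4) 9) →
      Sup ν (fun X => - u X) (closedBall 0 10 ×ˢ Icc (-4) 9) →
      (∀ X ∈ closedBall 0 10 ×ˢ Icc (-4) 9, 0 ≤ u X) →
      (∃ B, ∀ X ∈ closedBall 0 10 ×ˢ Icc (-4) 9, u X ≤ B) →
      ∀ x ∈ closedBall (0 : E n) 1, u (0, 0) ≤ N * u (x, 9) := by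
  obtain ⟨C, κ, hC, hκ0, hκ1, H⟩ := FStep (n := n) hν
  obtain ⟨L', hL'⟩ := pow_unbounded_of_one_lt (κ⁻¹) (by norm_num : (1:ℝ) < 3 / 2)
  set L := L' + 1 with hL
  have hLp : 0 < L := by omega
  have hL1 : 1 ≤ (3 / 2 : ℝ) ^ L * κ := by
    rw [inv_lt_iff_one_lt_mul₀ hκ0] at hL'
    have : (3 / 2 : ℝ) ^ L' ≤ (3 / 2 : ℝ) ^ L := pow_le_pow_right₀ (by norm_num) (by omega)
    nlinarith
  obtain ⟨k0, hk0⟩ := pow_unbounded_of_one_lt (2 * (L:ℝ)) (by norm_num : (1:ℝ) < 2)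
  set q : ℝ := (1 / 2) ^ k0 with hq
  have hq0 : 0 < q := by positivity
  have hqL : q * (2 * L) ≤ 1 := by
    have : q * 2 ^ k0 = 1 := by rw [hq, ← mul_pow]; norm_num
    nlinarith
  set f : ℕ → ℝ := fun j => (1 / 2) ^ (j / L) * (2 * L - (j % L : ℕ)) with hf
  have hf0 : ∀ j, 0 < f j := by
    intro j
    have h1 : j % L < L := Nat.mod_lt _ hLp
    have h2 : ((j % L : ℕ) : ℝ) < L := by exact_mod_cast h1
    have h3 : (0:ℝ) < 2 * L - (j % L : ℕ) := by linarith [(Nat.cast_nonneg L : (0:ℝ) ≤ L)]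
    simp only [hf]; positivity
  have hfs : ∀ j, f j - f (j + 1) = (1 / 2) ^ (j / L) := by
    intro j
    have h1 : j % L < L := Nat.mod_lt _ hLp
    have h2 := Nat.div_add_mod j L
    by_cases hb : j % L + 1 < L
    · have e : j + 1 = L * (j / L) + (j % L + 1) := by omega
      have e1 : (j + 1) / L = j / L := by
        rw [e, Nat.mul_add_div hLp, Nat.div_eq_of_lt hb, add_zero]
      have e2 : (j + 1) % L = j % L + 1 := by
        rw [e, Nat.mul_add_mod, Nat.mod_eq_of_lt hb]
      simp only [hf, e1, e2]; push_cast; ring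
    · have hb' : j % L + 1 = L := by omega
      have e : j + 1 = L * (j / L + 1) + 0 := by rw [mul_add]; omega
      have e1 : (j + 1) / L = j / L + 1 := by
        rw [e, Nat.mul_add_div hLp]; simp
      have e2 : (j + 1) % L = 0 := by
        rw [e, Nat.mul_add_mod]; simp
      have e3 : ((j % L : ℕ) : ℝ) = L - 1 := by
        have : ((j % L + 1 : ℕ) : ℝ) = L := by exact_mod_cast hb'
        push_cast at this; push_cast; linarith
      simp only [hf, e1, e2, e3, pow_succ]; push_cast; ring
  have hf00 : f 0 = 2 * L := by simp [hf]
  refine ⟨(C * κ ^ k0)⁻¹, by positivity, fun u hS hS' hu hB x hx => ?_⟩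
  obtain ⟨B, hB⟩ := hB
  by_contra hlt
  push Not at hlt
  set M0 := u (0, 0) with hM0
  have hux : 0 ≤ u (x, 9) := hu _ ⟨closedBall_subset_closedBall (by norm_num) hx, by norm_num, by norm_num⟩
  rw [inv_mul_lt_iff₀ (by positivity)] at hlt
  have hM0p : 0 < M0 := by
    by_contra h
    push Not at h
    have : C * κ ^ k0 * M0 ≤ 0 := mul_nonpos_of_nonneg_of_nonpos (by positivity) h
    linarith
  have key : ∀ j : ℕ, ∃ (y : E n) (s : ℝ), ‖y‖ ≤ q * (2 * L - f j) ∧ -(q * (2 * L - f j)) ≤ s ∧ s ≤ 0 ∧ (3 / 2) ^ j * M0 ≤ u (y, s) := by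
    intro j
    induction j with
    | zero => exact ⟨0, 0, by rw [hf00]; simp, by rw [hf00]; simp, le_rfl, by simp [hM0]⟩
    | succ j ih =>
      obtain ⟨y, s, hy, hs1, hs2, huy⟩ := ih
      have hqf : q * (2 * L - f j) ≤ 1 := by nlinarith [hf0 j]
      by_contra hcon
      push Not at hcon
      set k := k0 + j / L with hk
      have hrk : (1 / 2 : ℝ) ^ k = q * (1 / 2) ^ (j / L) := by rw [hk, pow_add, hq]
      have hrk1 : (1 / 2 : ℝ) ^ k ≤ 1 := pow_le_one₀ (by norm_num) (by norm_num)
      have hrk0 : 0 < (1 / 2 : ℝ) ^ k := by positivity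
      have hfj := hfs j
      have hsum : q * (2 * L - f (j + 1)) = q * (2 * L - f j) + (1 / 2 : ℝ) ^ k := by
        rw [hrk, ← hfj]; ring
      have h1 := H u hS hS' hu y s ((3 / 2) ^ j * M0) k (by linarith) (by linarith) hs2 (by positivity) huy (by
        rintro ⟨z, τ⟩ ⟨hz, hτ1, hτ2⟩
        dsimp only at hz hτ1 hτ2
        rw [mem_closedBall, dist_eq_norm] at hz
        have h2 := hcon z τ (by
          have : ‖z‖ ≤ ‖y‖ + ‖z - y‖ := by have := norm_add_le y (z - y); simpa using this
          linarith) (by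
          have : ((1 / 2 : ℝ) ^ k) ^ 2 ≤ (1 / 2 : ℝ) ^ k := by nlinarith
          linarith) (by linarith)
        rw [pow_succ'] at h2
        linarith) x hx
      have h3 : κ ^ k0 ≤ κ ^ k * (3 / 2) ^ j := by
        have h4 : (1:ℝ) ≤ κ ^ (j / L) * (3 / 2) ^ j := by
          have h5 : (3 / 2 : ℝ) ^ (L * (j / L)) ≤ (3 / 2) ^ j := pow_le_pow_right₀ (by norm_num) (Nat.mul_div_le j L)
          rw [pow_mul] at h5
          calc (1:ℝ) ≤ ((3 / 2 : ℝ) ^ L * κ) ^ (j / L) := one_le_pow₀ hL1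
            _ = κ ^ (j / L) * ((3 / 2 : ℝ) ^ L) ^ (j / L) := by rw [mul_pow]; ring
            _ ≤ _ := by gcongr
        rw [hk, pow_add, mul_assoc]
        exact le_mul_of_one_le_right (by positivity) h4
      have h6 : C * κ ^ k0 * M0 ≤ C * κ ^ k * ((3 / 2) ^ j * M0) := by
        calc C * κ ^ k0 * M0 ≤ C * (κ ^ k * (3 / 2) ^ j) * M0 := by gcongr
          _ = _ := by ring
      linarith
  obtain ⟨j, hj⟩ := pow_unbounded_of_one_lt (B / M0) (by norm_num : (1:ℝ) < 3 / 2)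
  rw [div_lt_iff₀ hM0p] at hj
  obtain ⟨y, s, hy, hs1, hs2, huy⟩ := key j
  have hqf : q * (2 * L - f j) ≤ 1 := by nlinarith [hf0 j]
  have := hB (y, s) ⟨by rw [mem_closedBall_zero_iff]; linarith, by dsimp only; linarith, by dsimp only; linarith⟩
  linarith

theorem hasDerivAt_maxpow (k : ℕ) (x : ℝ) :
    HasDerivAt (fun y : ℝ => max y 0 ^ (k + 2)) ((k + 2 : ℕ) * max x 0 ^ (k + 1)) x := by
  rcases lt_trichotomy x 0 with h | h | h
  · have : (fun y : ℝ => max y 0 ^ (k + 2)) =ᶠ[nhds x] fun _ => 0 := by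
      filter_upwards [Iio_mem_nhds h] with y hy
      rw [max_eq_right (le_of_lt hy)]; simp
    rw [max_eq_right h.le]
    have e : ((k + 2 : ℕ) : ℝ) * 0 ^ (k + 1) = 0 := by simp
    rw [e]
    exact (hasDerivAt_const x (0:ℝ)).congr_of_eventuallyEq this
  · subst h
    have e : ((k + 2 : ℕ) : ℝ) * max (0:ℝ) 0 ^ (k + 1) = 0 := by simp
    rw [e, hasDerivAt_iff_tendsto_slope_zero]
    have h0 : Tendsto (fun t : ℝ => |t| ^ (k + 1)) (nhdsWithin 0 {0}ᶜ) (nhds 0) := by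
      have : Tendsto (fun t : ℝ => |t| ^ (k + 1)) (nhds 0) (nhds (|0| ^ (k+1))) :=
        Continuous.tendsto (by fun_prop) 0
      simp at this
      exact this.mono_left nhdsWithin_le_nhds
    refine squeeze_zero_norm' ?_ h0
    filter_upwards [self_mem_nhdsWithin] with t ht
    have ht : t ≠ 0 := ht
    have hm : |max t 0| ≤ |t| := by
      rcases le_total t 0 with h | h
      · rw [max_eq_right h]; simp
      · rw [max_eq_left h]
    simp only [zero_add, max_self, ne_eq, Nat.add_eq_zero_iff, OfNat.ofNat_ne_zero, and_false,
      not_false_eq_true, zero_pow, sub_zero, smul_eq_mul, norm_mul, norm_inv, Real.norm_eq_abs, abs_pow]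
    rw [inv_mul_le_iff₀ (abs_pos.2 ht)]
    calc |max t 0| ^ (k+2) ≤ |t| ^ (k+2) := by gcongr
      _ = |t| * |t| ^ (k+1) := by ring
  · have : (fun y : ℝ => max y 0 ^ (k + 2)) =ᶠ[nhds x] fun y => y ^ (k + 2) := by
      filter_upwards [Ioi_mem_nhds h] with y hy
      rw [max_eq_left (le_of_lt hy)]
    rw [max_eq_left h.le]
    exact (hasDerivAt_pow (k + 2) x).congr_of_eventuallyEq this

theorem contDiff_maxcube : ContDiff ℝ 2 (fun y : ℝ => max y 0 ^ 3) := by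
  have h1 : deriv (fun y : ℝ => max y 0 ^ 3) = fun y => 3 * max y 0 ^ 2 := by
    ext y; simpa using (hasDerivAt_maxpow 1 y).deriv
  have h2 : deriv (fun y : ℝ => 3 * max y 0 ^ 2) = fun y => 3 * (2 * max y 0) := by
    ext y; simpa using ((hasDerivAt_maxpow 0 y).const_mul 3).deriv
  rw [show (2 : WithTop ℕ∞) = 1 + 1 by norm_num, contDiff_succ_iff_deriv]
  refine ⟨fun y => (hasDerivAt_maxpow 1 y).differentiableAt, by simp, ?_⟩
  rw [h1, contDiff_one_iff_deriv, h2]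
  exact ⟨fun y => ((hasDerivAt_maxpow 0 y).const_mul 3).differentiableAt, by fun_prop⟩

theorem hs_maxcube {n : ℕ} {w : E n → ℝ} {x : E n} (h : ContDiffAt ℝ 2 w x) (i j : Fin n) :
    hs (fun y => max (w y) 0 ^ 3) x i j = 3 * max (w x) 0 ^ 2 * hs w x i j +
      6 * max (w x) 0 * fderiv ℝ w x (EuclideanSpace.single i 1) * fderiv ℝ w x (EuclideanSpace.single j 1) := by
  unfold hs
  have h1 : (fun y => fderiv ℝ (fun y => max (w y) 0 ^ 3) y (EuclideanSpace.single j (1:ℝ)))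
      =ᶠ[nhds x] fun y => (3 * max (w y) 0 ^ 2) * fderiv ℝ w y (EuclideanSpace.single j 1) := by
    filter_upwards [cd_ev h] with y hy
    have := ((hasDerivAt_maxpow 1 (w y)).comp_hasFDerivAt y (cd_d hy).hasFDerivAt)
    have e : fderiv ℝ (fun y => max (w y) 0 ^ 3) y = _ := this.fderiv
    rw [e]; simp
  rw [h1.fderiv_eq]
  have h2 : HasFDerivAt (fun y => 3 * max (w y) 0 ^ 2) ((3 * (2 * max (w x) 0)) • fderiv ℝ w x) x := by
    have := (((hasDerivAt_maxpow 0 (w x)).const_mul 3).comp_hasFDerivAt x (cd_d h).hasFDerivAt)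
    simp at this
    exact this
  have h3 : DifferentiableAt ℝ (fun y => fderiv ℝ w y (EuclideanSpace.single j (1:ℝ))) x :=
    (cd_diff h).clm_apply (differentiableAt_const _)
  rw [(h2.fun_mul h3.hasFDerivAt).fderiv]
  simp only [_root_.add_apply, _root_.smul_apply, smul_eq_mul]
  ring

/-- Double integration by parts for compactly supported functions. -/
theorem ibp2 {n : ℕ} {f g : E n → ℝ} (hf : ContDiff ℝ 2 f) (hg : ContDiff ℝ 2 g)
    (cf : HasCompactSupport f) (cg : HasCompactSupport g) (i j : Fin n) :
    ∫ x, f x * hs g x i j = ∫ x, g x * hs f x j i := by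
  have d1 : ∀ {f : E n → ℝ}, ContDiff ℝ 2 f → ∀ i, ContDiff ℝ 1 (fun y => fderiv ℝ f y (EuclideanSpace.single i (1:ℝ))) := by
    intro f hf i
    exact (hf.fderiv_right (m := 1) (by norm_num)).clm_apply contDiff_const
  have c1 : ∀ {f : E n → ℝ}, HasCompactSupport f → ∀ i, HasCompactSupport (fun y => fderiv ℝ f y (EuclideanSpace.single i (1:ℝ))) := by
    intro f cf i
    exact cf.fderiv_apply ℝ _
  have k0 : ∀ {f : E n → ℝ}, ContDiff ℝ 2 f → Continuous f := fun h => h.continuous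
  have k1 : ∀ {f : E n → ℝ}, ContDiff ℝ 2 f → ∀ i, Continuous (fun y => fderiv ℝ f y (EuclideanSpace.single i (1:ℝ))) :=
    fun h i => (d1 h i).continuous
  have k2 : ∀ {f : E n → ℝ}, ContDiff ℝ 2 f → ∀ i j, Continuous (fun y => hs f y i j) := by
    intro f h i j
    unfold hs
    exact ((d1 h j).continuous_fderiv (by norm_num)).clm_apply continuous_const
  have e1 := integral_mul_fderiv_eq_neg_fderiv_mul_of_integrable (μ := (volume : Measure (E n)))
    (f := f) (g := fun y => fderiv ℝ g y (EuclideanSpace.single j (1:ℝ)))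
    (v := EuclideanSpace.single i (1:ℝ))
    (((k1 hf i).mul (k1 hg j)).integrable_of_hasCompactSupport ((c1 cf i).mul_right))
    (((k0 hf).mul (k2 hg i j)).integrable_of_hasCompactSupport (cf.mul_right))
    (((k0 hf).mul (k1 hg j)).integrable_of_hasCompactSupport (cf.mul_right))
    (fun x _ => hf.differentiable (by norm_num) x) (fun x _ => (d1 hg j).differentiable (by norm_num) x)
  have e2 := integral_mul_fderiv_eq_neg_fderiv_mul_of_integrable (μ := (volume : Measure (E n)))
    (f := g) (g := fun y => fderiv ℝ f y (EuclideanSpace.single i (1:ℝ)))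
    (v := EuclideanSpace.single j (1:ℝ))
    (((k1 hg j).mul (k1 hf i)).integrable_of_hasCompactSupport ((c1 cg j).mul_right))
    (((k0 hg).mul (k2 hf j i)).integrable_of_hasCompactSupport (cg.mul_right))
    (((k0 hg).mul (k1 hf i)).integrable_of_hasCompactSupport (cg.mul_right))
    (fun x _ => hg.differentiable (by norm_num) x) (fun x _ => (d1 hf i).differentiable (by norm_num) x)
  have e3 : ∀ x, fderiv ℝ f x (EuclideanSpace.single i (1:ℝ)) * fderiv ℝ g x (EuclideanSpace.single j (1:ℝ))
    = fderiv ℝ g x (EuclideanSpace.single j (1:ℝ)) * fderiv ℝ f x (EuclideanSpace.single i (1:ℝ)) := fun x => mul_comm _ _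
  unfold hs
  rw [e1, e2]
  congr 1
  exact integral_congr_ae (Eventually.of_forall e3)

/-- Spatial energy inequality. -/
theorem EN {n : ℕ} {ν : ℝ} (hν : 0 < ν) {a : E n → Fin n → Fin n → ℝ} {w : E n → ℝ} {x0 : E n}
    {R r' C : ℝ} (hr : 0 < r') (hrR : r' < R)
    (ha : ∀ x ∈ ball x0 R, ∀ i j, ContDiffAt ℝ 2 (fun y => a y i j) x)
    (hE : ∀ x ∈ ball x0 R, Ell ν (a x))
    (hw : ∀ x ∈ ball x0 R, ContDiffAt ℝ 2 w x)
    (hsu : ∀ x ∈ ball x0 R, 0 < w x → x ∈ closedBall x0 r')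
    (hC : ∀ x ∈ ball x0 R, |∑ i, ∑ j, hs (fun y => a y i j) x j i| ≤ C) :
    ∃ Φ : E n → ℝ, Continuous Φ ∧ HasCompactSupport Φ ∧
      (∀ x ∈ ball x0 R, 3 * max (w x) 0 ^ 2 * Lx (a x) w x ≤ Φ x) ∧
      ∫ x in ball x0 R, Φ x ≤ C * ∫ x in ball x0 R, max (w x) 0 ^ 3 := by
  classical
  set g : E n → ℝ := (ball x0 R).indicator (fun x => max (w x) 0 ^ 3) with hg
  have g_in : ∀ x ∈ ball x0 R, g =ᶠ[nhds x] fun x => max (w x) 0 ^ 3 := by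
    intro x hx
    filter_upwards [isOpen_ball.mem_nhds hx] with y hy
    exact indicator_of_mem hy _
  have g_zero : ∀ x, x ∉ closedBall x0 r' → g x = 0 := by
    intro x hx
    by_cases h : x ∈ ball x0 R
    · rw [hg, indicator_of_mem h]
      have : w x ≤ 0 := by
        by_contra h'
        exact hx (hsu x h (not_le.1 h'))
      simp [max_eq_right this]
    · rw [hg, indicator_of_notMem h]
  have g_out : ∀ x, x ∉ closedBall x0 r' → g =ᶠ[nhds x] fun _ => 0 := by
    intro x hx
    filter_upwards [isClosed_closedBall.isOpen_compl.mem_nhds hx] with y hy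
    exact g_zero y hy
  have sub : closedBall x0 r' ⊆ ball x0 R := closedBall_subset_ball hrR
  have g_c2 : ContDiff ℝ 2 g := by
    rw [contDiff_iff_contDiffAt]
    intro x
    by_cases hx : x ∈ closedBall x0 r'
    · have h1 : ContDiffAt ℝ 2 (fun x => max (w x) 0 ^ 3) x :=
        (contDiff_maxcube.contDiffAt (x := w x)).comp x (hw x (sub hx))
      exact h1.congr_of_eventuallyEq (g_in x (sub hx))
    · exact contDiffAt_const.congr_of_eventuallyEq (g_out x hx)
  have g_cs : HasCompactSupport g :=
    HasCompactSupport.intro (isCompact_closedBall x0 r') g_zero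
  let χ : ContDiffBump x0 := ⟨(2 * r' + R) / 3, (r' + 2 * R) / 3, by linarith, by linarith⟩
  have χin : ∀ x ∈ closedBall x0 r', χ =ᶠ[nhds x] fun _ => 1 := by
    intro x hx
    have : x ∈ ball x0 ((2 * r' + R) / 3) := by
      rw [mem_closedBall] at hx; rw [mem_ball]; linarith
    filter_upwards [isOpen_ball.mem_nhds this] with y hy
    exact χ.one_of_mem_closedBall (ball_subset_closedBall hy)
  set A : Fin n → Fin n → E n → ℝ := fun i j x => χ x * a x i j with hA
  have A_zero : ∀ i j x, x ∉ closedBall x0 ((r' + 2 * R) / 3) → A i j x = 0 := by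
    intro i j x hx
    have : χ x = 0 := χ.zero_of_le_dist (by
      rw [mem_closedBall, not_le] at hx; exact hx.le)
    simp [hA, this]
  have A_c2 : ∀ i j, ContDiff ℝ 2 (A i j) := by
    intro i j
    rw [contDiff_iff_contDiffAt]
    intro x
    by_cases hx : x ∈ closedBall x0 ((r' + 2 * R) / 3)
    · exact χ.contDiff.contDiffAt.mul (ha x (closedBall_subset_ball (by linarith) hx) i j)
    · have : A i j =ᶠ[nhds x] fun _ => 0 := by
        filter_upwards [isClosed_closedBall.isOpen_compl.mem_nhds hx] with y hy
        exact A_zero i j y hy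
      exact contDiffAt_const.congr_of_eventuallyEq this
  have A_cs : ∀ i j, HasCompactSupport (A i j) := fun i j =>
    HasCompactSupport.intro (isCompact_closedBall x0 _) (A_zero i j)
  have k2 : ∀ {f : E n → ℝ}, ContDiff ℝ 2 f → ∀ i j, Continuous (fun y => hs f y i j) := by
    intro f h i j
    unfold hs
    exact (((h.fderiv_right (m := 1) (by norm_num)).clm_apply contDiff_const).continuous_fderiv
      (by norm_num)).clm_apply continuous_const
  have hs_out : ∀ x, x ∉ closedBall x0 r' → ∀ i j, hs g x i j = 0 := by
    intro x hx i j
    rw [hs_congr (g_out x hx)]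
    simp [hs]
  refine ⟨fun x => ∑ i, ∑ j, A i j x * hs g x i j, ?_, ?_, ?_, ?_⟩
  · refine continuous_finset_sum _ fun i _ => continuous_finset_sum _ fun j _ => ?_
    exact (A_c2 i j).continuous.mul (k2 g_c2 i j)
  · refine HasCompactSupport.intro (isCompact_closedBall x0 r') fun x hx => ?_
    simp [hs_out x hx]
  · intro x hx
    by_cases hx' : x ∈ closedBall x0 r'
    · have hχ : χ x = 1 := (χin x hx').eq_of_nhds
      have hq := (hE x hx).1 (fun i => fderiv ℝ w x (EuclideanSpace.single i 1))
      have hq0 : 0 ≤ ∑ i, ∑ j, a x i j * fderiv ℝ w x (EuclideanSpace.single i 1) * fderiv ℝ w x (EuclideanSpace.single j 1) :=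
        le_trans (mul_nonneg hν.le (Finset.sum_nonneg fun i _ => sq_nonneg _)) hq
      have : ∑ i, ∑ j, A i j x * hs g x i j = 3 * max (w x) 0 ^ 2 * Lx (a x) w x + 6 * max (w x) 0 *
          ∑ i, ∑ j, a x i j * fderiv ℝ w x (EuclideanSpace.single i 1) * fderiv ℝ w x (EuclideanSpace.single j 1) := by
        unfold Lx
        rw [Finset.mul_sum, Finset.mul_sum, ← Finset.sum_add_distrib]
        refine Finset.sum_congr rfl fun i _ => ?_
        rw [Finset.mul_sum, Finset.mul_sum, ← Finset.sum_add_distrib]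
        refine Finset.sum_congr rfl fun j _ => ?_
        rw [hs_congr (g_in x hx), hs_maxcube (hw x hx)]
        simp only [hA, hχ]; ring
      dsimp only
      rw [this]
      have : 0 ≤ 6 * max (w x) 0 := by positivity
      nlinarith [mul_nonneg this hq0]
    · have : w x ≤ 0 := by
        by_contra h'
        exact hx' (hsu x hx (not_le.1 h'))
      simp [hs_out x hx', max_eq_right this]
  · have i1 : ∀ i j, Integrable (fun x => A i j x * hs g x i j) := fun i j =>
      ((A_c2 i j).continuous.mul (k2 g_c2 i j)).integrable_of_hasCompactSupport (A_cs i j).mul_right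
    have i2 : ∀ i j, Integrable (fun x => g x * hs (A i j) x j i) := fun i j =>
      (g_c2.continuous.mul (k2 (A_c2 i j) j i)).integrable_of_hasCompactSupport g_cs.mul_right
    have e0 : ∫ x in ball x0 R, ∑ i, ∑ j, A i j x * hs g x i j = ∫ x, ∑ i, ∑ j, A i j x * hs g x i j := by
      refine setIntegral_eq_integral_of_forall_compl_eq_zero fun x hx => ?_
      simp [hs_out x (fun h => hx (sub h))]
    have e1 : ∫ x, ∑ i, ∑ j, A i j x * hs g x i j = ∫ x, ∑ i, ∑ j, g x * hs (A i j) x j i := by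
      rw [integral_finset_sum _ fun i _ => integrable_finset_sum _ fun j _ => i1 i j,
        integral_finset_sum _ fun i _ => integrable_finset_sum _ fun j _ => i2 i j]
      refine Finset.sum_congr rfl fun i _ => ?_
      rw [integral_finset_sum _ fun j _ => i1 i j, integral_finset_sum _ fun j _ => i2 i j]
      exact Finset.sum_congr rfl fun j _ => ibp2 (A_c2 i j) g_c2 (A_cs i j) g_cs i j
    have e2 : ∫ x in ball x0 R, max (w x) 0 ^ 3 = ∫ x, g x := by
      rw [hg, integral_indicator measurableSet_ball]
    rw [e0, e1, e2, ← integral_const_mul]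
    refine integral_mono (integrable_finset_sum _ fun i _ => integrable_finset_sum _ fun j _ => i2 i j)
      ((g_c2.continuous.integrable_of_hasCompactSupport g_cs).const_mul C) fun x => ?_
    dsimp only
    by_cases hx : x ∈ closedBall x0 r'
    · have : ∀ i j, hs (A i j) x j i = hs (fun y => a y i j) x j i := by
        intro i j
        refine hs_congr ?_ j i
        filter_upwards [χin x hx] with y hy
        simp [hA, hy]
      simp only [this]
      simp only [← Finset.mul_sum]
      have hg0 : 0 ≤ g x := by
        rw [hg, indicator_of_mem (sub hx)]; positivity
      rw [mul_comm C]
      exact mul_le_mul_of_nonneg_left ((le_abs_self _).trans (hC x (sub hx))) hg0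
    · simp [g_zero x hx]

/-- Data for the regularity argument in a closed cylinder. -/
structure AB {n : ℕ} (ν C : ℝ) (x0 : E n) (R τ β : ℝ) (a : E n × ℝ → Fin n → Fin n → ℝ)
    (u : E n × ℝ → ℝ) : Prop where
  hν : 0 < ν
  hR : 0 < R
  cd : ∀ x ∈ closedBall x0 R, ∀ t ∈ Icc τ β, ContDiffAt ℝ 2 (fun y => u (y, t)) x
  dt : ∀ x ∈ closedBall x0 R, ∀ t ∈ Icc τ β, DifferentiableAt ℝ (fun s => u (x, s)) t
  ell : ∀ x ∈ closedBall x0 R, ∀ t ∈ Icc τ β, Ell ν (a (x, t))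
  eq : ∀ x ∈ closedBall x0 R, ∀ t ∈ Icc τ β, Lx (a (x, t)) (fun y => u (y, t)) x = Dt u (x, t)
  acd : ∀ x ∈ closedBall x0 R, ∀ t ∈ Icc τ β, ∀ i j, ContDiffAt ℝ 2 (fun y => a (y, t) i j) x
  hC : ∀ x ∈ closedBall x0 R, ∀ t ∈ Icc τ β,
    |∑ i, ∑ j, hs (fun y => a (y, t) i j) x j i| ≤ C
  pos : ∀ x ∈ closedBall x0 R, ∀ t ∈ Icc τ β, 0 ≤ u (x, t)

/-- time slope of the comparison paraboloids -/
def Lam (n : ℕ) (ν : ℝ) : ℝ := 2 * (n * ν⁻¹) + 1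

theorem Lam_pos {n : ℕ} {ν : ℝ} (hν : 0 < ν) : 0 < Lam n ν := by unfold Lam; positivity

/-- comparison paraboloid -/
def ph {n : ℕ} (L K : ℝ) (y : E n) (θ : ℝ) (x : E n) (t : ℝ) : ℝ := K * (θ - ‖x - y‖ ^ 2 - L * t)

/-- energy -/
def HH {n : ℕ} (u : E n × ℝ → ℝ) (x0 : E n) (R L K : ℝ) (y : E n) (θ t : ℝ) : ℝ :=
  ∫ x in ball x0 R, max (ph L K y θ x t - u (x, t)) 0 ^ 3

/-- admissible paraboloids -/
def VP {n : ℕ} (x0 : E n) (R L K : ℝ) (y : E n) (θ t : ℝ) : Prop :=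
  0 < K ∧ ∀ x, ‖x - y‖ ^ 2 + L * t ≤ θ → x ∈ ball x0 R

/-- upper Dini inequality for the energy -/
def DD {n : ℕ} (u : E n × ℝ → ℝ) (x0 : E n) (R L C t : ℝ) : Prop :=
  ∀ K y θ, VP x0 R L K y θ t → ∀ r, C * HH u x0 R L K y θ t < r →
    ∀ᶠ s in nhdsWithin t (Ioi t), (s - t)⁻¹ * (HH u x0 R L K y θ s - HH u x0 R L K y θ t) < r

theorem ph_le {n : ℕ} {L K : ℝ} (hL : 0 ≤ L) (hK : 0 ≤ K) (y : E n) (θ : ℝ) (x : E n) (t : ℝ) :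
    ph L K y θ x t ≤ K * (θ - L * t) := by
  unfold ph
  have := sq_nonneg ‖x - y‖
  nlinarith [mul_nonneg hK this]

theorem ph_cont {n : ℕ} (L K : ℝ) (y : E n) (θ t : ℝ) : Continuous fun x => ph L K y θ x t := by
  unfold ph; fun_prop

theorem ph_contt {n : ℕ} (L K : ℝ) (y : E n) (θ : ℝ) (x : E n) : Continuous fun t => ph L K y θ x t := by
  unfold ph; fun_prop

section
variable {n : ℕ} {ν C : ℝ} {x0 : E n} {R τ β : ℝ} {a : E n × ℝ → Fin n → Fin n → ℝ}
  {u : E n × ℝ → ℝ}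

theorem AB.uc (h : AB ν C x0 R τ β a u) {t : ℝ} (ht : t ∈ Icc τ β) :
    ContinuousOn (fun x => u (x, t)) (closedBall x0 R) :=
  fun x hx => (h.cd x hx t ht).continuousAt.continuousWithinAt

theorem AB.HH_int (h : AB ν C x0 R τ β a u) (L K : ℝ) (y : E n) (θ : ℝ) {t : ℝ} (ht : t ∈ Icc τ β) :
    IntegrableOn (fun x => max (ph L K y θ x t - u (x, t)) 0 ^ 3) (ball x0 R) := by
  have : IntegrableOn (fun x => max (ph L K y θ x t - u (x, t)) 0 ^ 3) (closedBall x0 R) := by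
    refine ContinuousOn.integrableOn_compact (isCompact_closedBall _ _) ?_
    exact (((ph_cont L K y θ t).continuousOn.sub (h.uc ht)).sup continuousOn_const).pow 3
  exact this.mono_set ball_subset_closedBall

theorem AB.HH_cont (h : AB ν C x0 R τ β a u) {L K : ℝ} (hL : 0 ≤ L) (hK : 0 ≤ K) (y : E n) (θ : ℝ) :
    ContinuousOn (HH u x0 R L K y θ) (Icc τ β) := by
  refine continuousOn_of_dominated (bound := fun _ => (K * |θ - L * τ|) ^ 3) ?_ ?_ ?_ ?_
  · intro t ht
    exact (h.HH_int L K y θ ht).aestronglyMeasurable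
  · intro t ht
    refine (ae_restrict_iff' measurableSet_ball).2 (Eventually.of_forall fun x hx => ?_)
    have hx := ball_subset_closedBall hx
    rw [Real.norm_of_nonneg (by positivity)]
    gcongr
    refine max_le ?_ (by positivity)
    have := h.pos x hx t ht
    have h2 := ph_le hL hK y θ x t
    have h3 : K * (θ - L * t) ≤ K * (θ - L * τ) := by
      have := ht.1
      gcongr
    have h4 : K * (θ - L * τ) ≤ K * |θ - L * τ| := by gcongr; exact le_abs_self _
    linarith
  · exact integrableOn_const (by exact measure_ball_lt_top.ne)
  · refine (ae_restrict_iff' measurableSet_ball).2 (Eventually.of_forall fun x hx => ?_)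
    have hx := ball_subset_closedBall hx
    intro t ht
    exact ((((ph_contt L K y θ x).continuousAt.sub (h.dt x hx t ht).continuousAt).sup continuousAt_const).pow 3).continuousWithinAt

theorem Lx_ph (L K : ℝ) (y : E n) (θ : ℝ) (x : E n) (t : ℝ) (b : Fin n → Fin n → ℝ) :
    Lx b (fun x => ph L K y θ x t) x = - (2 * K * ∑ i, b i i) := by
  have e : (fun x => ph L K y θ x t) = fun x => (-K) * ‖x - y‖ ^ 2 + K * (θ - L * t) := by
    ext x; unfold ph; ring
  have c : ContDiffAt ℝ 2 (fun x => ‖x - y‖ ^ 2) x := (contDiffAt_id.sub contDiffAt_const).norm_sq ℝ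
  rw [e, Lx_add b (contDiffAt_const.mul c) contDiffAt_const, Lx_smul b _ c, Lx_const, Lx_normsq]
  ring

theorem ph_cd (L K : ℝ) (y : E n) (θ : ℝ) (x : E n) (t : ℝ) : ContDiffAt ℝ 2 (fun x => ph L K y θ x t) x := by
  have c : ContDiffAt ℝ 2 (fun x => ‖x - y‖ ^ 2) x := (contDiffAt_id.sub contDiffAt_const).norm_sq ℝ
  unfold ph
  exact contDiffAt_const.mul ((contDiffAt_const.sub c).sub contDiffAt_const)

theorem cube_alg {A B δ B0 : ℝ} (hA : 0 ≤ A) (hB : 0 ≤ B) (h : B ≤ A + δ) (hδ : 0 ≤ δ) (hA0 : A ≤ B0) :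
    B ^ 3 - A ^ 3 ≤ δ * (3 * (B0 + δ) ^ 2) := by
  have h1 : B ^ 3 ≤ (A + δ) ^ 3 := by gcongr
  have h2 : (A + δ) ^ 3 - A ^ 3 ≤ δ * (3 * (A + δ) ^ 2) := by
    nlinarith [mul_nonneg hA hδ, mul_nonneg (mul_nonneg hA hδ) hδ, pow_nonneg hδ 3]
  have h3 : δ * (3 * (A + δ) ^ 2) ≤ δ * (3 * (B0 + δ) ^ 2) := by gcongr
  linarith

theorem AB.dini (h : AB ν C x0 R τ β a u) {t : ℝ} (ht : t ∈ Ico τ β)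
    (hb : ∀ r, r < R → ∃ K1 η : ℝ, 0 < η ∧ ∀ x ∈ closedBall x0 r, ∀ s ∈ Icc τ β, t < s → s < t + η →
      u (x, t) - K1 * (s - t) ≤ u (x, s)) :
    DD u x0 R (Lam n ν) C t := by
  intro K y θ hV r hr
  have hL := Lam_pos (n := n) h.hν
  set L := Lam n ν with hLdef
  obtain ⟨hK, hV⟩ := hV
  have htI : t ∈ Icc τ β := ⟨ht.1, ht.2.le⟩
  obtain ⟨r', ⟨hr', hr'R⟩, hS⟩ := exists_pos_lt_subset_ball (x := x0) (r := R) (s := {x | ‖x - y‖ ^ 2 + L * t ≤ θ}) h.hR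
    (isClosed_le (by fun_prop) (by fun_prop)) hV
  have hph : ∀ x, x ∉ closedBall x0 r' → ph L K y θ x t ≤ 0 := by
    intro x hx
    have : ¬ (‖x - y‖ ^ 2 + L * t ≤ θ) := fun h' => hx (ball_subset_closedBall (hS h'))
    unfold ph
    nlinarith
  have hanti : ∀ x s, t ≤ s → ph L K y θ x s ≤ ph L K y θ x t := by
    intro x s hs
    unfold ph; gcongr
  obtain ⟨Φ, Φc, Φs, hΦ1, hΦ2⟩ := EN (a := fun x => a (x, t)) (w := fun x => ph L K y θ x t - u (x, t)) (C := C)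
    h.hν hr' hr'R (fun x hx i j => h.acd x (ball_subset_closedBall hx) t htI i j)
    (fun x hx => h.ell x (ball_subset_closedBall hx) t htI)
    (fun x hx => (ph_cd L K y θ x t).sub (h.cd x (ball_subset_closedBall hx) t htI))
    (fun x hx hw => by
      by_contra hx'
      have := hph x hx'
      have := h.pos x (ball_subset_closedBall hx) t htI
      linarith)
    (fun x hx => h.hC x (ball_subset_closedBall hx) t htI)
  obtain ⟨K1, η, hη, hK1⟩ := hb r' hr'R
  set K2 := max K1 0 with hK2
  set B0 := K * |θ - L * t| with hB0
  set Lc := K2 * (3 * (B0 + K2 * η) ^ 2) with hLc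
  have hK2n : 0 ≤ K2 := le_max_right _ _
  have hB0n : 0 ≤ B0 := by positivity
  have hLcn : 0 ≤ Lc := by positivity
  set q : ℝ → E n → ℝ := fun s x => (s - t)⁻¹ * (max (ph L K y θ x s - u (x, s)) 0 ^ 3 - max (ph L K y θ x t - u (x, t)) 0 ^ 3) with hq
  have hev : ∀ᶠ s in nhdsWithin t (Ioi t), s ∈ Icc τ β ∧ t < s ∧ s < t + η := by
    have h1 : Ioo t (min β (t + η)) ∈ nhdsWithin t (Ioi t) :=
      Ioo_mem_nhdsGT (lt_min ht.2 (by linarith))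
    filter_upwards [h1] with s hs
    have := hs.2
    rw [lt_min_iff] at this
    exact ⟨⟨ht.1.trans hs.1.le, this.1.le⟩, hs.1, this.2⟩
  have hqi : ∀ s ∈ Icc τ β, Integrable (q s) (volume.restrict (ball x0 R)) := by
    intro s hs
    exact ((h.HH_int L K y θ hs).sub (h.HH_int L K y θ htI)).const_mul _
  have hΦi : Integrable Φ (volume.restrict (ball x0 R)) := (Φc.integrable_of_hasCompactSupport Φs).restrict
  have hqb : ∀ s ∈ Icc τ β, t < s → s < t + η → ∀ x ∈ ball x0 R, q s x ≤ Lc := by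
    intro s hs hts hsη x hx
    have hxc := ball_subset_closedBall hx
    have hst : 0 < s - t := by linarith
    have us := h.pos x hxc s hs
    have ut := h.pos x hxc t htI
    simp only [hq]
    rw [inv_mul_le_iff₀ hst]
    by_cases hx' : x ∈ closedBall x0 r'
    · have h1 := hK1 x hx' s hs hts hsη
      have h2 : K1 * (s - t) ≤ K2 * (s - t) := by gcongr; exact le_max_left _ _
      have h3 := hanti x s hts.le
      have h4 := cube_alg (A := max (ph L K y θ x t - u (x, t)) 0) (B := max (ph L K y θ x s - u (x, s)) 0)
        (δ := K2 * (s - t)) (B0 := B0) (le_max_right _ _) (le_max_right _ _) ?_ (by positivity) ?_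
      · refine h4.trans ?_
        have : K2 * (s - t) * (3 * (B0 + K2 * (s - t)) ^ 2) ≤ K2 * (s - t) * (3 * (B0 + K2 * η) ^ 2) := by
          have : s - t ≤ η := by linarith
          gcongr
        rw [hLc]; linarith
      · refine max_le ?_ ?_
        · have := le_max_left (ph L K y θ x t - u (x, t)) 0
          linarith
        · have := le_max_right (ph L K y θ x t - u (x, t)) 0
          have : 0 ≤ K2 * (s - t) := by positivity
          linarith
      · refine max_le ?_ hB0n
        have e1 := ph_le hL.le hK.le y θ x t
        have e2 : K * (θ - L * t) ≤ B0 := by rw [hB0]; gcongr; exact le_abs_self _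
        linarith
    · have h1 := hph x hx'
      have h2 := hanti x s hts.le
      rw [max_eq_right (by linarith), max_eq_right (by linarith)]
      simp only [sub_self]; positivity
  have hlim : Tendsto (fun s => ∫ x in ball x0 R, max (q s x) (Φ x)) (nhdsWithin t (Ioi t)) (nhds (∫ x in ball x0 R, Φ x)) := by
    refine tendsto_integral_filter_of_dominated_convergence (fun x => Lc + |Φ x|) ?_ ?_ ?_ ?_
    · filter_upwards [hev] with s hs
      exact ((hqi s hs.1).sup hΦi).aestronglyMeasurable
    · filter_upwards [hev] with s hs
      refine (ae_restrict_iff' measurableSet_ball).2 (Eventually.of_forall fun x hx => ?_)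
      have := hqb s hs.1 hs.2.1 hs.2.2 x hx
      rw [Real.norm_eq_abs, abs_le]
      constructor
      · have := le_max_right (q s x) (Φ x)
        have := neg_abs_le (Φ x)
        linarith
      · refine max_le ?_ ?_
        · have := abs_nonneg (Φ x); linarith
        · have := le_abs_self (Φ x); linarith
    · exact (integrableOn_const (by exact measure_ball_lt_top.ne)).add hΦi.abs
    · refine (ae_restrict_iff' measurableSet_ball).2 (Eventually.of_forall fun x hx => ?_)
      have hxc := ball_subset_closedBall hx
      have hd1 : HasDerivAt (fun s => ph L K y θ x s - u (x, s)) (K * (-L) - Dt u (x, t)) t := by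
        have e1 : HasDerivAt (fun s => ph L K y θ x s) (K * (-L)) t := by
          unfold ph
          have := (((hasDerivAt_id t).const_mul L).const_sub (θ - ‖x - y‖ ^ 2)).const_mul K
          simpa using this
        exact e1.sub (h.dt x hxc t htI).hasDerivAt
      have hd2 := (hasDerivAt_maxpow 1 _).comp t hd1
      have hd3 := hd2.tendsto_slope
      have hle : (((1:ℕ) + 2 : ℕ) : ℝ) * max (ph L K y θ x t - u (x, t)) 0 ^ (1 + 1) * (K * (-L) - Dt u (x, t)) ≤ Φ x := by
        refine le_trans ?_ (hΦ1 x hx)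
        rw [Lx_sub _ (ph_cd L K y θ x t) (h.cd x hxc t htI), Lx_ph, h.eq x hxc t htI]
        have e1 := (h.ell x hxc t htI).trace_le
        have e2 : K * (-L) ≤ - (2 * K * ∑ i, a (x, t) i i) := by
          rw [hLdef]; unfold Lam
          nlinarith [mul_le_mul_of_nonneg_left e1 hK.le]
        have e3 : (((1:ℕ) + 2 : ℕ) : ℝ) * max (ph L K y θ x t - u (x, t)) 0 ^ (1 + 1) = 3 * max (ph L K y θ x t - u (x, t)) 0 ^ 2 := by norm_num
        rw [e3]
        exact mul_le_mul_of_nonneg_left (by linarith) (by positivity)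
      have hd4 : Tendsto (fun s => q s x) (nhdsWithin t (Ioi t)) (nhds ((((1:ℕ) + 2 : ℕ) : ℝ) * max (ph L K y θ x t - u (x, t)) 0 ^ (1 + 1) * (K * (-L) - Dt u (x, t)))) := by
        refine (hd3.mono_left (nhdsWithin_mono _ fun s hs => ?_)).congr fun s => ?_
        · exact ne_of_gt hs
        · simp [slope, hq]
      have hd5 := hd4.max (tendsto_const_nhds (x := Φ x))
      rwa [max_eq_right hle] at hd5
  have hlt : ∫ x in ball x0 R, Φ x < r := lt_of_le_of_lt hΦ2 hr
  filter_upwards [hev, hlim.eventually (gt_mem_nhds hlt)] with s hs hs2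
  refine lt_of_le_of_lt ?_ hs2
  have e : (s - t)⁻¹ * (HH u x0 R L K y θ s - HH u x0 R L K y θ t) = ∫ x in ball x0 R, q s x := by
    unfold HH
    rw [← integral_sub (h.HH_int L K y θ hs.1) (h.HH_int L K y θ htI), ← integral_const_mul]
  rw [e]
  exact integral_mono (hqi s hs.1) ((hqi s hs.1).sup hΦi) fun x => le_max_left _ _

end

/-- times at which the solution is `C^{1,1}` from below with constant `M` -/
def TT {n : ℕ} (u : E n × ℝ → ℝ) (x0 : E n) (R τ β M : ℝ) : Set ℝ :=
  {t | t ∈ Icc τ β ∧ ∀ x1 ∈ closedBall x0 R, |u (x1, t)| ≤ M ∧ ∃ p : E n, ‖p‖ ≤ M ∧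
    ∀ x ∈ closedBall x0 R, u (x1, t) + inner ℝ p (x - x1) - M * ‖x - x1‖ ^ 2 ≤ u (x, t)}

/-- opening of the touching paraboloids -/
def KK (M d : ℝ) : ℝ := (M + 1) * (1 + 2 / d + 8 / d ^ 2)

theorem KK_facts {M d : ℝ} (hM : 0 ≤ M) (hd : 0 < d) : M + 1 ≤ KK M d ∧ 0 < KK M d ∧ M / KK M d ≤ d ^ 2 / 8 ∧
    M / (2 * KK M d) ≤ d / 4 := by
  have h1 : M + 1 ≤ KK M d := by
    unfold KK
    have : 0 ≤ 2 / d + 8 / d ^ 2 := by positivity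
    nlinarith
  have h0 : 0 < KK M d := by linarith
  have h2 : (M + 1) * (8 / d ^ 2) ≤ KK M d := by
    unfold KK
    have : 0 ≤ (M + 1) * (1 + 2 / d) := by positivity
    nlinarith
  have h3 : (M + 1) * (2 / d) ≤ KK M d := by
    unfold KK
    have : 0 ≤ (M + 1) * (1 + 8 / d ^ 2) := by positivity
    nlinarith
  refine ⟨h1, h0, ?_, ?_⟩
  · rw [div_le_iff₀ h0]
    calc M ≤ d ^ 2 / 8 * ((M + 1) * (8 / d ^ 2)) := by field_simp; linarith
      _ ≤ _ := by gcongr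
  · rw [div_le_iff₀ (by positivity)]
    calc M ≤ d / 4 * (2 * ((M + 1) * (2 / d))) := by field_simp; linarith
      _ ≤ _ := by gcongr

section
variable {n : ℕ} {ν C : ℝ} {x0 : E n} {R τ β : ℝ} {a : E n × ℝ → Fin n → Fin n → ℝ}
  {u : E n × ℝ → ℝ}

theorem AB.utc (h : AB ν C x0 R τ β a u) {x : E n} (hx : x ∈ closedBall x0 R) :
    ContinuousOn (fun t => u (x, t)) (Icc τ β) :=
  fun t ht => (h.dt x hx t ht).continuousAt.continuousWithinAt

theorem AB.TT_closed (h : AB ν C x0 R τ β a u) (M : ℝ) : IsClosed (TT u x0 R τ β M) := by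
  have h1 : ∀ x1 ∈ closedBall x0 R, IsClosed {t | t ∈ Icc τ β ∧ |u (x1, t)| ≤ M ∧ ∃ p : E n, ‖p‖ ≤ M ∧
    ∀ x ∈ closedBall x0 R, u (x1, t) + inner ℝ p (x - x1) - M * ‖x - x1‖ ^ 2 ≤ u (x, t)} := by
    intro x1 hx1
    set S : Set (ℝ × E n) := Icc τ β ×ˢ closedBall 0 M with hS
    have hSc : IsCompact S := isCompact_Icc.prod (isCompact_closedBall _ _)
    have c1 : ∀ x ∈ closedBall x0 R, ContinuousOn (fun z : ℝ × E n => u (x, z.1)) S := by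
      intro x hx
      exact (h.utc hx).comp continuousOn_fst (fun z hz => hz.1)
    have hcl : IsClosed ({z ∈ S | |u (x1, z.1)| ≤ M} ∩ ⋂ x ∈ closedBall x0 R,
        {z ∈ S | u (x1, z.1) + inner ℝ z.2 (x - x1) - M * ‖x - x1‖ ^ 2 ≤ u (x, z.1)}) := by
      refine IsClosed.inter ?_ (isClosed_biInter fun x hx => ?_)
      · exact hSc.isClosed.isClosed_le (c1 x1 hx1).abs continuousOn_const
      · refine hSc.isClosed.isClosed_le ?_ (c1 x hx)
        refine ((c1 x1 hx1).add ?_).sub continuousOn_const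
        exact (Continuous.inner continuous_snd continuous_const).continuousOn
    have hco := hSc.of_isClosed_subset hcl (fun z hz => hz.1.1)
    have := (hco.image continuous_fst).isClosed
    convert this using 1
    ext t
    constructor
    · rintro ⟨ht, hu, p, hp, hq⟩
      have hm : ((t, p) : ℝ × E n) ∈ S := ⟨ht, by simpa using hp⟩
      refine ⟨(t, p), ⟨⟨hm, hu⟩, ?_⟩, rfl⟩
      exact mem_iInter₂.2 fun x hx => ⟨hm, hq x hx⟩
    · rintro ⟨⟨t', p⟩, ⟨⟨hm, hu⟩, hq⟩, rfl⟩
      refine ⟨hm.1, hu, p, by simpa using hm.2, fun x hx => ?_⟩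
      exact (mem_iInter₂.1 hq x hx).2
  have : TT u x0 R τ β M = Icc τ β ∩ ⋂ x1 ∈ closedBall x0 R, {t | t ∈ Icc τ β ∧ |u (x1, t)| ≤ M ∧ ∃ p : E n, ‖p‖ ≤ M ∧
    ∀ x ∈ closedBall x0 R, u (x1, t) + inner ℝ p (x - x1) - M * ‖x - x1‖ ^ 2 ≤ u (x, t)} := by
    ext t
    constructor
    · rintro ⟨h1, h2⟩
      exact ⟨h1, mem_iInter₂.2 fun x hx => ⟨h1, h2 x hx⟩⟩
    · rintro ⟨h1, h2⟩
      exact ⟨h1, fun x hx => (mem_iInter₂.1 h2 x hx).2⟩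
  rw [this]
  exact isClosed_Icc.inter (isClosed_biInter h1)

theorem AB.TT_cover (h : AB ν C x0 R τ β a u) {t : ℝ} (ht : t ∈ Icc τ β) : ∃ M : ℕ, t ∈ TT u x0 R τ β M := by
  set f : E n → ℝ := fun x => u (x, t) with hf
  have hcd : ∀ x ∈ closedBall x0 R, ContDiffAt ℝ 2 f x := fun x hx => h.cd x hx t ht
  have hB := isCompact_closedBall x0 R
  obtain ⟨M0, hM0⟩ := hB.exists_bound_of_continuousOn (f := f) (h.uc ht)
  obtain ⟨M1, hM1⟩ := hB.exists_bound_of_continuousOn (f := fderiv ℝ f)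
    (fun x hx => (cd_fderiv (hcd x hx)).continuousAt.continuousWithinAt)
  obtain ⟨M2, hM2⟩ := hB.exists_bound_of_continuousOn (f := fderiv ℝ (fderiv ℝ f))
    (fun x hx => ((cd_fderiv (hcd x hx)).fderiv_right (m := 0) (by norm_num)).continuousAt.continuousWithinAt)
  obtain ⟨M, hM⟩ := exists_nat_ge (max M0 (max M1 M2))
  have m0 : M0 ≤ M := (le_max_left _ _).trans hM
  have m1 : M1 ≤ M := ((le_max_left _ _).trans (le_max_right _ _)).trans hM
  have m2 : M2 ≤ M := ((le_max_right _ _).trans (le_max_right _ _)).trans hM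
  refine ⟨M, ht, fun x1 hx1 => ⟨(hM0 x1 hx1).trans m0, (InnerProductSpace.toDual ℝ (E n)).symm (fderiv ℝ f x1), ?_, fun x hx => ?_⟩⟩
  · rw [LinearIsometryEquiv.norm_map]; exact (hM1 x1 hx1).trans m1
  · rw [InnerProductSpace.toDual_symm_apply]
    have hconv := convex_closedBall x0 R
    have hseg := hconv.segment_subset hx1 hx
    have hsb : ∀ z ∈ segment ℝ x1 x, ‖z - x1‖ ≤ ‖x - x1‖ := by
      intro z hz
      have : segment ℝ x1 x ⊆ closedBall x1 ‖x - x1‖ :=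
        (convex_closedBall x1 _).segment_subset (by simp) (by simp [dist_eq_norm])
      simpa [dist_eq_norm] using this hz
    have h2 := Convex.norm_image_sub_le_of_norm_hasFDerivWithin_le' (𝕜 := ℝ) (f := f) (f' := fderiv ℝ f) (φ := fderiv ℝ f x1)
      (C := M * ‖x - x1‖) (s := segment ℝ x1 x)
      (fun z hz => (cd_d (hcd z (hseg hz))).hasFDerivAt.hasFDerivWithinAt)
      (fun z hz => by
        have := Convex.norm_image_sub_le_of_norm_fderiv_le (𝕜 := ℝ) (f := fderiv ℝ f) (C := M) (s := closedBall x0 R)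
          (fun z hz => cd_diff (hcd z hz)) (fun z hz => (hM2 z hz).trans m2) hconv hx1 (hseg hz)
        refine this.trans ?_
        gcongr
        exact hsb z hz)
      (convex_segment _ _) (left_mem_segment ℝ x1 x) (right_mem_segment ℝ x1 x)
    rw [Real.norm_eq_abs, abs_le] at h2
    have := h2.1
    have e1 : u (x, t) = f x := rfl
    have e2 : u (x1, t) = f x1 := rfl
    rw [e1, e2]
    nlinarith

theorem AB.gap (h : AB ν C x0 R τ β a u) {M r : ℝ} (hM : 0 ≤ M) (hr : r < R) {p1 t : ℝ}
    (hp : p1 ∈ TT u x0 R τ β M) (hpt : p1 < t) (htβ : t ≤ β)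
    (hD : ∀ s ∈ Ioo p1 t, DD u x0 R (Lam n ν) C s) {x1 : E n} (hx1 : x1 ∈ closedBall x0 r) :
    u (x1, p1) - KK M (R - r) * Lam n ν * (t - p1) ≤ u (x1, t) := by
  have hL := Lam_pos (n := n) h.hν
  set L := Lam n ν with hLdef
  obtain ⟨k1, k2, k3, k4⟩ := KK_facts hM (sub_pos.2 hr)
  set K := KK M (R - r) with hKdef
  obtain ⟨hpI, hp2⟩ := hp
  have hx1b : x1 ∈ ball x0 R := closedBall_subset_ball hr hx1
  obtain ⟨hu, p, hpM, hq⟩ := hp2 x1 (ball_subset_closedBall hx1b)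
  have hu0 := h.pos x1 (ball_subset_closedBall hx1b) p1 hpI
  rw [abs_of_nonneg hu0] at hu
  set y : E n := x1 + (2 * K)⁻¹ • p with hy
  set θ : ℝ := u (x1, p1) / K + ‖p‖ ^ 2 / (4 * K ^ 2) + L * p1 with hθ
  have hdy : ∀ x : E n, ‖x - y‖ ^ 2 = ‖x - x1‖ ^ 2 - inner ℝ p (x - x1) / K + ‖p‖ ^ 2 / (4 * K ^ 2) := by
    intro x
    have : x - y = (x - x1) - (2 * K)⁻¹ • p := by rw [hy]; abel
    rw [this, norm_sub_sq_real, norm_smul, mul_pow, inner_smul_right, real_inner_comm]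
    rw [Real.norm_eq_abs, sq_abs]
    field_simp
    ring
  have hphi : ∀ x s, ph L K y θ x s = u (x1, p1) + inner ℝ p (x - x1) - K * ‖x - x1‖ ^ 2 - K * L * (s - p1) := by
    intro x s
    unfold ph
    rw [hdy, hθ]
    field_simp
    ring
  have hV : ∀ s, p1 ≤ s → VP x0 R L K y θ s := by
    intro s hs
    refine ⟨k2, fun x hx => ?_⟩
    have h1 : L * p1 ≤ L * s := by gcongr
    have h2 : ‖x - y‖ ^ 2 ≤ u (x1, p1) / K + ‖p‖ ^ 2 / (4 * K ^ 2) := by linarith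
    have h3 : u (x1, p1) / K ≤ M / K := by gcongr
    have h4 : ‖p‖ ^ 2 / (4 * K ^ 2) = (‖p‖ / (2 * K)) ^ 2 := by rw [div_pow]; congr 1; ring
    have h5 : ‖p‖ / (2 * K) ≤ (R - r) / 4 := le_trans (by gcongr) k4
    have h6 : (‖p‖ / (2 * K)) ^ 2 ≤ ((R - r) / 4) ^ 2 := by gcongr
    have h7 : ‖x - y‖ ^ 2 ≤ ((R - r) / 2) ^ 2 := by nlinarith
    have hd : 0 < R - r := sub_pos.2 hr
    have h8 : ‖x - y‖ ≤ (R - r) / 2 := abs_le_of_sq_le_sq' h7 (by positivity) |>.2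
    have h9 : ‖y - x1‖ ≤ (R - r) / 4 := by
      rw [hy, add_sub_cancel_left, norm_smul, norm_inv, Real.norm_of_nonneg (by positivity : (0:ℝ) ≤ 2 * K)]
      calc (2 * K)⁻¹ * ‖p‖ = ‖p‖ / (2 * K) := by ring
        _ ≤ _ := h5
    rw [mem_closedBall] at hx1
    rw [mem_ball]
    have t1 := dist_triangle x y x0
    have t2 := dist_triangle y x1 x0
    rw [dist_eq_norm x y] at t1
    rw [dist_eq_norm y x1] at t2
    linarith
  have hz : HH u x0 R L K y θ p1 = 0 := by
    unfold HH
    refine setIntegral_eq_zero_of_forall_eq_zero fun x hx => ?_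
    have h1 := hq x (ball_subset_closedBall hx)
    have h2 := hphi x p1
    have : ph L K y θ x p1 - u (x, p1) ≤ 0 := by
      rw [h2]
      have : M * ‖x - x1‖ ^ 2 ≤ K * ‖x - x1‖ ^ 2 := by gcongr; linarith
      linarith
    rw [max_eq_right this]; simp
  have hcont := h.HH_cont hL.le k2.le y θ
  have hsub : Icc p1 t ⊆ Icc τ β := Icc_subset_Icc hpI.1 htβ
  have hgr : ∀ a' ∈ Ioo p1 t, HH u x0 R L K y θ t ≤ HH u x0 R L K y θ a' * Real.exp (C * (t - a')) := by
    intro a' ha'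
    have := le_gronwallBound_of_liminf_deriv_right_le (f := HH u x0 R L K y θ) (f' := fun s => C * HH u x0 R L K y θ s)
      (δ := HH u x0 R L K y θ a') (K := C) (ε := 0) (a := a') (b := t)
      (hcont.mono ((Icc_subset_Icc_left ha'.1.le).trans hsub))
      (fun s hs r hr => ((hD s ⟨ha'.1.trans_le hs.1, hs.2⟩) K y θ (hV s (ha'.1.le.trans hs.1)) r hr).frequently)
      le_rfl (fun s hs => by simp) t ⟨ha'.2.le, le_rfl⟩
    rwa [gronwallBound_ε0] at this
  have hlim : HH u x0 R L K y θ t ≤ 0 := by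
    have h1 : Tendsto (HH u x0 R L K y θ) (nhdsWithin p1 (Ioi p1)) (nhds 0) := by
      have := (hcont p1 hpI)
      rw [ContinuousWithinAt, hz] at this
      refine this.mono_left (nhdsWithin_le_iff.2 ?_)
      filter_upwards [Ioo_mem_nhdsGT hpt] with s hs
      exact hsub ⟨hs.1.le, hs.2.le⟩
    have h2 : Tendsto (fun s => Real.exp (C * (t - s))) (nhdsWithin p1 (Ioi p1)) (nhds (Real.exp (C * (t - p1)))) :=
      ((Continuous.tendsto (by fun_prop) p1)).mono_left nhdsWithin_le_nhds
    have h3 := h1.mul h2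
    rw [zero_mul] at h3
    refine ge_of_tendsto h3 ?_
    filter_upwards [Ioo_mem_nhdsGT hpt] with s hs
    exact hgr s hs
  have htI : t ∈ Icc τ β := ⟨hpI.1.trans hpt.le, htβ⟩
  have hz2 : HH u x0 R L K y θ t = 0 := le_antisymm hlim (by
    unfold HH; exact integral_nonneg fun x => by positivity)
  unfold HH at hz2
  rw [integral_eq_zero_iff_of_nonneg (fun x => by positivity) (h.HH_int L K y θ htI)] at hz2
  have hc : ContinuousOn (fun x => max (ph L K y θ x t - u (x, t)) 0 ^ 3) (ball x0 R) :=
    (((ph_cont L K y θ t).continuousOn.sub ((h.uc htI).mono ball_subset_closedBall)).sup continuousOn_const).pow 3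
  have := Measure.eqOn_open_of_ae_eq hz2 isOpen_ball hc continuousOn_const hx1b
  simp only [Pi.zero_apply] at this
  have h1 := pow_eq_zero_iff (n := 3) (by norm_num) |>.1 this
  have h2 := le_max_left (ph L K y θ x1 t - u (x1, t)) 0
  rw [h1, hphi] at h2
  simp at h2
  linarith

theorem AB.dt_lower (h : AB ν C x0 R τ β a u) {M : ℝ} {s : ℝ} (hs : s ∈ TT u x0 R τ β M) {x : E n}
    (hx : x ∈ ball x0 R) : - (2 * M * (∑ i, a (x, s) i i)) ≤ Dt u (x, s) := by
  have hxc := ball_subset_closedBall hx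
  obtain ⟨-, p, hp, hq⟩ := hs.2 x hxc
  set f : E n → ℝ := fun y => u (y, s) + (M * ‖y - x‖ ^ 2 + ((-1) * (innerSL ℝ p) y + (inner ℝ p x - u (x, s)))) with hf
  have c1 : ContDiffAt ℝ 2 (fun y : E n => ‖y - x‖ ^ 2) x := (contDiffAt_id.sub contDiffAt_const).norm_sq ℝ
  have c2 : ContDiffAt ℝ 2 (fun y : E n => (innerSL ℝ p) y) x := (innerSL ℝ p).contDiff.contDiffAt
  have c3 := h.cd x hxc s hs.1
  have c4 : ContDiffAt ℝ 2 (fun y : E n => (-1) * (innerSL ℝ p) y + (inner ℝ p x - u (x, s))) x :=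
    (contDiffAt_const.mul c2).add contDiffAt_const
  have hmin : IsLocalMin f x := by
    filter_upwards [isOpen_ball.mem_nhds hx] with y hy
    have := hq y (ball_subset_closedBall hy)
    simp only [hf, innerSL_apply_apply, sub_self, norm_zero]
    rw [inner_sub_right] at this
    linarith
  have := Lx_nonneg_of_min (h.ell x hxc s hs.1) h.hν (c3.add ((contDiffAt_const.mul c1).add c4)) hmin
  rw [Lx_add _ c3 ((contDiffAt_const.mul c1).add c4), Lx_add _ (contDiffAt_const.mul c1) c4,
    Lx_smul _ _ c1, Lx_add _ (contDiffAt_const.mul c2) contDiffAt_const, Lx_smul _ _ c2, Lx_lin, Lx_const,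
    Lx_normsq, h.eq x hxc s hs.1] at this
  linarith

theorem AB.chain (h : AB ν C x0 R τ β a u) {M r : ℝ} (hM : 0 ≤ M) (hr : r < R) {I P : Set ℝ}
    (hI : I.OrdConnected) (hPc : IsClosed P) (hP : ∀ s ∈ P, s ∈ I → s ∈ TT u x0 R τ β M)
    (hD : ∀ s ∈ Ico τ β, s ∉ P → DD u x0 R (Lam n ν) C s) {p t : ℝ} (hp : p ∈ P) (hpI : p ∈ I) (htI : t ∈ I)
    (hpt : p ≤ t) (htβ : t ≤ β) {x : E n} (hx : x ∈ closedBall x0 r) :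
    u (x, p) - KK M (R - r) * Lam n ν * (t - p) ≤ u (x, t) := by
  have hL := Lam_pos (n := n) h.hν
  obtain ⟨k1, k2, -, -⟩ := KK_facts hM (sub_pos.2 hr)
  have hxb : x ∈ ball x0 R := closedBall_subset_ball hr hx
  have hxc := ball_subset_closedBall hxb
  have hτp : τ ≤ p := (hP p hp hpI).1.1
  set κ := KK M (R - r) * Lam n ν with hκ
  set g : ℝ → ℝ := fun s => u (x, s) + κ * s with hg
  suffices hh : g p ≤ g t by simp only [hg] at hh; linarith
  have hgc : ContinuousOn g (Icc τ β) := (h.utc hxc).add (by fun_prop)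
  have hpt' : Icc p t ⊆ Icc τ β := Icc_subset_Icc hτp htβ
  have hA : IsCompact {s ∈ P ∩ Icc p t | g p ≤ g s} :=
    (isCompact_Icc (a := p) (b := t)).of_isClosed_subset
      ((hPc.inter isClosed_Icc).isClosed_le continuousOn_const (hgc.mono (inter_subset_right.trans hpt')))
      (fun s hs => hs.1.2)
  obtain ⟨s, ⟨⟨hsP, hsI⟩, hsg⟩, hsmax⟩ := hA.exists_isGreatest ⟨p, ⟨hp, le_rfl, hpt⟩, le_rfl⟩
  rcases hsI.2.eq_or_lt with hst | hst
  · rwa [← hst]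
  have hsII : s ∈ I := hI.out hpI htI hsI
  have hsT := hP s hsP hsII
  have hgap : ∀ q, s < q → q ≤ t → (∀ s' ∈ Ioo s q, s' ∉ P) → g s ≤ g q := by
    intro q hsq hqt hno
    have := h.gap hM hr hsT hsq (hqt.trans htβ) (fun s' hs' => hD s' ⟨hsT.1.1.trans hs'.1.le, (hs'.2.trans_le hqt).trans_le htβ⟩ (hno s' hs')) hx
    simp only [hg]
    rw [← hκ] at this
    linarith
  have hder : HasDerivAt g (Dt u (x, s) + κ) s := by
    have := (h.dt x hxc s hsT.1).hasDerivAt.add ((hasDerivAt_id s).const_mul κ)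
    simp only [mul_one] at this
    exact this
  have hpos : 0 < Dt u (x, s) + κ := by
    have h1 := h.dt_lower hsT hxb
    have h2 := (h.ell x hxc s hsT.1).trace_le
    have h3 : 2 * M * (∑ i, a (x, s) i i) ≤ 2 * M * (n * ν⁻¹) := by gcongr
    have h4 : (M + 1) * Lam n ν ≤ κ := by rw [hκ]; gcongr
    have h5 : 0 ≤ n * ν⁻¹ := mul_nonneg (Nat.cast_nonneg n) (inv_nonneg.2 h.hν.le)
    have h6 : 2 * M * (n * ν⁻¹) < (M + 1) * Lam n ν := by unfold Lam; nlinarith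
    linarith
  have hev : ∀ᶠ s' in nhdsWithin s (Ioi s), g s < g s' := by
    have h1 := hder.tendsto_slope.eventually (lt_mem_nhds hpos)
    have h2 := h1.filter_mono (nhdsWithin_mono s (fun s' hs' => ne_of_gt hs') : nhdsWithin s (Ioi s) ≤ nhdsWithin s {s}ᶜ)
    filter_upwards [h2, self_mem_nhdsWithin] with s' hs' hs''
    rw [slope_def_field] at hs'
    have h3 : 0 < s' - s := sub_pos.2 hs''
    have := (div_pos_iff_of_pos_right h3).1 hs'
    linarith
  obtain ⟨η, hη, hηs⟩ := (mem_nhdsGT_iff_exists_Ioo_subset).1 hev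
  have hno : ∀ s' ∈ P, s < s' → s' ≤ t → η ≤ s' := by
    intro s' hs' h1 h2
    by_contra h3
    have h4 : g s < g s' := hηs ⟨h1, not_le.1 h3⟩
    have := hsmax ⟨⟨hs', hsI.1.trans h1.le, h2⟩, hsg.trans h4.le⟩
    linarith
  by_cases hB : (P ∩ Icc η t).Nonempty
  · have hBc : IsCompact (P ∩ Icc η t) := isCompact_Icc.inter_left hPc
    obtain ⟨q, hq, hqmin⟩ := hBc.exists_isLeast hB
    have hsq : s < q := lt_of_lt_of_le hη hq.2.1
    have := hgap q hsq hq.2.2 (fun s' hs' hsP' => by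
      have h1 := hno s' hsP' hs'.1 (hs'.2.le.trans hq.2.2)
      have := hqmin ⟨hsP', h1, hs'.2.le.trans hq.2.2⟩
      linarith [hs'.2])
    have := hsmax ⟨⟨hq.1, hsI.1.trans hsq.le, hq.2.2⟩, hsg.trans this⟩
    linarith
  · refine hsg.trans (hgap t hst le_rfl fun s' hs' hsP' => hB ⟨s', hsP', ?_, hs'.2.le⟩)
    exact hno s' hsP' hs'.1 hs'.2.le

theorem AB.main (h : AB ν C x0 R τ β a u) (hτβ : τ ≤ β) {r : ℝ} (hr : r < R) :
    ∃ K : ℝ, ∀ x ∈ closedBall x0 r, ∀ t ∈ Icc τ β, u (x, τ) - K * (t - τ) ≤ u (x, t) := by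
  set Bad : Set ℝ := {t ∈ Ico τ β | ¬ DD u x0 R (Lam n ν) C t} with hBad
  set P := closure Bad with hP
  have hPsub : P ⊆ Icc τ β := closure_minimal (fun t ht => ⟨ht.1.1, ht.1.2.le⟩) isClosed_Icc
  have hD : ∀ s ∈ Ico τ β, s ∉ P → DD u x0 R (Lam n ν) C s := by
    intro s hs hsP
    by_contra hc
    exact hsP (subset_closure ⟨hs, hc⟩)
  have hempty : ¬ P.Nonempty := by
    intro hne
    have : Nonempty P := hne.to_subtype
    have hcs : CompleteSpace P := (isClosed_closure : IsClosed P).completeSpace_coe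
    obtain ⟨M, p, hp⟩ := nonempty_interior_of_iUnion_of_closed (X := P) (f := fun M : ℕ => Subtype.val ⁻¹' TT u x0 R τ β M)
      (fun M => (h.TT_closed M).preimage continuous_subtype_val) (by
        refine eq_univ_of_forall fun p => ?_
        obtain ⟨M, hM⟩ := h.TT_cover (hPsub p.2)
        exact mem_iUnion.2 ⟨M, hM⟩)
    obtain ⟨ε, hε, hball⟩ := Metric.isOpen_iff.1 isOpen_interior p hp
    have hPT : ∀ s ∈ P, s ∈ ball p.1 ε → s ∈ TT u x0 R τ β M := by
      intro s hs hsb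
      have : (⟨s, hs⟩ : P) ∈ ball p ε := hsb
      have h3 := interior_subset (hball this)
      exact h3
    obtain ⟨t', ht', hd⟩ := Metric.mem_closure_iff.1 p.2 ε hε
    refine ht'.2 (h.dini ht'.1 fun r hr => ⟨KK M (R - r) * Lam n ν, p.1 + ε - t', ?_, ?_⟩)
    · rw [Real.dist_eq, abs_lt] at hd; linarith
    · intro x hx s hs hts hsη
      have hIc : (ball p.1 ε).OrdConnected := by rw [Real.ball_eq_Ioo]; exact ordConnected_Ioo
      refine h.chain (Nat.cast_nonneg M) hr hIc isClosed_closure hPT hD (subset_closure ht') ?_ ?_ hts.le hs.2 hx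
      · rw [mem_ball, dist_comm]; exact hd
      · rw [Real.dist_eq, abs_lt] at hd
        rw [Real.ball_eq_Ioo]; constructor <;> linarith
  obtain ⟨M, hM⟩ := h.TT_cover (left_mem_Icc.2 hτβ)
  refine ⟨KK M (R - r) * Lam n ν, fun x hx t ht => ?_⟩
  rcases ht.1.eq_or_lt with hτ | hτ
  · rw [← hτ]; simp
  · exact h.gap (Nat.cast_nonneg M) hr hM hτ ht.2 (fun s hs => hD s ⟨hs.1.le, hs.2.trans_le ht.2⟩
      fun hsP => hempty ⟨s, hsP⟩) hx
end

theorem LB {α : Type*} [TopologicalSpace α] {f : α → ℝ} {K : Set α} (hK : IsCompact K)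
    (h : ∀ X ∈ K, ∃ B, ∀ᶠ Y in nhds X, f Y ≤ B) : ∃ B, ∀ Y ∈ K, f Y ≤ B := by
  refine hK.induction_on (p := fun s => ∃ B, ∀ Y ∈ s, f Y ≤ B) ⟨0, fun Y hY => hY.elim⟩ ?_ ?_ ?_
  · rintro s t hst ⟨B, hB⟩
    exact ⟨B, fun Y hY => hB Y (hst hY)⟩
  · rintro s t ⟨B, hB⟩ ⟨B', hB'⟩
    exact ⟨max B B', fun Y hY => hY.elim (fun h => (hB Y h).trans (le_max_left _ _))
      (fun h => (hB' Y h).trans (le_max_right _ _))⟩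
  · intro X hX
    obtain ⟨B, hB⟩ := h X hX
    exact ⟨{Y | f Y ≤ B}, mem_nhdsWithin_of_mem_nhds hB, B, fun Y hY => hY⟩

theorem box_enlarge {n : ℕ} {V : Set (E n × ℝ)} (hV : IsOpen V) {x0 : E n} {r τ β : ℝ} (hr : 0 < r)
    (h : closedBall x0 r ×ˢ Icc τ β ⊆ V) : ∃ R, r < R ∧ closedBall x0 R ×ˢ Icc τ β ⊆ V := by
  obtain ⟨U, W, hU, hW, hrU, hIW, hUW⟩ := generalized_tube_lemma (isCompact_closedBall x0 r)
    (isCompact_Icc (a := τ) (b := β)) hV h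
  obtain ⟨ε, hε, hεU⟩ := (isCompact_closedBall x0 r).exists_cthickening_subset_open hU hrU
  rw [cthickening_closedBall hε.le hr.le] at hεU
  exact ⟨ε + r, by linarith, (prod_mono hεU hIW).trans hUW⟩

theorem hs_contAt {n : ℕ} {f : E n × ℝ → ℝ} {X : E n × ℝ} (hf : ContDiffAt ℝ 3 f X) (i j : Fin n) :
    ContinuousAt (fun Z : E n × ℝ => hs (fun y => f (y, Z.2)) Z.1 i j) X := by
  have h1 : ContDiffAt ℝ 2 (fun Z : E n × ℝ => fderiv ℝ (fun y => f (y, Z.2)) Z.1) X := by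
    refine ContDiffAt.fderiv (f := fun (Z : E n × ℝ) (y : E n) => f (y, Z.2)) (g := fun Z => Z.1)
      (n := 3) ?_ contDiffAt_fst (by norm_num)
    have : ContDiffAt ℝ 3 (fun Z : (E n × ℝ) × E n => (Z.2, Z.1.2)) (X, X.1) := by fun_prop
    exact ContDiffAt.comp (X, X.1) (g := f) (f := fun Z : (E n × ℝ) × E n => (Z.2, Z.1.2)) hf this
  have h2 : ContDiffAt ℝ 2 (fun Z : E n × ℝ => fderiv ℝ (fun y => f (y, Z.2)) Z.1
      (EuclideanSpace.single j 1)) X := h1.clm_apply contDiffAt_const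
  have h3 : ContDiffAt ℝ 1 (fun Z : E n × ℝ => fderiv ℝ (fun w => fderiv ℝ (fun y => f (y, Z.2)) w
      (EuclideanSpace.single j 1)) Z.1) X := by
    refine ContDiffAt.fderiv (f := fun (Z : E n × ℝ) (w : E n) => fderiv ℝ (fun y => f (y, Z.2)) w
      (EuclideanSpace.single j 1)) (g := fun Z => Z.1)
      (n := 2) ?_ contDiffAt_fst (by norm_num)
    have : ContDiffAt ℝ 2 (fun Z : (E n × ℝ) × E n => (Z.2, Z.1.2)) (X, X.1) := by fun_prop
    exact ContDiffAt.comp (X, X.1) (g := fun Z : E n × ℝ => fderiv ℝ (fun y => f (y, Z.2)) Z.1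
      (EuclideanSpace.single j 1)) (f := fun Z : (E n × ℝ) × E n => (Z.2, Z.1.2)) h2 this
  exact (h3.clm_apply contDiffAt_const).continuousAt

theorem SolvesL.neg {n : ℕ} {a : E n × ℝ → Fin n → Fin n → ℝ} {u : E n × ℝ → ℝ} {V : Set (E n × ℝ)}
    (h : SolvesL a u V) : SolvesL a (fun X => - u X) V := by
  refine ⟨fun X hX => ⟨(h.1 X hX).1.neg, (h.1 X hX).2.neg⟩, fun X hX => ?_⟩
  have h1 : Lx (a X) (fun x => u (x, X.2)) X.1 - Dt u X = 0 := h.2 X hX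
  have h2 := Lx_smul (a X) (-1) (h.1 X hX).1
  simp only [neg_one_mul] at h2
  have h3 : Dt (fun X => - u X) X = - Dt u X := deriv.fun_neg
  change Lx (a X) (fun x => - u (x, X.2)) X.1 - Dt (fun X => - u X) X = 0
  rw [h2, h3]; linarith

theorem SolvesL.PS {n : ℕ} {ν : ℝ} {a : E n × ℝ → Fin n → Fin n → ℝ} {u : E n × ℝ → ℝ} {V : Set (E n × ℝ)}
    (h : SolvesL a u V) (ha : IsParabolicCoeff ν a V) : PS ν u V := by
  intro X hX
  refine ⟨(h.1 X hX).1, (h.1 X hX).2, a X, ha.2 X hX, ?_⟩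
  have h1 : Lx (a X) (fun x => u (x, X.2)) X.1 - Dt u X = 0 := h.2 X hX
  linarith

theorem SolvesL.mono {n : ℕ} {a : E n × ℝ → Fin n → Fin n → ℝ} {u : E n × ℝ → ℝ} {V W : Set (E n × ℝ)}
    (h : SolvesL a u V) (hW : W ⊆ V) : SolvesL a u W :=
  ⟨fun X hX => h.1 X (hW hX), fun X hX => h.2 X (hW hX)⟩

theorem IsParabolicCoeff.mono {n : ℕ} {ν : ℝ} {a : E n × ℝ → Fin n → Fin n → ℝ} {V W : Set (E n × ℝ)}
    (h : IsParabolicCoeff ν a V) (hW : W ⊆ V) : IsParabolicCoeff ν a W :=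
  ⟨fun i j => (h.1 i j).mono hW, fun X hX => h.2 X (hW hX)⟩

theorem A1 {n : ℕ} {ν : ℝ} (hν : 0 < ν) {a : E n × ℝ → Fin n → Fin n → ℝ} {u : E n × ℝ → ℝ}
    {V : Set (E n × ℝ)} (hV : IsOpen V) (ha : IsParabolicCoeff ν a V) (h : SolvesL a u V)
    (hb : ∀ X ∈ V, ∃ B, ∀ᶠ Y in nhds X, - u Y ≤ B) : Sup ν u V := by
  refine ⟨h.PS ha, fun x0 r τ β hr hτβ hsub => ?_⟩
  obtain ⟨R, hR, hRV⟩ := box_enlarge hV hr hsub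
  have hcomp : IsCompact (closedBall x0 R ×ˢ Icc τ β) := (isCompact_closedBall x0 R).prod isCompact_Icc
  obtain ⟨B, hB⟩ := LB hcomp fun X hX => hb X (hRV hX)
  have hcd : ∀ X ∈ V, ∀ i j, ContDiffAt ℝ 3 (fun X => a X i j) X := fun X hX i j =>
    ((ha.1 i j).contDiffAt (hV.mem_nhds hX)).of_le (by
      exact (WithTop.coe_le_coe (b := (3 : ℕ∞))).2 le_top)
  have hcont : ContinuousOn (fun X : E n × ℝ => |∑ i, ∑ j, hs (fun y => a (y, X.2) i j) X.1 j i|)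
      (closedBall x0 R ×ˢ Icc τ β) := by
    intro X hX
    refine ContinuousAt.continuousWithinAt ?_
    refine ContinuousAt.abs ?_
    refine tendsto_finsetSum _ fun i _ => tendsto_finsetSum _ fun j _ => ?_
    exact hs_contAt (f := fun X => a X i j) (hcd X (hRV hX) i j) j i
  obtain ⟨C, hC⟩ := hcomp.bddAbove_image hcont
  have hAB : AB ν C x0 R τ β a (fun X => u X + B) := by
    refine ⟨hν, hr.trans hR, ?_, ?_, ?_, ?_, ?_, ?_, ?_⟩
    · intro x hx t ht
      exact (h.1 (x, t) (hRV ⟨hx, ht⟩)).1.add contDiffAt_const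
    · intro x hx t ht
      exact (h.1 (x, t) (hRV ⟨hx, ht⟩)).2.add_const _
    · intro x hx t ht
      exact ha.2 (x, t) (hRV ⟨hx, ht⟩)
    · intro x hx t ht
      have h1 : Lx (a (x, t)) (fun y => u (y, t)) x - Dt u (x, t) = 0 := h.2 (x, t) (hRV ⟨hx, ht⟩)
      have h2 := Lx_add (a (x, t)) (h.1 (x, t) (hRV ⟨hx, ht⟩)).1
        (contDiffAt_const (c := B) (x := x) (n := 2) (𝕜 := ℝ))
      rw [Lx_const] at h2
      have h3 : Dt (fun X => u X + B) (x, t) = Dt u (x, t) := by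
        unfold Dt; simp
      rw [h3]
      refine h2.trans ?_
      simp only; linarith
    · intro x hx t ht i j
      have := (hcd (x, t) (hRV ⟨hx, ht⟩) i j).of_le (m := 2) (by norm_num)
      exact ContDiffAt.comp x (g := fun X : E n × ℝ => a X i j) (f := fun y => (y, t)) this
        (contDiffAt_id.prodMk contDiffAt_const)
    · intro x hx t ht
      exact hC ⟨(x, t), ⟨hx, ht⟩, rfl⟩
    · intro x hx t ht
      have := hB (x, t) ⟨hx, ht⟩
      linarith
  obtain ⟨K, hK⟩ := hAB.main hτβ hR
  refine ⟨K, fun x hx t ht => ?_⟩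
  have := hK x hx t ht
  linarith

theorem FFs {n : ℕ} {ν : ℝ} (hν : 0 < ν) : ∃ N : ℝ, 0 < N ∧
    ∀ (u : E n × ℝ → ℝ) (V : Set (E n × ℝ)) (x : E n) (t r : ℝ), 0 < r → Sup ν u V →
      Sup ν (fun X => - u X) V → (∀ X ∈ V, 0 ≤ u X) → (∃ B, ∀ X ∈ closedBall x (r * 10) ×ˢ
        Icc (t + r ^ 2 * (-4)) (t + r ^ 2 * 9), u X ≤ B) →
      closedBall x (r * 10) ×ˢ Icc (t + r ^ 2 * (-4)) (t + r ^ 2 * 9) ⊆ V →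
      ∀ x' ∈ closedBall x r, u (x, t) ≤ N * u (x', t + 9 * r ^ 2) := by
  obtain ⟨N, hN, H⟩ := FF (n := n) hν
  refine ⟨N, hN, fun u V x t r hr hS hS' hpos hB hsub x' hx' => ?_⟩
  have hsub' := mem_scl_box hr hsub
  have hsub2 := mem_scl_box hr (le_refl (closedBall x (r * 10) ×ˢ
    Icc (t + r ^ 2 * (-4)) (t + r ^ 2 * 9)))
  obtain ⟨B, hB⟩ := hB
  have key := H (scl u x t r 1 0) ((hS.scl x t 0 hr zero_le_one).mono hsub') ?_ ?_ ?_
    (r⁻¹ • (x' - x)) ?_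
  · simp only [scl, smul_zero, add_zero, mul_zero, one_mul, smul_smul, mul_inv_cancel₀ hr.ne',
      one_smul, add_sub_cancel] at key
    rwa [mul_comm (r ^ 2) 9] at key
  · have := (hS'.scl x t 0 hr zero_le_one).mono hsub'
    have e : (fun X => - scl u x t r 1 0 X) = scl (fun X => - u X) x t r 1 0 := by
      funext X; simp [scl]
    rw [e]; exact this
  · intro X hX
    have := hpos _ (hsub' hX)
    simp only [scl, one_mul, add_zero]; exact this
  · refine ⟨B, fun X hX => ?_⟩
    have := hB _ (hsub2 hX)
    simp only [scl, one_mul, add_zero]; exact this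
  · rw [mem_closedBall_zero_iff, norm_smul, norm_inv, Real.norm_of_nonneg hr.le, ← dist_eq_norm]
    rw [mem_closedBall] at hx'
    rw [inv_mul_le_iff₀ hr]; linarith

theorem baire_step {n : ℕ} {u : E n × ℝ → ℝ} {V F : Set (E n × ℝ)} (hV : IsOpen V)
    (hx : ∀ X ∈ V, ContinuousAt (fun x => u (x, X.2)) X.1)
    (ht : ∀ X ∈ V, ContinuousAt (fun t => u (X.1, t)) X.2) (hFV : F ⊆ V)
    (hF : ∀ X ∈ V, X ∈ closure F → X ∈ F) {X0 : E n × ℝ} (hX0 : X0 ∈ F) :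
    ∃ X1 ∈ F, ∃ ε K : ℝ, 0 < ε ∧ ε ≤ 1 ∧ closedBall X1.1 ε ×ˢ Icc (X1.2 - ε) (X1.2 + ε) ⊆ V ∧
      ∀ Z ∈ F ∩ closedBall X1.1 ε ×ˢ Icc (X1.2 - ε) (X1.2 + ε), ∀ s ∈ Icc (X1.2 - ε) (X1.2 + ε),
        u (Z.1, s) ≤ K := by
  obtain ⟨ρ', hρ', hρV'⟩ := Metric.isOpen_iff.1 hV X0 (hFV hX0)
  set ρ := ρ' / 3 with hρd
  have hρ : 0 < ρ := by positivity
  have hρV : closedBall X0 (2 * ρ) ⊆ V := (closedBall_subset_ball (by linarith)).trans hρV'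
  set G := F ∩ closedBall X0 ρ with hG
  have hGc : IsClosed G := by
    rw [← closure_subset_iff_isClosed]
    intro X hX
    have h1 : X ∈ closedBall X0 ρ := closure_minimal inter_subset_right isClosed_closedBall hX
    exact ⟨hF X (hρV (closedBall_subset_closedBall (by linarith) h1))
      (closure_mono inter_subset_left hX), h1⟩
  have hGk : IsCompact G := (isCompact_closedBall X0 ρ).of_isClosed_subset hGc inter_subset_right
  haveI : CompactSpace G := isCompact_iff_compactSpace.1 hGk
  have hin : ∀ X ∈ G, ∀ s, |s - X.2| ≤ ρ → (X.1, s) ∈ V := by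
    intro X hX s hs
    refine hρV ?_
    have h1 := mem_closedBall.1 hX.2
    rw [Prod.dist_eq, max_le_iff, Real.dist_eq] at h1
    rw [mem_closedBall, Prod.dist_eq, max_le_iff, Real.dist_eq]
    refine ⟨h1.1.trans (by linarith), ?_⟩
    have := abs_add_le (s - X.2) (X.2 - X0.2)
    rw [sub_add_sub_cancel] at this
    simp only
    linarith [h1.2]
  set A : ℕ → Set G := fun k => {X : G | ∀ s, |s - X.1.2| < ρ / (k + 1) → u (X.1.1, s) ≤ k} with hA
  have hρk : ∀ k : ℕ, ρ / ((k : ℝ) + 1) ≤ ρ := fun k =>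
    div_le_self hρ.le (by have : (0:ℝ) ≤ k := k.cast_nonneg; linarith)
  have hAc : ∀ k, IsClosed (A k) := by
    intro k
    rw [← closure_subset_iff_isClosed]
    intro X hX s hs
    have hXs := hin X.1 X.2 s (hs.le.trans (hρk k))
    have hc : ContinuousAt (fun Y : G => u (Y.1.1, s)) X :=
      ContinuousAt.comp (f := fun Y : G => Y.1.1) (g := fun x => u (x, s)) (hx _ hXs) (by fun_prop)
    by_contra hlt
    push Not at hlt
    have e1 := hc.eventually (lt_mem_nhds hlt)
    have e2 : ∀ᶠ Y : G in nhds X, |s - Y.1.2| < ρ / (k + 1) :=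
      (show ContinuousAt (fun Y : G => |s - Y.1.2|) X by fun_prop) (gt_mem_nhds hs)
    obtain ⟨Y, hY3, hY1, hY2⟩ := ((mem_closure_iff_frequently.1 hX).and_eventually (e1.and e2)).exists
    exact absurd (hY3 s hY2) (not_le.2 hY1)
  have hAU : ⋃ k, A k = univ := by
    rw [eq_univ_iff_forall]
    intro X
    have hc := ht X.1 (hFV X.2.1)
    have e1 := hc.eventually (gt_mem_nhds (lt_add_one (u X.1)))
    obtain ⟨η, hη, hηb⟩ := Metric.eventually_nhds_iff.1 e1
    obtain ⟨k1, hk1⟩ := exists_nat_gt (ρ / η)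
    obtain ⟨k2, hk2⟩ := exists_nat_gt (u X.1 + 1)
    rw [mem_iUnion]
    refine ⟨max k1 k2, fun s hs => ?_⟩
    have m1 : (k1 : ℝ) ≤ (max k1 k2 : ℕ) := by exact_mod_cast le_max_left _ _
    have m2 : (k2 : ℝ) ≤ (max k1 k2 : ℕ) := by exact_mod_cast le_max_right _ _
    have h0 : (0:ℝ) ≤ k1 := k1.cast_nonneg
    have h2 : dist s X.1.2 < η := by
      rw [Real.dist_eq]
      refine hs.trans_le ?_
      rw [div_lt_iff₀ hη] at hk1
      rw [div_le_iff₀ (by linarith)]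
      nlinarith
    have := hηb h2
    linarith
  have hD := dense_iUnion_interior_of_closed hAc hAU
  obtain ⟨X1, hX1, hX1U⟩ := hD.inter_open_nonempty {X : G | dist X.1 X0 < ρ}
    (isOpen_lt (by fun_prop) continuous_const) ⟨⟨X0, hX0, mem_closedBall_self hρ.le⟩, by
      change dist X0 X0 < ρ
      rw [dist_self]; exact hρ⟩
  rw [mem_iUnion] at hX1U
  obtain ⟨k, hk⟩ := hX1U
  obtain ⟨ε, hε, hεb⟩ := Metric.mem_nhds_iff.1 (mem_interior_iff_mem_nhds.1 hk)
  have hX1d : dist X1.1 X0 < ρ := hX1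
  set e := min (min (ε / 2) ((ρ - dist X1.1 X0) / 2)) (min (ρ / (k + 1) / 4) 1) with he
  have hk0 : (0:ℝ) ≤ k := k.cast_nonneg
  have hepos : 0 < e := by
    rw [he]
    have : 0 < ρ - dist X1.1 X0 := by linarith
    positivity
  have he1 : e ≤ ε / 2 := (min_le_left _ _).trans (min_le_left _ _)
  have he2 : e ≤ (ρ - dist X1.1 X0) / 2 := (min_le_left _ _).trans (min_le_right _ _)
  have he3 : e ≤ ρ / (k + 1) / 4 := (min_le_right _ _).trans (min_le_left _ _)
  have he4 : e ≤ 1 := (min_le_right _ _).trans (min_le_right _ _)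
  have hbox : closedBall X1.1.1 e ×ˢ Icc (X1.1.2 - e) (X1.1.2 + e) = closedBall X1.1 e := by
    rw [← Real.closedBall_eq_Icc, closedBall_prod_same]
  have hsub : closedBall X1.1 e ⊆ closedBall X0 ρ :=
    closedBall_subset_closedBall' (by linarith)
  refine ⟨X1.1, X1.2.1, e, k, hepos, he4, ?_, ?_⟩
  · rw [hbox]
    exact hsub.trans ((closedBall_subset_closedBall (by linarith)).trans hρV)
  · intro Z hZ s hs
    have hZ2 := hZ.2.2
    rw [hbox] at hZ
    have hZA : (⟨Z, hZ.1, hsub hZ.2⟩ : G) ∈ A k := hεb (by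
      rw [mem_ball]
      have := mem_closedBall.1 hZ.2
      change dist Z X1.1 < ε
      linarith)
    refine hZA s ?_
    have : 0 < ρ / ((k:ℝ) + 1) := by positivity
    rw [abs_lt]
    simp only [mem_Icc] at hZ2 hs
    constructor <;> simp only <;> linarith [hZ2.1, hZ2.2, hs.1, hs.2]

theorem A2 {n : ℕ} {ν : ℝ} (hν : 0 < ν) {a : E n × ℝ → Fin n → Fin n → ℝ} {u : E n × ℝ → ℝ}
    {V : Set (E n × ℝ)} (hV : IsOpen V) (ha : IsParabolicCoeff ν a V) (h : SolvesL a u V)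
    (hpos : ∀ X ∈ V, 0 ≤ u X) : ∀ X ∈ V, ∃ B, ∀ᶠ Y in nhds X, u Y ≤ B := by
  by_contra hcon
  push Not at hcon
  obtain ⟨X0, hX0V, hX0⟩ := hcon
  have hnegb : ∀ X ∈ V, ∃ B, ∀ᶠ Y in nhds X, - u Y ≤ B := fun X hX =>
    ⟨0, by filter_upwards [hV.mem_nhds hX] with Y hY; linarith [hpos Y hY]⟩
  have hSup : Sup ν u V := A1 hν hV ha h hnegb
  set F : Set (E n × ℝ) := {X ∈ V | ¬ ∃ B, ∀ᶠ Y in nhds X, u Y ≤ B} with hFdef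
  have hFV : F ⊆ V := fun X hX => hX.1
  have hFc : ∀ X ∈ V, X ∈ closure F → X ∈ F := by
    intro X hX hXc
    refine ⟨hX, ?_⟩
    rintro ⟨B, hB⟩
    obtain ⟨Y, hY, hYF⟩ := ((mem_closure_iff_frequently.1 hXc).and_eventually
      hB.eventually_nhds).exists
    exact hY.2 ⟨B, hYF⟩
  obtain ⟨X1, hX1, ε, K, hε, hε1, hbV, hK⟩ := baire_step hV
    (fun X hX => (h.1 X hX).1.continuousAt) (fun X hX => (h.1 X hX).2.continuousAt) hFV hFc
    (X0 := X0) ⟨hX0V, by push Not; intro B; exact hX0 B⟩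
  obtain ⟨x1, t1⟩ := X1
  simp only at hbV hK
  set I := Icc (t1 - ε) (t1 + ε) with hI
  have hFPc : IsCompact (F ∩ closedBall x1 ε ×ˢ I) := by
    refine ((isCompact_closedBall x1 ε).prod isCompact_Icc).of_isClosed_subset ?_ inter_subset_right
    rw [← closure_subset_iff_isClosed]
    intro X hX
    have h1 : X ∈ closedBall x1 ε ×ˢ I := closure_minimal inter_subset_right
      (isClosed_closedBall.prod isClosed_Icc) hX
    exact ⟨hFc X (hbV h1) (closure_mono inter_subset_left hX), h1⟩
  set Z := Prod.fst '' (F ∩ closedBall x1 ε ×ˢ I) with hZ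
  have hZc : IsCompact Z := hFPc.image continuous_fst
  have ht1I : t1 ∈ I := ⟨by linarith, by linarith⟩
  have hx1Z : x1 ∈ Z := ⟨(x1, t1), ⟨hX1, mem_closedBall_self hε.le, ht1I⟩, rfl⟩
  have hZK : ∀ z ∈ Z, ∀ s ∈ I, u (z, s) ≤ K := by
    rintro z ⟨W, hW, rfl⟩ s hs
    exact hK W hW s hs
  obtain ⟨N, hN, HF⟩ := FFs (n := n) hν
  obtain ⟨κ, hκ, hκ1, HB⟩ := BARs (n := n) hν (ε := 1 / 11) (tmin := 1) (T := 1) (by norm_num)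
    (by norm_num) one_pos
  apply hX1.2
  refine ⟨max K (N * (K / κ)), ?_⟩
  have hη : 0 < ε / 100 := by positivity
  filter_upwards [prod_mem_nhds (ball_mem_nhds x1 hη) (Ioo_mem_nhds (show t1 - ε / 100 < t1 by linarith)
    (show t1 < t1 + ε / 100 by linarith))]
  rintro ⟨x, t⟩ ⟨hx, ht⟩
  simp only [mem_Ioo, mem_ball] at hx ht
  by_cases hxZ : x ∈ Z
  · exact (hZK x hxZ t ⟨by linarith, by linarith⟩).trans (le_max_left _ _)
  refine le_trans ?_ (le_max_right _ _)
  obtain ⟨z, hzZ, hzd⟩ := hZc.exists_infDist_eq_dist ⟨x1, hx1Z⟩ x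
  set d := dist x z with hd
  have hd0 : 0 < d := dist_pos.2 fun h => hxZ (h ▸ hzZ)
  have hdmin : ∀ y ∈ Z, d ≤ dist x y := fun y hy => hzd ▸ infDist_le_dist_of_mem hy
  have hdε : d < ε / 100 := (hdmin x1 hx1Z).trans_lt hx
  have hd2 : d ^ 2 ≤ ε / 100 := by nlinarith
  set W := ball x d ×ˢ Ioo (t1 - ε) (t1 + ε) with hW
  have hWo : IsOpen W := isOpen_ball.prod isOpen_Ioo
  have hWb : W ⊆ closedBall x1 ε ×ˢ I := by
    rintro ⟨y, s⟩ ⟨hy, hs⟩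
    refine ⟨?_, hs.1.le, hs.2.le⟩
    simp only [mem_ball] at hy
    rw [mem_closedBall]
    linarith [dist_triangle y x x1]
  have hWV : W ⊆ V := hWb.trans hbV
  have hWbd : ∀ X ∈ W, ∃ B, ∀ᶠ Y in nhds X, u Y ≤ B := by
    intro X hX
    by_contra hc
    have h1 : X.1 ∈ Z := ⟨X, ⟨⟨hWV hX, hc⟩, hWb hX⟩, rfl⟩
    have h2 := hdmin _ h1
    have h3 := mem_ball.1 hX.1
    rw [dist_comm] at h3
    linarith
  have hSW : Sup ν u W := hSup.mono hWV
  have hSW' : Sup ν (fun X => - u X) W := A1 hν hWo (ha.mono hWV) (h.mono hWV).neg (by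
    simpa only [neg_neg] using hWbd)
  set r := d / 11 with hr
  have hr0 : 0 < r := by positivity
  have hr2 : r ^ 2 = d ^ 2 / 121 := by rw [hr]; ring
  have hd20 : 0 < d ^ 2 := by positivity
  have hboxW : closedBall x (r * 10) ×ˢ Icc (t + r ^ 2 * (-4)) (t + r ^ 2 * 9) ⊆ W := by
    refine prod_mono (closedBall_subset_ball (by rw [hr]; linarith)) ?_
    intro s hs
    rw [hr2] at hs
    exact ⟨by linarith [hs.1], by linarith [hs.2]⟩
  have hFF := HF u W x t r hr0 hSW hSW' (fun X hX => hpos X (hWV hX))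
    (LB ((isCompact_closedBall _ _).prod isCompact_Icc) fun X hX => hWbd X (hboxW hX)) hboxW
  have hxtV : (x, t) ∈ V := hWV ⟨mem_ball_self hd0, by simp only; linarith, by simp only; linarith⟩
  have hbox2 : closedBall x (d * 3) ×ˢ Icc (t + 9 * r ^ 2) (t + 9 * r ^ 2 + d ^ 2 * 1) ⊆ V := by
    refine Subset.trans ?_ hbV
    rintro ⟨y, s⟩ ⟨hy, hs⟩
    rw [hr2] at hs
    refine ⟨?_, by simp only; linarith [hs.1], by simp only; linarith [hs.2]⟩
    simp only [mem_closedBall] at hy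
    rw [mem_closedBall]
    simp only
    linarith [dist_triangle y x x1]
  have hBB := HB u x (t + 9 * r ^ 2) d (u (x, t) / N) hd0 (div_nonneg (hpos _ hxtV) hN.le)
    (hSup.mono hbox2) (fun X hX => hpos X (hbox2 hX)) (by
      intro y hy
      rw [div_le_iff₀' hN]
      refine hFF y (ball_subset_closedBall ?_)
      rw [hr]; convert hy using 2; ring) z (by
      rw [mem_closedBall, dist_comm]; linarith) (t + 9 * r ^ 2 + d ^ 2 * 1) ⟨le_rfl, le_rfl⟩
  have hzk := hZK z hzZ (t + 9 * r ^ 2 + d ^ 2 * 1) ⟨by rw [hr2]; linarith, by rw [hr2]; linarith⟩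
  have h5 : κ * (u (x, t) / N) ≤ K := hBB.trans hzk
  rw [← le_div_iff₀' hκ, div_le_iff₀' hN] at h5
  exact h5

/-- Basic Harnack step for nonnegative solutions. -/
theorem HStep {n : ℕ} {ν : ℝ} (hν : 0 < ν) : ∃ N : ℝ, 0 < N ∧
    ∀ (a : E n × ℝ → Fin n → Fin n → ℝ) (u : E n × ℝ → ℝ) (V : Set (E n × ℝ)), IsOpen V →
      IsParabolicCoeff ν a V → SolvesL a u V → (∀ X ∈ V, 0 ≤ u X) →
      ∀ (x : E n) (t r : ℝ), 0 < r →
      closedBall x (r * 10) ×ˢ Icc (t + r ^ 2 * (-4)) (t + r ^ 2 * 9) ⊆ V →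
      ∀ x' ∈ closedBall x r, u (x, t) ≤ N * u (x', t + 9 * r ^ 2) := by
  obtain ⟨N, hN, H⟩ := FFs (n := n) hν
  refine ⟨N, hN, fun a u V hV ha h hpos x t r hr hsub => ?_⟩
  have hbd := A2 hν hV ha h hpos
  refine H u V x t r hr (A1 hν hV ha h fun X hX =>
    ⟨0, by filter_upwards [hV.mem_nhds hX] with Y hY; linarith [hpos Y hY]⟩)
    (A1 hν hV ha h.neg (by simpa only [neg_neg] using hbd)) hpos
    (LB ((isCompact_closedBall _ _).prod isCompact_Icc) fun X hX => hbd X (hsub hX)) hsub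

theorem seg_frontier {α : Type*} [TopologicalSpace α] {s t : Set α} (hs : IsPreconnected s)
    (h1 : (s ∩ t).Nonempty) (h2 : (s ∩ tᶜ).Nonempty) : (s ∩ frontier t).Nonempty := by
  by_contra hc
  rw [not_nonempty_iff_eq_empty, eq_empty_iff_forall_notMem] at hc
  have hin : ∀ x ∈ s, x ∈ t → x ∈ interior t := by
    intro x hx hxt
    by_contra h
    exact hc x ⟨hx, subset_closure hxt, h⟩
  have hout : ∀ x ∈ s, x ∉ t → x ∈ (closure t)ᶜ := fun x hx hxt hcl =>
    hc x ⟨hx, hcl, fun h => hxt (interior_subset h)⟩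
  obtain ⟨y, hy, hyt⟩ := h1
  obtain ⟨z, hz, hzt⟩ := h2
  obtain ⟨w, hw, hw1, hw2⟩ := hs (interior t) (closure t)ᶜ isOpen_interior isClosed_closure.isOpen_compl
    (fun x hx => by
      by_cases h : x ∈ t
      · exact Or.inl (hin x hx h)
      · exact Or.inr (hout x hx h)) ⟨y, hy, hin y hy hyt⟩ ⟨z, hz, hout z hz hzt⟩
  exact hw2 (subset_closure (interior_subset hw1))

theorem inner_ball {n : ℕ} {Ω : Set (E n)} {δ : ℝ} {y : E n} (hy : y ∈ innerSet Ω δ) : ball y δ ⊆ Ω := by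
  intro z hz
  by_contra hzn
  have hseg : IsPreconnected (segment ℝ y z) := (convex_segment y z).isPreconnected
  obtain ⟨w, hw, hwf⟩ := seg_frontier (t := Ω) hseg ⟨y, left_mem_segment ℝ y z, hy.1⟩
    ⟨z, right_mem_segment ℝ y z, hzn⟩
  have h1 := infDist_le_dist_of_mem (x := y) hwf
  have h2 : w ∈ closedBall y (dist z y) := (convex_closedBall y (dist z y)).segment_subset
    (mem_closedBall_self dist_nonneg) (mem_closedBall.2 le_rfl) hw
  rw [mem_closedBall, dist_comm] at h2
  have h3 := hy.2
  rw [mem_ball] at hz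
  linarith

theorem seg_chain {n : ℕ} {N : ℝ} {u : E n × ℝ → ℝ} {V : Set (E n × ℝ)} (hN : 0 < N)
    (hstep : ∀ (x : E n) (t r : ℝ), 0 < r →
      closedBall x (r * 10) ×ˢ Icc (t + r ^ 2 * (-4)) (t + r ^ 2 * 9) ⊆ V →
      ∀ x' ∈ closedBall x r, u (x, t) ≤ N * u (x', t + 9 * r ^ 2))
    {δ T s t : ℝ} {x y : E n} (hδ : 0 < δ) (hV : ball y δ ×ˢ Ioo 0 T ⊆ V) (hxy : dist y x ≤ δ / 2)
    {k : ℕ} (hk : 0 < k) (hs : δ ^ 2 < s) (hst : s < t) (htT : t < T)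
    (hk1 : 9 * δ ^ 2 ≤ 4 * (k * (t - s))) (hk2 : 400 * (t - s) < 9 * k * δ ^ 2) :
    u (y, s) ≤ N ^ k * u (x, t) := by
  have hk0 : (0:ℝ) < k := by exact_mod_cast hk
  have hts : 0 < t - s := by linarith
  set r := Real.sqrt ((t - s) / (9 * k)) with hr
  have hr2 : r ^ 2 = (t - s) / (9 * k) := Real.sq_sqrt (by positivity)
  have hr0 : 0 < r := Real.sqrt_pos.2 (by positivity)
  have hr9 : 9 * r ^ 2 * k = t - s := by rw [hr2]; field_simp
  have hr10 : r * 10 < δ / 2 := by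
    refine lt_of_pow_lt_pow_left₀ 2 (by positivity) ?_
    have : 3600 * (r ^ 2) * k < 9 * δ ^ 2 * k := by nlinarith
    have := lt_of_mul_lt_mul_right this hk0.le
    nlinarith
  have hr4 : 4 * r ^ 2 ≤ δ ^ 2 := by nlinarith
  have hlen : dist y x / k ≤ r := by
    rw [div_le_iff₀ hk0]
    refine hxy.trans ?_
    refine (abs_le_of_sq_le_sq' ?_ (by positivity)).2
    have h1 : (r * k) ^ 2 * 9 = k * (t - s) := by rw [← hr9]; ring
    nlinarith
  have main : ∀ i : ℕ, i ≤ k → u (y, s) ≤ N ^ i * u (y + ((i:ℝ) / k) • (x - y), s + i * (9 * r ^ 2)) := by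
    intro i
    induction i with
    | zero => intro _; simp
    | succ i ih =>
      intro hi
      have hik : (i:ℝ) + 1 ≤ k := by exact_mod_cast hi
      have hi0 : (0:ℝ) ≤ i := i.cast_nonneg
      refine (ih (by omega)).trans ?_
      rw [pow_succ N i, mul_assoc]
      refine mul_le_mul_of_nonneg_left ?_ (by positivity)
      have hr20 : 0 < r ^ 2 := by positivity
      have := hstep (y + ((i:ℝ) / k) • (x - y)) (s + i * (9 * r ^ 2)) r hr0 ?_
        (y + (((i + 1 : ℕ):ℝ) / k) • (x - y)) ?_
      · have e : s + (i:ℝ) * (9 * r ^ 2) + 9 * r ^ 2 = s + ((i + 1 : ℕ):ℝ) * (9 * r ^ 2) := by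
          push_cast; ring
        rw [e] at this
        exact this
      · refine Subset.trans ?_ hV
        rintro ⟨z, w⟩ ⟨hz, hw⟩
        simp only [mem_closedBall, mem_Icc] at hz hw
        refine ⟨?_, ?_, ?_⟩
        · simp only [mem_ball]
          have h1 : dist (y + ((i:ℝ) / k) • (x - y)) y ≤ δ / 2 := by
            rw [dist_eq_norm, add_sub_cancel_left, norm_smul, ← dist_eq_norm, dist_comm x y,
              Real.norm_of_nonneg (by positivity)]
            refine le_trans (mul_le_of_le_one_left dist_nonneg ?_) hxy
            rw [div_le_one hk0]; linarith
          linarith [dist_triangle z (y + ((i:ℝ) / k) • (x - y)) y]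
        · simp only
          have : 0 ≤ (i:ℝ) * (9 * r ^ 2) := by positivity
          linarith [hw.1]
        · simp only
          have : ((i:ℝ) + 1) * (9 * r ^ 2) ≤ k * (9 * r ^ 2) := by gcongr
          linarith [hw.2]
      · rw [mem_closedBall, dist_eq_norm]
        have e : y + (((i + 1 : ℕ):ℝ) / k) • (x - y) - (y + ((i:ℝ) / k) • (x - y)) = (1 / (k:ℝ)) • (x - y) := by
          rw [add_sub_add_left_eq_sub, ← sub_smul]; congr 1; push_cast; ring
        rw [e, norm_smul, ← dist_eq_norm, dist_comm x y, Real.norm_of_nonneg (by positivity)]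
        refine le_trans (le_of_eq ?_) hlen
        ring
  have := main k le_rfl
  rw [div_self hk0.ne', one_smul, add_sub_cancel] at this
  convert this using 4
  linarith

theorem coarse_chain (n : ℕ) (lam : ℝ) : ∃ M : ℕ, ∀ (S : Set (E n)) (δ : ℝ), 0 < δ → IsPreconnected S →
    (∀ x ∈ S, ∀ y ∈ S, dist x y ≤ lam * δ) → ∀ y ∈ S, ∀ x ∈ S, ∃ w : ℕ → E n, w 0 = y ∧ w (M + 2) = x ∧
      (∀ i, w i ∈ S) ∧ ∀ i < M + 2, dist (w i) (w (i + 1)) ≤ δ / 2 := by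
  obtain ⟨t, -, htf, htc⟩ := (isCompact_closedBall (0 : E n) lam).finite_cover_balls
    (e := 1 / 8) (by norm_num)
  haveI : Fintype t := htf.fintype
  refine ⟨Fintype.card t, fun S δ hδ hS hd y hy x hx => ?_⟩
  set Bc : E n → Set (E n) := fun c => ball (y + δ • c) (δ / 8) with hBc
  have hcov : ∀ z ∈ S, ∃ c ∈ t, z ∈ Bc c := by
    intro z hz
    have h1 : δ⁻¹ • (z - y) ∈ closedBall (0 : E n) lam := by
      rw [mem_closedBall_zero_iff, norm_smul, norm_inv, Real.norm_of_nonneg hδ.le, inv_mul_le_iff₀ hδ,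
        ← dist_eq_norm, mul_comm]
      exact hd z hz y hy
    have h2 := htc h1
    simp only [mem_iUnion] at h2
    obtain ⟨c, hc, h3⟩ := h2
    refine ⟨c, hc, ?_⟩
    rw [mem_ball, dist_eq_norm] at h3 ⊢
    have e : z - (y + δ • c) = δ • (δ⁻¹ • (z - y) - c) := by
      rw [smul_sub, smul_smul, mul_inv_cancel₀ hδ.ne', one_smul]; abel
    rw [e, norm_smul, Real.norm_of_nonneg hδ.le]
    nlinarith
  classical
  set ι := {c : t // (S ∩ Bc c.1).Nonempty} with hι
  choose p hp using fun c : ι => c.2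
  let G : SimpleGraph ι :=
    { Adj := fun c c' => c ≠ c' ∧ dist (p c) (p c') ≤ δ / 2
      symm := ⟨fun c c' h => ⟨h.1.symm, by rw [dist_comm]; exact h.2⟩⟩
      loopless := ⟨fun c h => h.1 rfl⟩ }
  have hnear : ∀ (c : ι) (q : E n), q ∈ Bc c.1.1 → dist q (p c) < δ / 4 := by
    intro c q hq
    have h1 := mem_ball.1 (hp c).2
    have h2 := mem_ball.1 hq
    have := dist_triangle_right q (p c) (y + δ • c.1.1)
    linarith
  obtain ⟨cy, hcyt, hcy⟩ := hcov y hy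
  set c0 : ι := ⟨⟨cy, hcyt⟩, y, hy, hcy⟩ with hc0
  set U := ⋃ c ∈ {c : ι | G.Reachable c0 c}, Bc c.1.1 with hU
  set W := ⋃ c ∈ {c : ι | ¬ G.Reachable c0 c}, Bc c.1.1 with hW
  have hUo : IsOpen U := isOpen_biUnion fun c _ => isOpen_ball
  have hWo : IsOpen W := isOpen_biUnion fun c _ => isOpen_ball
  have hxU : ∃ cx : ι, x ∈ Bc cx.1.1 ∧ G.Reachable c0 cx := by
    obtain ⟨cx, hcxt, hcx⟩ := hcov x hx
    refine ⟨⟨⟨cx, hcxt⟩, x, hx, hcx⟩, hcx, ?_⟩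
    by_contra hnr
    obtain ⟨q, hqS, hqU, hqW⟩ := hS U W hUo hWo (by
      intro z hz
      obtain ⟨c, hct, hc⟩ := hcov z hz
      by_cases hr : G.Reachable c0 ⟨⟨c, hct⟩, z, hz, hc⟩
      · exact Or.inl (mem_iUnion₂.2 ⟨⟨⟨c, hct⟩, z, hz, hc⟩, hr, hc⟩)
      · exact Or.inr (mem_iUnion₂.2 ⟨⟨⟨c, hct⟩, z, hz, hc⟩, hr, hc⟩))
      ⟨y, hy, mem_iUnion₂.2 ⟨c0, SimpleGraph.Reachable.refl c0, hcy⟩⟩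
      ⟨x, hx, mem_iUnion₂.2 ⟨⟨⟨cx, hcxt⟩, x, hx, hcx⟩, hnr, hcx⟩⟩
    obtain ⟨c, hc, hqc⟩ := mem_iUnion₂.1 hqU
    obtain ⟨c', hc', hqc'⟩ := mem_iUnion₂.1 hqW
    have h1 := hnear c q hqc
    have h2 := hnear c' q hqc'
    apply hc'
    refine SimpleGraph.Reachable.trans hc (SimpleGraph.Adj.reachable ⟨?_, ?_⟩)
    · rintro rfl; exact hc' hc
    · linarith [dist_triangle_left (p c) (p c') q]
  obtain ⟨cx, hxB, hreach⟩ := hxU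
  obtain ⟨wk, hpath⟩ := hreach.exists_isPath
  have hlen : wk.length ≤ Fintype.card t := by
    have h1 := hpath.length_lt
    have h2 : Fintype.card ι ≤ Fintype.card t := Fintype.card_subtype_le _
    omega
  set M := Fintype.card t with hM
  refine ⟨fun i => if i = 0 then y else if i = M + 2 then x else p (wk.getVert (i - 1)), by simp, by simp,
    ?_, ?_⟩
  · intro i
    simp only
    split_ifs
    · exact hy
    · exact hx
    · exact (hp _).1
  · intro i hi
    rcases Nat.eq_zero_or_pos i with h0 | hpos
    · subst h0
      have e : ¬ (0 + 1 = M + 2) := by omega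
      simp only [if_pos, e, if_false, Nat.add_eq_zero_iff, one_ne_zero, and_false]
      have := hnear c0 y hcy
      simp only [Nat.zero_add, Nat.sub_self, SimpleGraph.Walk.getVert_zero]
      linarith
    · have e1 : ¬ i = 0 := by omega
      have e2 : ¬ i = M + 2 := by omega
      have e3 : ¬ i + 1 = 0 := by omega
      simp only [e1, e2, e3, if_false]
      by_cases hl : i + 1 = M + 2
      · simp only [hl, if_true]
        rw [SimpleGraph.Walk.getVert_of_length_le _ (by omega)]
        have := hnear cx x hxB
        rw [dist_comm] at this
        linarith
      · simp only [hl, if_false]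
        by_cases hlt : i - 1 < wk.length
        · have := wk.adj_getVert_succ hlt
          rw [show i - 1 + 1 = i by omega] at this
          rw [show i + 1 - 1 = i by omega]
          exact this.2
        · rw [SimpleGraph.Walk.getVert_of_length_le _ (by omega),
            SimpleGraph.Walk.getVert_of_length_le _ (by omega), dist_self]
          linarith

/-- **Theorem 2.2** (Harnack inequality): if `u ≥ 0` solves `Lu = 0` in the bounded
cylinder `Q = Ω × (0,T)`, `Ω^δ` is connected, `diam Ω ≤ λδ` and `T ≤ λδ²`, then
`u(Y) ≤ N u(X)` for all `X = (x,t), Y = (y,s) ∈ Q^δ = Ω^δ × (δ², T)` with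
`t - s ≥ δ²`, where `N = N(n, ν, λ)`. -/
theorem harnack_inequality (n : ℕ) (hn : 1 ≤ n) (ν : ℝ) (hν : ν ∈ Ioc (0 : ℝ) 1)
    (lam : ℝ) (hlam : 0 < lam) :
    ∃ N : ℝ, 0 < N ∧
      ∀ (Ω : Set (E n)), IsOpen Ω → Ω.Nonempty → IsConnected Ω →
        Bornology.IsBounded Ω →
      ∀ (T δ : ℝ), 0 < δ → 0 < T →
        IsConnected (innerSet Ω δ) → Metric.diam Ω ≤ lam * δ → T ≤ lam * δ ^ 2 →
      ∀ (a : E n × ℝ → Fin n → Fin n → ℝ),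
        IsParabolicCoeff ν a (closure (Ω ×ˢ Ioo (0 : ℝ) T)) →
      ∀ u : E n × ℝ → ℝ, SolvesL a u (Ω ×ˢ Ioo (0 : ℝ) T) →
        (∀ X ∈ Ω ×ˢ Ioo (0 : ℝ) T, 0 ≤ u X) →
      ∀ X ∈ innerSet Ω δ ×ˢ Ioo (δ ^ 2) T, ∀ Y ∈ innerSet Ω δ ×ˢ Ioo (δ ^ 2) T,
        X.2 - Y.2 ≥ δ ^ 2 → u Y ≤ N * u X := by
  obtain ⟨N, hN, HS⟩ := HStep (n := n) hν.1
  obtain ⟨M, HM⟩ := coarse_chain n lam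
  obtain ⟨k, hk⟩ := exists_nat_gt (3 * ((M:ℝ) + 2) + 400 * lam)
  have hM0 : (0:ℝ) ≤ M := M.cast_nonneg
  have hk0 : 0 < k := by
    have : (0:ℝ) < k := by linarith
    exact_mod_cast this
  have hkr : (0:ℝ) < k := by exact_mod_cast hk0
  refine ⟨(N ^ k) ^ (M + 2), by positivity, ?_⟩
  intro Ω hΩ _ _ hbd T δ hδ hT hconn hdiam hTl a ha u hu hpos X hX Y hY hXY
  obtain ⟨x, t⟩ := X
  obtain ⟨y, s⟩ := Y
  simp only [mem_prod, mem_Ioo] at hX hY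
  simp only at hXY
  have hδ2 : 0 < δ ^ 2 := by positivity
  have hst := HS a u (Ω ×ˢ Ioo (0 : ℝ) T) (hΩ.prod isOpen_Ioo) (ha.mono subset_closure) hu hpos
  obtain ⟨w, hw0, hwM, hwS, hwd⟩ := HM (innerSet Ω δ) δ hδ hconn.isPreconnected
    (fun p hp q hq => (dist_le_diam_of_mem hbd hp.1 hq.1).trans hdiam) y hY.1 x hX.1
  set τ := (t - s) / ((M:ℝ) + 2) with hτ
  have hM2 : (0:ℝ) < (M:ℝ) + 2 := by linarith
  have hτm : τ * ((M:ℝ) + 2) = t - s := by rw [hτ]; field_simp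
  have hτ0 : 0 < τ := div_pos (by linarith) hM2
  have hτT : τ ≤ lam * δ ^ 2 := by
    have : τ * 1 ≤ τ * ((M:ℝ) + 2) := by gcongr; linarith
    linarith [hX.2.2, hY.2.1]
  have main : ∀ i : ℕ, i ≤ M + 2 → u (y, s) ≤ (N ^ k) ^ i * u (w i, s + i * τ) := by
    intro i
    induction i with
    | zero => intro _; simp [hw0]
    | succ i ih =>
      intro hi
      have hik : (i:ℝ) + 1 ≤ (M:ℝ) + 2 := by exact_mod_cast hi
      have hi0 : (0:ℝ) ≤ i := i.cast_nonneg
      refine (ih (by omega)).trans ?_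
      rw [pow_succ (N ^ k) i, mul_assoc]
      refine mul_le_mul_of_nonneg_left ?_ (by positivity)
      have h1 : 0 ≤ (i:ℝ) * τ := by positivity
      have h2 : ((i:ℝ) + 1) * τ ≤ ((M:ℝ) + 2) * τ := by gcongr
      have hdiff : s + ((i + 1 : ℕ):ℝ) * τ - (s + i * τ) = τ := by push_cast; ring
      refine seg_chain (T := T) hN hst hδ (prod_mono (inner_ball (hwS i)) subset_rfl)
        (hwd i (by omega)) hk0 (by linarith [hY.2.1]) (by linarith)
        (by push_cast; linarith [hX.2.2]) ?_ ?_
      · rw [hdiff]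
        have h3 : δ ^ 2 ≤ τ * ((M:ℝ) + 2) := by linarith
        have h4 : 3 * ((M:ℝ) + 2) * τ ≤ k * τ := by gcongr; linarith
        linarith
      · rw [hdiff]
        have h3 : 400 * lam * δ ^ 2 < k * δ ^ 2 := by gcongr; linarith
        linarith
  have := main (M + 2) le_rfl
  rw [hwM] at this
  convert this using 4
  push_cast; linarith
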